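/- Let a ≥ 3 be an integer and let Z be a general set of o(a) = (3/2)a(a−1) + a + 1 points on a smooth cubic surface X ⊂ ℙ³. Then the graded minimal free resolution of the saturated ideal I_Z over R is 0 → R(−a−3)^{a} → R(−a−1)^{3a−3} ⊕ R(−a−2)^{3} → R(−a)^{2a} ⊕ R(−3) → I_Z → 0. -/

import Mathlib

/-!
Common definitions for formalizing "The minimal resolution conjecture for points
on the cubic surface" (arXiv:math/0611137).

We work with `R = k[x₀,x₁,x₂,x₃]`, closed points of `ℙ³` modeled by
`Projectivization k (Fin 4 → k)`, saturated ideals of sets of points as vanishing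
ideals, genericity expressed by a nonempty basic open subset of the configuration
space, and graded minimal free resolutions expressed by explicit homogeneous
matrices whose entries have zero constant term (no nonzero scalar entries).
-/

open MvPolynomial

noncomputable section

/-- The polynomial ring `R = k[x₀,x₁,x₂,x₃]` in four variables over `k`. -/
abbrev R4 (k : Type) [Field k] : Type := MvPolynomial (Fin 4) k

/-- The (closed) points of the projective space `ℙ³` over `k`. -/
abbrev P3 (k : Type) [Field k] : Type := Projectivization k (Fin 4 → k)

variable (k : Type) [Field k]

/-- A polynomial vanishes at a projective point if it vanishes at every
representative vector of that point. -/
def VanishesAt (f : R4 k) (p : P3 k) : Prop :=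
  ∀ (v : Fin 4 → k) (hv : v ≠ 0), Projectivization.mk k v hv = p → eval v f = 0

/-- The saturated homogeneous ideal `I_Z ⊆ R` of a set `Z` of (reduced) points of
`ℙ³`: all polynomials vanishing at every point of `Z`. -/
def pointsIdeal (Zs : Set (P3 k)) : Ideal (R4 k) where
  carrier := {f | ∀ p ∈ Zs, VanishesAt k f p}
  zero_mem' := by
    intro p _ v hv _
    simp
  add_mem' := by
    intro a b ha hb p hp v hv hmk
    have h1 := ha p hp v hv hmk
    have h2 := hb p hp v hv hmk
    simp [h1, h2]
  smul_mem' := by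
    intro c a ha p hp v hv hmk
    have h1 := ha p hp v hv hmk
    simp [smul_eq_mul, h1]

/-- An ideal of `R` is homogeneous if it is generated by homogeneous elements. -/
def IsHomogIdeal (I : Ideal (R4 k)) : Prop :=
  ∃ G : Set (R4 k), (∀ g ∈ G, ∃ d : ℕ, g.IsHomogeneous d) ∧ I = Ideal.span G

/-- Saturation of an ideal with respect to the irrelevant maximal ideal
`(x₀,…,x₃)`. -/
def satIdeal (I : Ideal (R4 k)) : Ideal (R4 k) where
  carrier := {g | ∀ i : Fin 4, ∃ N : ℕ, (X i : R4 k) ^ N * g ∈ I}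
  zero_mem' := by
    intro i
    exact ⟨0, by simp⟩
  add_mem' := by
    intro a b ha hb i
    obtain ⟨N, hN⟩ := ha i
    obtain ⟨M, hM⟩ := hb i
    refine ⟨N + M, ?_⟩
    have h1 : (X i : R4 k) ^ (N + M) * (a + b)
        = X i ^ M * (X i ^ N * a) + X i ^ N * (X i ^ M * b) := by ring
    rw [h1]
    exact Ideal.add_mem _ (Ideal.mul_mem_left _ _ hN) (Ideal.mul_mem_left _ _ hM)
  smul_mem' := by
    intro c a ha i
    obtain ⟨N, hN⟩ := ha i
    refine ⟨N, ?_⟩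
    have h1 : (X i : R4 k) ^ N * (c • a) = c * (X i ^ N * a) := by
      rw [smul_eq_mul]; ring
    rw [h1]
    exact Ideal.mul_mem_left _ _ hN

/-- The colon ideal `(I : J) = {r | r·J ⊆ I}`. -/
def icolon (I J : Ideal (R4 k)) : Ideal (R4 k) where
  carrier := {r | ∀ x ∈ J, r * x ∈ I}
  zero_mem' := by
    intro x hx
    rw [zero_mul]; exact I.zero_mem
  add_mem' := by
    intro a b ha hb x hx
    rw [add_mul]
    exact Ideal.add_mem _ (ha x hx) (hb x hx)
  smul_mem' := by
    intro c a ha x hx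
    rw [smul_eq_mul, mul_assoc]
    exact Ideal.mul_mem_left _ _ (ha x hx)

/-- A smooth cubic surface `X ⊂ ℙ³`: an irreducible homogeneous cubic form with
no singular zero (Jacobian criterion). -/
structure SmoothCubicSurface (k : Type) [Field k] : Type where
  f : MvPolynomial (Fin 4) k
  homog : f.IsHomogeneous 3
  irred : Irreducible f
  smooth : ∀ v : Fin 4 → k, v ≠ 0 → eval v f = 0 →
    ∃ i : Fin 4, eval v (pderiv i f) ≠ 0

/-- A configuration of `t` distinct points lying on `X`. -/
def ConfigOn (S : SmoothCubicSurface k) {t : ℕ} (Z : Fin t → P3 k) : Prop :=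
  Function.Injective Z ∧ ∀ i, VanishesAt k S.f (Z i)

/-- A configuration avoids the (closed locus of the) polynomial `g` on the
product of the affine cones: some choice of representatives does not annihilate `g`. -/
def Avoids {t : ℕ} (g : MvPolynomial (Fin t × Fin 4) k) (Z : Fin t → P3 k) : Prop :=
  ∃ v : Fin t → Fin 4 → k,
    (∀ i, ∃ hv : v i ≠ 0, Projectivization.mk k (v i) hv = Z i) ∧
    eval (fun q : Fin t × Fin 4 => v q.1 q.2) g ≠ 0

/-- `P` holds for a *general* set of `t` points on `X`: it holds on a nonempty
(basic) Zariski-open subset of the family of all sets of `t` points of `X`. -/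
def GeneralPointsSatisfy (S : SmoothCubicSurface k) (t : ℕ)
    (P : (Fin t → P3 k) → Prop) : Prop :=
  ∃ g : MvPolynomial (Fin t × Fin 4) k,
    (∃ Z : Fin t → P3 k, ConfigOn k S Z ∧ Avoids k g Z) ∧
    (∀ Z : Fin t → P3 k, ConfigOn k S Z → Avoids k g Z → P Z)

/-- An admissible entry of a matrix in a graded **minimal** free resolution,
mapping a generator of degree `d` into a generator of degree `e`: the entry is
homogeneous of degree `d - e`, and it is not a nonzero scalar (zero constant
coefficient). -/
def EntryOk (d e : ℕ) (q : R4 k) : Prop :=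
  (q = 0 ∨ ∃ c : ℕ, d = e + c ∧ q.IsHomogeneous c) ∧ coeff 0 q = 0

/-- Integer-degree version of `EntryOk` (for modules with generators of
arbitrary integer degrees). -/
def EntryOkZ (d e : ℤ) (q : R4 k) : Prop :=
  (q = 0 ∨ ∃ c : ℕ, d = e + (c : ℤ) ∧ q.IsHomogeneous c) ∧ coeff 0 q = 0

/-- The body of a graded minimal free resolution of length 2 over `R` of the
`R`-module `I/J`:
`0 → ⊕ R(-d2 i) --M2--> ⊕ R(-d1 j) --g--> I/J → 0`.
The generators `g j ∈ I` are homogeneous of degree `d1 j` and generate `I` mod `J`;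
`M2` is a homogeneous matrix with no nonzero scalar entries whose rows generate the
kernel, and which is injective. -/
def Res2Body (J I : Ideal (R4 k)) {n1 n2 : ℕ}
    (d1 : Fin n1 → ℕ) (d2 : Fin n2 → ℕ)
    (g : Fin n1 → R4 k) (M2 : Fin n2 → Fin n1 → R4 k) : Prop :=
  (∀ j, g j ∈ I ∧ (g j).IsHomogeneous (d1 j)) ∧
  (∀ x ∈ I, ∃ w : Fin n1 → R4 k, x - ∑ j, w j * g j ∈ J) ∧
  (∀ i j, EntryOk k (d2 i) (d1 j) (M2 i j)) ∧
  (∀ w : Fin n1 → R4 k,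
    ((∑ j, w j * g j) ∈ J) ↔ ∃ u : Fin n2 → R4 k, ∀ j, w j = ∑ i, u i * M2 i j) ∧
  (∀ u : Fin n2 → R4 k, (∀ j, (∑ i, u i * M2 i j) = 0) → u = 0)

/-- `I/J` has a graded minimal free resolution
`0 → ⊕ R(-d2 i) → ⊕ R(-d1 j) → I/J → 0` over `R`. -/
def HasMinFreeRes2 (J I : Ideal (R4 k)) {n1 n2 : ℕ}
    (d1 : Fin n1 → ℕ) (d2 : Fin n2 → ℕ) : Prop :=
  ∃ (g : Fin n1 → R4 k) (M2 : Fin n2 → Fin n1 → R4 k), Res2Body k J I d1 d2 g M2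

/-- The body of a graded minimal free resolution of length 3 over `R` of the
`R`-module `I/J`:
`0 → ⊕ R(-d3 l) --M3--> ⊕ R(-d2 i) --M2--> ⊕ R(-d1 j) --g--> I/J → 0`. -/
def Res3Body (J I : Ideal (R4 k)) {n1 n2 n3 : ℕ}
    (d1 : Fin n1 → ℕ) (d2 : Fin n2 → ℕ) (d3 : Fin n3 → ℕ)
    (g : Fin n1 → R4 k) (M2 : Fin n2 → Fin n1 → R4 k)
    (M3 : Fin n3 → Fin n2 → R4 k) : Prop :=
  (∀ j, g j ∈ I ∧ (g j).IsHomogeneous (d1 j)) ∧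
  (∀ x ∈ I, ∃ w : Fin n1 → R4 k, x - ∑ j, w j * g j ∈ J) ∧
  (∀ i j, EntryOk k (d2 i) (d1 j) (M2 i j)) ∧
  (∀ i j, EntryOk k (d3 i) (d2 j) (M3 i j)) ∧
  (∀ w : Fin n1 → R4 k,
    ((∑ j, w j * g j) ∈ J) ↔ ∃ u : Fin n2 → R4 k, ∀ j, w j = ∑ i, u i * M2 i j) ∧
  (∀ u : Fin n2 → R4 k,
    (∀ j, (∑ i, u i * M2 i j) = 0) ↔ ∃ t : Fin n3 → R4 k, ∀ i, u i = ∑ l, t l * M3 l i) ∧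
  (∀ t : Fin n3 → R4 k, (∀ i, (∑ l, t l * M3 l i) = 0) → t = 0)

/-- `I/J` has a graded minimal free resolution
`0 → ⊕ R(-d3 l) → ⊕ R(-d2 i) → ⊕ R(-d1 j) → I/J → 0` over `R`.
Taking `J = ⊥` this is a resolution of the ideal `I ⊆ R`; taking `J = (f)` it is a
resolution of `I/(f) ⊆ R_X = R/(f)`; taking `J = I_C` a resolution of `I/I_C`. -/
def HasMinFreeRes3 (J I : Ideal (R4 k)) {n1 n2 n3 : ℕ}
    (d1 : Fin n1 → ℕ) (d2 : Fin n2 → ℕ) (d3 : Fin n3 → ℕ) : Prop :=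
  ∃ (g : Fin n1 → R4 k) (M2 : Fin n2 → Fin n1 → R4 k) (M3 : Fin n3 → Fin n2 → R4 k),
    Res3Body k J I d1 d2 d3 g M2 M3

/-- The Betti numbers read off from a minimal free resolution
`0 → F₃ → F₂ → F₁ → I_Z → 0` of the ideal of `Z` (so that
`F_i = ⊕_j R(-i-j)^{b_{i,j}}` in the resolution of `R/I_Z`, with `F₀ = R`). -/
def bettiCount {n1 n2 n3 : ℕ} (d1 : Fin n1 → ℕ) (d2 : Fin n2 → ℕ) (d3 : Fin n3 → ℕ)
    (i j : ℕ) : ℕ :=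
  if i = 0 then (if j = 0 then 1 else 0)
  else if i = 1 then (Finset.univ.filter fun l => d1 l = 1 + j).card
  else if i = 2 then (Finset.univ.filter fun l => d2 l = 2 + j).card
  else if i = 3 then (Finset.univ.filter fun l => d3 l = 3 + j).card
  else 0

/-- The Hilbert polynomial `P_X(t) = (3/2)t(t+1) + 1` of the cubic surface. -/
def PXcubic (t : ℕ) : ℕ := 3 * (t * (t + 1) / 2) + 1

/-- The saturated homogeneous ideal of an integral curve lying on `X`. -/
def IsCurveIdealOn (S : SmoothCubicSurface k) (I : Ideal (R4 k)) : Prop :=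
  IsHomogIdeal k I ∧ I.IsPrime ∧ S.f ∈ I ∧
    ringKrullDim (R4 k ⧸ I) = ((2 : ℕ∞) : WithBot ℕ∞)

/-- The Jacobian criterion at a point of the cone: some 2×2 minor of the Jacobian
matrix of elements of `I` is nonzero, i.e. the curve is smooth there. -/
def CurveSmoothAt (I : Ideal (R4 k)) (v : Fin 4 → k) : Prop :=
  ∃ g₁ ∈ I, ∃ g₂ ∈ I, ∃ i j : Fin 4,
    eval v (pderiv i g₁) * eval v (pderiv j g₂)
      - eval v (pderiv j g₁) * eval v (pderiv i g₂) ≠ 0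

/-- A smooth (integral) curve on `X`. -/
def IsSmoothCurveIdealOn (S : SmoothCubicSurface k) (I : Ideal (R4 k)) : Prop :=
  IsCurveIdealOn k S I ∧
  ∀ v : Fin 4 → k, v ≠ 0 → (∀ g ∈ I, eval v g = 0) → CurveSmoothAt k I v

/-- The coordinate ring `R/I` of a curve has depth 2 (a regular sequence of two
positive-degree homogeneous elements), i.e. the curve is arithmetically
Cohen–Macaulay. -/
def IsACMIdeal (I : Ideal (R4 k)) : Prop :=
  ∃ r₁ r₂ : R4 k,
    (∃ d₁ : ℕ, 0 < d₁ ∧ r₁.IsHomogeneous d₁) ∧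
    (∃ d₂ : ℕ, 0 < d₂ ∧ r₂.IsHomogeneous d₂) ∧
    (∀ x : R4 k, r₁ * x ∈ I → x ∈ I) ∧
    (∀ x : R4 k, r₂ * x ∈ I ⊔ Ideal.span {r₁} → x ∈ I ⊔ Ideal.span {r₁})

/-- The Hilbert function `t ↦ dim_k (R/I)_t`. -/
def hilbFn (I : Ideal (R4 k)) (t : ℕ) : ℕ :=
  Module.finrank k ↥(homogeneousSubmodule (Fin 4) k t) -
    Module.finrank k ↥(homogeneousSubmodule (Fin 4) k t ⊓
      Submodule.restrictScalars k I)

/-- The subscheme with saturated ideal `I` has degree `d` and (arithmetic) genus `g`,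
read off from the Hilbert polynomial `P(t) = d·t + 1 - g`. -/
def HasDegreeGenus (I : Ideal (R4 k)) (d : ℕ) (g : ℤ) : Prop :=
  ∃ N : ℕ, ∀ t : ℕ, N ≤ t → (hilbFn k I t : ℤ) = d * t + 1 - g

/-- Linear equivalence of divisors on `X`: the divisor with (divisorial) ideal `I`
is linearly equivalent to (divisor of `J`) + `a·H`, where `H` is the hyperplane
class.  Concretely, there are homogeneous forms `q, p` with `deg p = deg q + a`,
nonzero on `X`, with `q·I = p·J` in `R_X = R/(f)`.  (Taking `J = ⊤` expresses
that the divisor of `I` is linearly equivalent to `aH`.) -/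
def LinEquivOnX (S : SmoothCubicSurface k) (I J : Ideal (R4 k)) (a : ℤ) : Prop :=
  ∃ (mq mp : ℕ) (q p : R4 k), (mp : ℤ) = (mq : ℤ) + a ∧
    q.IsHomogeneous mq ∧ p.IsHomogeneous mp ∧
    q ∉ Ideal.span {S.f} ∧ p ∉ Ideal.span {S.f} ∧
    Ideal.span {q} * I ⊔ Ideal.span {S.f} = Ideal.span {p} * J ⊔ Ideal.span {S.f}

/-- Linear equivalence, on the curve `C` with ideal `IC`, of the divisor with
ideal `IG` to `r·H_C` (`H_C` the hyperplane section of `C`): there are homogeneous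
forms `q, p`, nonzero on `C`, with `deg p = deg q + r` and `q·I_{G,C} = (p)` in
`R/I_C`. -/
def DivOnCurveEquivH (IC IG : Ideal (R4 k)) (r : ℤ) : Prop :=
  ∃ (mq mp : ℕ) (q p : R4 k), (mp : ℤ) = (mq : ℤ) + r ∧
    q.IsHomogeneous mq ∧ p.IsHomogeneous mp ∧ q ∉ IC ∧ p ∉ IC ∧
    Ideal.span {q} * IG ⊔ IC = Ideal.span {p} ⊔ IC

/-- The saturated homogeneous ideal of a zero-dimensional subscheme of `ℙ³`. -/
def IsZeroDimIdeal (I : Ideal (R4 k)) : Prop :=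
  IsHomogIdeal k I ∧ satIdeal k I = I ∧
    ringKrullDim (R4 k ⧸ I) = ((1 : ℕ∞) : WithBot ℕ∞)

/-- An arithmetically Gorenstein zero-dimensional subscheme of `ℙ³`: its ideal has a
graded minimal free resolution of length 3 whose last free module has rank one. -/
def IsAGPointsIdeal (I : Ideal (R4 k)) : Prop :=
  IsZeroDimIdeal k I ∧
  ∃ (n1 n2 : ℕ) (d1 : Fin n1 → ℕ) (d2 : Fin n2 → ℕ) (s : ℕ),
    HasMinFreeRes3 k ⊥ I d1 d2 (fun _ : Fin 1 => s)

/-- `V₁` and `V₂` are directly Gorenstein linked by the arithmetically Gorenstein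
scheme with ideal `IG`: `I_G ⊆ I_{V₁} ∩ I_{V₂}`, `I_G : I_{V₁} = I_{V₂}` and
`I_G : I_{V₂} = I_{V₁}`. -/
def IsGLinked (IG I1 I2 : Ideal (R4 k)) : Prop :=
  IG ≤ I1 ⊓ I2 ∧ icolon k IG I1 = I2 ∧ icolon k IG I2 = I1

/-- The divisor `G` (with ideal `IG`) on the curve `C ⊂ X` (with ideal `IC`) is
linearly equivalent to `m·H_C - K_C`.  By adjunction on the cubic surface
(`K_X = -H`) this says `G + C|_C ∼ (m+1)·H_C` on `C`, where `C|_C` is realized as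
the scheme-theoretic intersection `C ∩ C'` with any curve `C' ∼ C`, `C' ≠ C`,
chosen disjoint from `G`. -/
def EquivHminusKC (S : SmoothCubicSurface k) (IC IG : Ideal (R4 k)) (m : ℤ) : Prop :=
  ∃ IC' : Ideal (R4 k), IsCurveIdealOn k S IC' ∧ IC' ≠ IC ∧
    LinEquivOnX k S IC' IC 0 ∧
    satIdeal k (satIdeal k (IC ⊔ IC') ⊔ IG) = ⊤ ∧
    DivOnCurveEquivH k IC (IG ⊓ satIdeal k (IC ⊔ IC')) (m + 1)

/-- A line on `X`: a smooth integral curve of degree 1, genus 0 on `X`. -/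
def IsLineOn (S : SmoothCubicSurface k) (I : Ideal (R4 k)) : Prop :=
  IsSmoothCurveIdealOn k S I ∧ HasDegreeGenus k I 1 0

/-- A smooth conic on `X`: a smooth integral curve of degree 2, genus 0 on `X`. -/
def IsConicOn (S : SmoothCubicSurface k) (I : Ideal (R4 k)) : Prop :=
  IsSmoothCurveIdealOn k S I ∧ HasDegreeGenus k I 2 0

/-- A twisted cubic on `X`: a smooth integral curve of degree 3, genus 0 on `X`. -/
def IsTwistedCubicOn (S : SmoothCubicSurface k) (I : Ideal (R4 k)) : Prop :=
  IsSmoothCurveIdealOn k S I ∧ HasDegreeGenus k I 3 0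

/-- The curve `C ⊂ X` moves in a linear system of (projective) dimension `dim`,
i.e. `h⁰(O_X(C)) = dim + 1`.  Global sections of `O_X(C)` are computed, for any
homogeneous `q ∈ I_C` of degree `s` not divisible by `f`, as the degree-`s` part of
the colon ideal `((q, f) : I_C)` modulo `(f)`. -/
def MovesInLinSysOfDim (S : SmoothCubicSurface k) (IC : Ideal (R4 k)) (dim : ℤ) : Prop :=
  ∀ (s : ℕ) (q : R4 k), q.IsHomogeneous s → q ∈ IC → q ∉ Ideal.span {S.f} →
    (Module.finrank k ↥(homogeneousSubmodule (Fin 4) k s ⊓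
        Submodule.restrictScalars k (icolon k (Ideal.span {q} ⊔ Ideal.span {S.f}) IC)) : ℤ)
      - (Module.finrank k ↥(homogeneousSubmodule (Fin 4) k s ⊓
        Submodule.restrictScalars k (icolon k (Ideal.span {q} ⊔ Ideal.span {S.f}) IC) ⊓
        Submodule.restrictScalars k (Ideal.span {S.f})) : ℤ) = dim + 1

/-- `I/(f₀)` is a maximal Cohen–Macaulay module over `R/(f₀)` (3-dimensional):
it admits a regular sequence of three positive-degree homogeneous elements. -/
def IsMCMQuotient (f0 : R4 k) (I : Ideal (R4 k)) : Prop :=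
  ∃ r₁ r₂ r₃ : R4 k,
    (∃ d : ℕ, 0 < d ∧ r₁.IsHomogeneous d) ∧
    (∃ d : ℕ, 0 < d ∧ r₂.IsHomogeneous d) ∧
    (∃ d : ℕ, 0 < d ∧ r₃.IsHomogeneous d) ∧
    (∀ x ∈ I, r₁ * x ∈ Ideal.span {f0} → x ∈ Ideal.span {f0}) ∧
    (∀ x ∈ I, r₂ * x ∈ Ideal.span {r₁} * I ⊔ Ideal.span {f0} →
      x ∈ Ideal.span {r₁} * I ⊔ Ideal.span {f0}) ∧
    (∀ x ∈ I, r₃ * x ∈ Ideal.span {r₁} * I ⊔ Ideal.span {r₂} * I ⊔ Ideal.span {f0} →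
      x ∈ Ideal.span {r₁} * I ⊔ Ideal.span {r₂} * I ⊔ Ideal.span {f0}) ∧
    (∃ x ∈ I, x ∉ Ideal.span {r₁} * I ⊔ Ideal.span {r₂} * I ⊔ Ideal.span {r₃} * I
      ⊔ Ideal.span {f0})

end

namespace CubicMRC

section Grading
variable {k : Type} [Field k]

/-- The graded piece of degree `n` of `R`, for an integer `n` (zero when `n < 0`). -/
def RZ (k : Type) [Field k] (n : ℤ) : Submodule k (R4 k) :=
  weightedHomogeneousSubmodule k (fun _ : Fin 4 => (1 : ℤ)) n

/-- The homogeneous component of degree `n`. -/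
noncomputable def cmp (n : ℤ) : R4 k →ₗ[k] R4 k :=
  weightedHomogeneousComponent (fun _ : Fin 4 => (1 : ℤ)) n

lemma weight_one_eq (d : Fin 4 →₀ ℕ) :
    Finsupp.weight (fun _ : Fin 4 => (1 : ℤ)) d = (d.degree : ℤ) := by
  simp [Finsupp.weight_apply, Finsupp.degree_apply, Finsupp.sum]

lemma mem_RZ {n : ℤ} {p : R4 k} :
    p ∈ RZ k n ↔ ∀ d, coeff d p ≠ 0 → (d.degree : ℤ) = n := by
  simp only [RZ, mem_weightedHomogeneousSubmodule, IsWeightedHomogeneous, weight_one_eq]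

lemma mem_RZ_nat {n : ℕ} {p : R4 k} : p ∈ RZ k (n : ℤ) ↔ p.IsHomogeneous n := by
  rw [mem_RZ]
  simp only [IsHomogeneous, IsWeightedHomogeneous]
  refine forall_congr' fun d => ?_
  have : Finsupp.weight (1 : Fin 4 → ℕ) d = d.degree := by
    rw [Finsupp.degree_eq_weight_one]; rfl
  rw [this]
  norm_cast

lemma RZ_neg {n : ℤ} (hn : n < 0) {p : R4 k} (hp : p ∈ RZ k n) : p = 0 := by
  ext d
  by_contra h
  have := mem_RZ.1 hp d (by simpa using h)
  omega

lemma mul_mem_RZ {m n l : ℤ} {p q : R4 k} (hp : p ∈ RZ k m) (hq : q ∈ RZ k n) (h : m + n = l) :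
    p * q ∈ RZ k l := by
  subst h; exact IsWeightedHomogeneous.mul hp hq

lemma X_mem_RZ (i : Fin 4) : (X i : R4 k) ∈ RZ k 1 := isWeightedHomogeneous_X _ _ i

lemma C_mem_RZ (c : k) : (C c : R4 k) ∈ RZ k 0 := isWeightedHomogeneous_C _ c

lemma one_mem_RZ : (1 : R4 k) ∈ RZ k 0 := isWeightedHomogeneous_one _ _

lemma X_mul_mem {n l : ℤ} {p : R4 k} (hp : p ∈ RZ k n) (i : Fin 4) (h : n + 1 = l) :
    X i * p ∈ RZ k l := mul_mem_RZ (X_mem_RZ i) hp (by omega)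

lemma C_mul_mem {n : ℤ} {p : R4 k} (hp : p ∈ RZ k n) (c : k) :
    C c * p ∈ RZ k n := mul_mem_RZ (C_mem_RZ c) hp (by omega)

lemma prod_mem_RZ {ι : Type*} (s : Finset ι) (φ : ι → R4 k) (n : ι → ℤ)
    (h : ∀ i ∈ s, φ i ∈ RZ k (n i)) : ∏ i ∈ s, φ i ∈ RZ k (∑ i ∈ s, n i) :=
  IsWeightedHomogeneous.prod s φ n h

lemma coeff_cmp (n : ℤ) (p : R4 k) (d : Fin 4 →₀ ℕ) :
    coeff d (cmp n p) = if (d.degree : ℤ) = n then coeff d p else 0 := by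
  classical
  rw [cmp, coeff_weightedHomogeneousComponent, weight_one_eq]

lemma cmp_mem (n : ℤ) (p : R4 k) : cmp n p ∈ RZ k n :=
  weightedHomogeneousComponent_mem _ p n

lemma cmp_same {n : ℤ} {p : R4 k} (hp : p ∈ RZ k n) : cmp n p = p := by
  ext d
  rw [coeff_cmp]
  split_ifs with h
  · rfl
  · by_contra h2
    exact h (mem_RZ.1 hp d (fun h3 => h2 h3.symm))

lemma cmp_ne {n m : ℤ} {p : R4 k} (hp : p ∈ RZ k m) (h : m ≠ n) : cmp n p = 0 := by
  ext d
  rw [coeff_cmp]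
  split_ifs with h1
  · by_contra h2
    exact h ((mem_RZ.1 hp d (by simpa using h2)).symm.trans h1)
  · simp

lemma exists_eq_sum_cmp (p : R4 k) : ∃ s : Finset ℤ, p = ∑ n ∈ s, cmp n p := by
  classical
  refine ⟨p.support.image fun d => (d.degree : ℤ), ?_⟩
  ext d
  rw [coeff_sum]
  simp only [coeff_cmp]
  rw [Finset.sum_ite_eq]
  split_ifs with h
  · rfl
  · by_contra h2
    exact h (Finset.mem_image_of_mem _ (mem_support_iff.2 h2))

lemma cmp_mul {m n : ℤ} {a : R4 k} (ha : a ∈ RZ k m) (b : R4 k) :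
    cmp n (a * b) = a * cmp (n - m) b := by
  obtain ⟨s, hs⟩ := exists_eq_sum_cmp b
  have key : ∀ j, cmp n (a * cmp j b) = a * cmp (n - m) (cmp j b) := by
    intro j
    have h1 := mul_mem_RZ ha (cmp_mem j b) rfl
    by_cases h : m + j = n
    · have hj : n - m = j := by omega
      rw [hj, cmp_same (h ▸ h1), cmp_same (cmp_mem j b)]
    · rw [cmp_ne h1 h, cmp_ne (cmp_mem j b) (by omega), mul_zero]
  calc cmp n (a * b) = cmp n (a * ∑ j ∈ s, cmp j b) := by rw [← hs]
    _ = a * cmp (n - m) (∑ j ∈ s, cmp j b) := by simp only [Finset.mul_sum, map_sum, key]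
    _ = a * cmp (n - m) b := by rw [← hs]

/-- A homogeneous element divisible by a nonzero form has a homogeneous quotient. -/
lemma exists_quot {f p : R4 k} {m n : ℤ} (hf : f ∈ RZ k m) (hp : p ∈ RZ k n) (h : f ∣ p) :
    ∃ q ∈ RZ k (n - m), p = f * q := by
  obtain ⟨q, rfl⟩ := h
  exact ⟨cmp (n - m) q, cmp_mem _ _, by rw [← cmp_mul hf, cmp_same hp]⟩

lemma eval_smul_RZ {n : ℕ} {p : R4 k} (hp : p ∈ RZ k n) (c : k) (v : Fin 4 → k) :
    eval (c • v) p = c ^ n * eval v p := by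
  have := (mem_RZ_nat.1 hp)
  rw [eval_eq, eval_eq, Finset.mul_sum]
  refine Finset.sum_congr rfl fun d hd => ?_
  have h := mem_RZ.1 hp d (mem_support_iff.1 hd)
  have h2 : d.degree = n := by exact_mod_cast h
  simp only [Pi.smul_apply, smul_eq_mul, mul_pow, Finset.prod_mul_distrib]
  rw [Finset.prod_pow_eq_pow_sum]
  rw [← h2, Finsupp.degree_apply]
  ring

lemma exists_eq_sum_X {n : ℤ} (hn : 0 < n) {p : R4 k} (hp : p ∈ RZ k n) :
    ∃ q : Fin 4 → R4 k, (∀ i, q i ∈ RZ k (n - 1)) ∧ p = ∑ i, X i * q i := by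
  have h : p ∈ Ideal.span (Set.range (X : Fin 4 → R4 k)) := by
    have : Set.range (X : Fin 4 → R4 k) = X '' Set.univ := by simp
    rw [this, mem_ideal_span_X_image]
    intro d hd
    have h := mem_RZ.1 hp d (mem_support_iff.1 hd)
    by_contra hc
    push Not at hc
    have : d = 0 := by ext i; simpa using hc i
    subst this
    simp at h; omega
  rw [Ideal.mem_span_range_iff_exists_fun] at h
  obtain ⟨c, hc⟩ := h
  refine ⟨fun i => cmp (n - 1) (c i), fun i => cmp_mem _ _, ?_⟩
  rw [← cmp_same hp, ← hc, map_sum]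
  refine Finset.sum_congr rfl fun i _ => ?_
  rw [mul_comm, cmp_mul (X_mem_RZ i)]

lemma RZ_eq_supported (n : ℤ) : RZ k n =
    AddMonoidAlgebra.supported k k {d : Fin 4 →₀ ℕ | (d.degree : ℤ) = n} := by
  rw [RZ, weightedHomogeneousSubmodule_eq_finsupp_supported]
  simp only [weight_one_eq]

lemma RZ_zero_deg {p : R4 k} (hp : p ∈ RZ k 0) : ∃ c, p = C c := by
  refine ⟨coeff 0 p, ?_⟩
  ext d
  rw [coeff_C]
  split_ifs with h
  · rw [h]
  · by_contra h2
    have := mem_RZ.1 hp d h2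
    simp only [Nat.cast_eq_zero, Finsupp.degree_eq_zero_iff] at this
    exact h this.symm

noncomputable def RZBasis (k : Type) [Field k] (n : ℤ) :
    Module.Basis {d : Fin 4 →₀ ℕ | (d.degree : ℤ) = n} k (RZ k n) :=
  (basisRestrictSupport k {d : Fin 4 →₀ ℕ | (d.degree : ℤ) = n}).map
    (LinearEquiv.ofEq _ _ (RZ_eq_supported n).symm)

lemma degree_set_finite (n : ℤ) : {d : Fin 4 →₀ ℕ | (d.degree : ℤ) = n}.Finite :=
  (Finsupp.finite_of_degree_le n.toNat).subset fun d hd => by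
    simp only [Set.mem_ofPred_eq] at hd ⊢; omega

instance (n : ℤ) : Module.Finite k (RZ k n) := by
  have := (degree_set_finite n).to_subtype
  exact Module.Finite.of_basis (RZBasis k n)

lemma finrank_RZ_nat (n : ℕ) : Module.finrank k (RZ k n) = (n + 3).choose 3 := by
  classical
  have hs : {d : Fin 4 →₀ ℕ | (d.degree : ℤ) = (n : ℤ)} =
      ((Finset.univ : Finset (Fin 4)).finsuppAntidiag n : Set (Fin 4 →₀ ℕ)) := by
    ext d
    simp [Finsupp.degree_eq_sum]
    norm_cast
  rw [Module.finrank_eq_nat_card_basis (RZBasis k n), hs, Nat.card_coe_set_eq,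
    Set.ncard_coe_finset, Finset.card_finsuppAntidiag_nat_eq_choose, Finset.card_univ,
    Fintype.card_fin, show 4 + n - 1 = n + 3 by omega]
  exact Nat.choose_symm_of_eq_add rfl

/-- `6 dim R_n = (n+1)(n+2)(n+3)` for `n ≥ -3`. -/
lemma finrank_RZ {n : ℤ} (hn : -3 ≤ n) :
    6 * (Module.finrank k (RZ k n) : ℤ) = (n + 1) * (n + 2) * (n + 3) := by
  rcases lt_or_ge n 0 with h | h
  · have hb : RZ k n = ⊥ := (Submodule.eq_bot_iff _).2 fun p hp => RZ_neg h hp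
    have : n = -3 ∨ n = -2 ∨ n = -1 := by omega
    rw [hb, finrank_bot]
    rcases this with rfl | rfl | rfl <;> norm_num
  · lift n to ℕ using h
    rw [finrank_RZ_nat]
    have h1 := Nat.add_one_mul_choose_eq (n + 2) 2
    have h2 := Nat.add_one_mul_choose_eq (n + 1) 1
    simp only [Nat.choose_one_right] at h2
    zify at h1 h2
    push_cast at h1 h2 ⊢
    ring_nf at h1 h2 ⊢
    nlinarith

end Grading

section Koszul
variable {k : Type} [Field k]

/-- The product of a matrix over a ring with a vector of module elements. -/
def smv {R M : Type*} [Semiring R] [AddCommMonoid M] [Module R M] {p q : ℕ}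
    (A : Matrix (Fin p) (Fin q) R) (v : Fin q → M) : Fin p → M := fun i => ∑ j, A i j • v j

lemma smv_smv {R M : Type*} [CommRing R] [AddCommGroup M] [Module R M] {p q s : ℕ}
    (A : Matrix (Fin p) (Fin q) R) (B : Matrix (Fin q) (Fin s) R) (v : Fin s → M) :
    smv A (smv B v) = smv (A * B) v := by
  funext i
  simp only [smv, Matrix.mul_apply, Finset.smul_sum, Finset.sum_smul, smul_smul]
  rw [Finset.sum_comm]

lemma smv_zero_mat {R M : Type*} [CommRing R] [AddCommGroup M] [Module R M] {p q : ℕ}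
    (v : Fin q → M) : smv (0 : Matrix (Fin p) (Fin q) R) v = 0 := by
  funext i; simp [smv]

lemma smv_sub {R M : Type*} [CommRing R] [AddCommGroup M] [Module R M] {p q : ℕ}
    (A : Matrix (Fin p) (Fin q) R) (v w : Fin q → M) : smv A (v - w) = smv A v - smv A w := by
  funext i; simp [smv, smul_sub, Finset.sum_sub_distrib]

lemma map_smv {R M N : Type*} [CommRing R] [AddCommGroup M] [Module R M] [AddCommGroup N]
    [Module R N] {p q : ℕ} (φ : M →ₗ[R] N)
    (A : Matrix (Fin p) (Fin q) R) (v : Fin q → M) :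
    (fun i => φ (smv A v i)) = smv A (fun j => φ (v j)) := by
  funext i; simp [smv]

noncomputable def KD0 (k : Type) [Field k] : Matrix (Fin 0) (Fin 1) (R4 k) := 0
noncomputable def KD1 (k : Type) [Field k] : Matrix (Fin 1) (Fin 4) (R4 k) :=
  !![X 0, X 1, X 2, X 3]
noncomputable def KD2 (k : Type) [Field k] : Matrix (Fin 4) (Fin 6) (R4 k) :=
  !![X 1, X 2, X 3, 0, 0, 0;
    -X 0, 0, 0, X 2, X 3, 0;
    0, -X 0, 0, -X 1, 0, X 3;
    0, 0, -X 0, 0, -X 1, -X 2]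
noncomputable def KD3 (k : Type) [Field k] : Matrix (Fin 6) (Fin 4) (R4 k) :=
  !![X 2, X 3, 0, 0;
    -X 1, 0, X 3, 0;
    0, -X 1, -X 2, 0;
    X 0, 0, 0, X 3;
    0, X 0, 0, -X 2;
    0, 0, X 0, X 1]
noncomputable def KD4 (k : Type) [Field k] : Matrix (Fin 4) (Fin 1) (R4 k) :=
  !![X 3; -X 2; X 1; -X 0]

lemma smv_KD1 {M : Type*} [AddCommGroup M] [Module (R4 k) M] (v : Fin 4 → M) :
    smv (KD1 k) v = ![(X 0 : R4 k) • v 0 + (X 1 : R4 k) • v 1 + (X 2 : R4 k) • v 2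
      + (X 3 : R4 k) • v 3] := by
  funext i
  fin_cases i
  simp [smv, KD1, Fin.sum_univ_four]

lemma smv_KD2 {M : Type*} [AddCommGroup M] [Module (R4 k) M] (v : Fin 6 → M) :
    smv (KD2 k) v = ![(X 1 : R4 k) • v 0 + (X 2 : R4 k) • v 1 + (X 3 : R4 k) • v 2,
      -((X 0 : R4 k) • v 0) + (X 2 : R4 k) • v 3 + (X 3 : R4 k) • v 4,
      -((X 0 : R4 k) • v 1) - (X 1 : R4 k) • v 3 + (X 3 : R4 k) • v 5,
      -((X 0 : R4 k) • v 2) - (X 1 : R4 k) • v 4 - (X 2 : R4 k) • v 5] := by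
  funext i
  fin_cases i <;> simp [smv, KD2, Fin.sum_univ_six] <;> abel

lemma smv_KD3 {M : Type*} [AddCommGroup M] [Module (R4 k) M] (v : Fin 4 → M) :
    smv (KD3 k) v = ![(X 2 : R4 k) • v 0 + (X 3 : R4 k) • v 1,
      -((X 1 : R4 k) • v 0) + (X 3 : R4 k) • v 2,
      -((X 1 : R4 k) • v 1) - (X 2 : R4 k) • v 2,
      (X 0 : R4 k) • v 0 + (X 3 : R4 k) • v 3,
      (X 0 : R4 k) • v 1 - (X 2 : R4 k) • v 3,
      (X 0 : R4 k) • v 2 + (X 1 : R4 k) • v 3] := by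
  funext i
  fin_cases i <;> simp [smv, KD3, Fin.sum_univ_four] <;> abel

lemma smv_KD4 {M : Type*} [AddCommGroup M] [Module (R4 k) M] (v : Fin 1 → M) :
    smv (KD4 k) v = ![(X 3 : R4 k) • v 0, -((X 2 : R4 k) • v 0), (X 1 : R4 k) • v 0,
      -((X 0 : R4 k) • v 0)] := by
  funext i
  fin_cases i <;> simp [smv, KD4]

lemma KD_mul_12 : KD1 k * KD2 k = 0 := by
  ext1 i j
  fin_cases i; fin_cases j <;>
  simp [KD1, KD2, Matrix.mul_apply, Fin.sum_univ_four] <;> ring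

lemma KD_mul_23 : KD2 k * KD3 k = 0 := by
  ext1 i j
  fin_cases i <;> fin_cases j <;>
  simp [KD2, KD3, Matrix.mul_apply, Fin.sum_univ_six] <;> ring

lemma KD_mul_34 : KD3 k * KD4 k = 0 := by
  ext1 i j
  fin_cases i <;> fin_cases j <;>
  simp [KD3, KD4, Matrix.mul_apply, Fin.sum_univ_four] <;> ring

lemma KD2_deg (i j) : KD2 k i j ∈ RZ k 1 := by
  fin_cases i <;> fin_cases j <;> simp [KD2, X_mem_RZ]
lemma KD3_deg (i j) : KD3 k i j ∈ RZ k 1 := by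
  fin_cases i <;> fin_cases j <;> simp [KD3, X_mem_RZ]
lemma KD4_deg (i j) : KD4 k i j ∈ RZ k 1 := by
  fin_cases i <;> fin_cases j <;> simp [KD4, X_mem_RZ]

/-- The variables form a regular sequence. -/
lemma mem_span_of_X_mul {J : Set (Fin 4)} {i : Fin 4} (hi : i ∉ J) {w : R4 k}
    (h : X i * w ∈ Ideal.span ((X : Fin 4 → R4 k) '' J)) :
    w ∈ Ideal.span ((X : Fin 4 → R4 k) '' J) := by
  rw [mem_ideal_span_X_image] at h ⊢
  intro m hm
  obtain ⟨j, hj, hne⟩ := h (m + Finsupp.single i 1) (by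
    rw [mem_support_iff, add_comm, coeff_X_mul]
    exact mem_support_iff.1 hm)
  refine ⟨j, hj, ?_⟩
  have : i ≠ j := fun h => hi (h ▸ hj)
  simpa [Finsupp.single_apply, this] using hne

lemma mem_span_X1 {i : Fin 4} {w : R4 k} :
    w ∈ Ideal.span ((X : Fin 4 → R4 k) '' {i}) ↔ ∃ a, w = X i * a := by
  simp only [Set.image_singleton, Ideal.mem_span_singleton']
  simp [eq_comm, mul_comm]

lemma mem_span_X2 {i j : Fin 4} {w : R4 k} :
    w ∈ Ideal.span ((X : Fin 4 → R4 k) '' {i, j}) ↔ ∃ a b, w = X i * a + X j * b := by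
  simp only [Set.image_pair, Ideal.mem_span_pair]
  simp [eq_comm, mul_comm]

lemma mem_span_X3 {i j l : Fin 4} {w : R4 k} :
    w ∈ Ideal.span ((X : Fin 4 → R4 k) '' {i, j, l}) ↔
      ∃ a b c, w = X i * a + X j * b + X l * c := by
  rw [Set.image_insert_eq, Set.image_pair, Ideal.mem_span_insert]
  simp only [Ideal.mem_span_pair]
  constructor
  · rintro ⟨a, z, ⟨b, c, rfl⟩, rfl⟩
    exact ⟨a, b, c, by ring⟩
  · rintro ⟨a, b, c, rfl⟩
    exact ⟨a, _, ⟨b, c, rfl⟩, by ring⟩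

lemma X_cancel {i : Fin 4} {a b : R4 k} (h : X i * a = X i * b) : a = b :=
  mul_left_cancel₀ (X_ne_zero i) h

lemma koszul_two {i j : Fin 4} (hij : i ≠ j) {a b : R4 k} (h : X i * a + X j * b = 0) :
    ∃ c, a = X j * c ∧ b = -(X i * c) := by
  obtain ⟨c, hc⟩ := mem_span_X1.1 (mem_span_of_X_mul (i := i) (J := {j}) (by simpa using hij)
    (w := a) (mem_span_X1.2 ⟨-b, by linear_combination h⟩))
  refine ⟨c, hc, X_cancel (i := j) ?_⟩
  rw [hc] at h
  linear_combination h

lemma koszul_three {i j l : Fin 4} (hij : i ≠ j) (hil : i ≠ l) (hjl : j ≠ l) {u v w : R4 k}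
    (h : X i * u + X j * v + X l * w = 0) :
    ∃ a b c, u = X j * a + X l * b ∧ v = -(X i * a) + X l * c ∧ w = -(X i * b) - X j * c := by
  obtain ⟨b, c, hw⟩ := mem_span_X2.1 (mem_span_of_X_mul (i := l) (J := {i, j})
    (by simp [hil.symm, hjl.symm]) (w := w) (mem_span_X2.2 ⟨-u, -v, by linear_combination h⟩))
  obtain ⟨a, h1, h2⟩ := koszul_two hij (a := u + X l * b) (b := v + X l * c)
    (by rw [hw] at h; linear_combination h)
  exact ⟨a, -b, -c, by linear_combination h1, by linear_combination h2,
    by linear_combination hw⟩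

lemma koszul_four {w : Fin 4 → R4 k} (h : X 0 * w 0 + X 1 * w 1 + X 2 * w 2 + X 3 * w 3 = 0) :
    ∃ c : Fin 6 → R4 k, w = smv (KD2 k) c := by
  obtain ⟨c3, c4, c5, hw⟩ := mem_span_X3.1 (mem_span_of_X_mul (i := 3) (J := {0, 1, 2})
    (by simp [Set.mem_insert_iff]) (w := w 3)
    (mem_span_X3.2 ⟨-w 0, -w 1, -w 2, by linear_combination h⟩))
  obtain ⟨a, b, c, h1, h2, h3⟩ := koszul_three (i := 0) (j := 1) (l := 2) (by decide) (by decide)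
    (by decide) (u := w 0 + X 3 * c3) (v := w 1 + X 3 * c4) (w := w 2 + X 3 * c5)
    (by rw [hw] at h; linear_combination h)
  refine ⟨![a, b, -c3, c, -c4, -c5], ?_⟩
  rw [smv_KD2]
  funext i
  fin_cases i <;> simp
  · linear_combination h1
  · linear_combination h2
  · linear_combination h3
  · linear_combination hw

lemma koszulR1 {w : Fin 4 → R4 k} (h : smv (KD1 k) w = 0) : ∃ c, w = smv (KD2 k) c := by
  rw [smv_KD1] at h
  exact koszul_four (by simpa using congrFun h 0)

lemma koszulR2 {c : Fin 6 → R4 k} (h : smv (KD2 k) c = 0) : ∃ e, c = smv (KD3 k) e := by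
  rw [smv_KD2] at h
  have h0 := congrFun h 0
  have h1 := congrFun h 1
  have h2 := congrFun h 2
  have h3 := congrFun h 3
  simp at h0 h1 h2 h3
  obtain ⟨a, b, d, e1, e2, e3⟩ := koszul_three (i := 0) (j := 1) (l := 2) (by decide) (by decide)
    (by decide) (u := c 2) (v := c 4) (w := c 5) (by linear_combination -h3)
  obtain ⟨e, e4, e5⟩ := koszul_two (i := 1) (j := 2) (by decide) (a := c 0 + X 3 * a)
    (b := c 1 + X 3 * b) (by linear_combination h0 - X 3 * e1)
  have e6 : c 3 = X 0 * e - X 3 * d :=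
      X_cancel (i := 2) (by linear_combination h1 + X 0 * e4 - X 3 * e2)
  refine ⟨![e, -a, -b, -d], ?_⟩
  rw [smv_KD3]
  funext i
  fin_cases i <;> simp
  · linear_combination e4
  · linear_combination e5
  · linear_combination e1
  · linear_combination e6
  · linear_combination e2
  · linear_combination e3

/-- Graded exactness at degree `n` of the composition of two matrices. -/
def GEx {M : Type*} [AddCommGroup M] [Module k M] [Module (R4 k) M] (𝓜 : ℤ → Submodule k M)
    {p q s : ℕ} (A : Matrix (Fin p) (Fin q) (R4 k)) (B : Matrix (Fin q) (Fin s) (R4 k))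
    (n : ℤ) : Prop :=
  ∀ v : Fin q → M, (∀ i, v i ∈ 𝓜 n) → smv A v = 0 →
    ∃ w : Fin s → M, (∀ i, w i ∈ 𝓜 (n - 1)) ∧ v = smv B w

/-- A family of subspaces is graded if forms of degree one raise the degree by one. -/
def GrMod {M : Type*} [AddCommGroup M] [Module k M] [Module (R4 k) M] (𝓜 : ℤ → Submodule k M) :
    Prop :=
  ∀ (n : ℤ) (r : R4 k) (x : M), r ∈ RZ k 1 → x ∈ 𝓜 n → r • x ∈ 𝓜 (n + 1)

lemma GrMod.smv_mem {M : Type*} [AddCommGroup M] [Module k M] [Module (R4 k) M]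
    {𝓜 : ℤ → Submodule k M} (h : GrMod 𝓜) {p q : ℕ} {A : Matrix (Fin p) (Fin q) (R4 k)}
    (hA : ∀ i j, A i j ∈ RZ k 1) {n : ℤ} {v : Fin q → M} (hv : ∀ j, v j ∈ 𝓜 n) (i : Fin p) :
    smv A v i ∈ 𝓜 (n + 1) :=
  Submodule.sum_mem _ fun j _ => h n _ _ (hA i j) (hv j)

lemma GEx.ker {M N : Type*} [AddCommGroup M] [Module k M] [Module (R4 k) M] [AddCommGroup N]
    [Module k N] [Module (R4 k) N] {𝓜 𝓚 : ℤ → Submodule k M} {𝓝 : ℤ → Submodule k N}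
    {p q s u : ℕ}
    {A : Matrix (Fin p) (Fin q) (R4 k)} {B : Matrix (Fin q) (Fin s) (R4 k)}
    {C : Matrix (Fin s) (Fin u) (R4 k)} (hC : ∀ i j, C i j ∈ RZ k 1) (hBC : B * C = 0)
    (hM : GrMod 𝓜) (φ : M →ₗ[R4 k] N) (hφ : ∀ n x, x ∈ 𝓜 n → φ x ∈ 𝓝 n)
    (hK : ∀ n x, x ∈ 𝓚 n ↔ x ∈ 𝓜 n ∧ φ x = 0) {n : ℤ}
    (hsurj : ∀ y ∈ 𝓝 (n - 2), ∃ x ∈ 𝓜 (n - 2), φ x = y)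
    (h1 : GEx 𝓜 A B n) (h2 : GEx 𝓝 B C (n - 1)) : GEx 𝓚 A B n := by
  intro v hv hAv
  obtain ⟨w, hw, rfl⟩ := h1 v (fun i => ((hK _ _).1 (hv i)).1) hAv
  have h3 : smv B (fun j => φ (w j)) = 0 := by
    rw [← map_smv]
    funext i
    exact ((hK _ _).1 (hv i)).2
  obtain ⟨c, hc, hcw⟩ := h2 _ (fun j => hφ _ _ (hw j)) h3
  have hn : n - 1 - 1 = n - 2 := by ring
  rw [hn] at hc
  choose d hd hdc using fun i => hsurj (c i) (hc i)
  refine ⟨w - smv C d, fun i => (hK _ _).2 ⟨?_, ?_⟩, ?_⟩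
  · refine Submodule.sub_mem _ (hw i) ?_
    have := hM.smv_mem hC hd i
    rwa [show n - 2 + 1 = n - 1 by ring] at this
  · have e1 := congrFun hcw i
    have e2 := congrFun (map_smv φ C d) i
    simp only [hdc] at e2
    simp only [Pi.sub_apply, map_sub, e2]
    exact sub_eq_zero.2 e1
  · rw [smv_sub, smv_smv, hBC, smv_zero_mat, sub_zero]

lemma RZ.grMod : GrMod (RZ k) := fun _ _ _ hr hx => mul_mem_RZ hr hx (by ring)

lemma GEx_R {p q s : ℕ} {A : Matrix (Fin p) (Fin q) (R4 k)} {B : Matrix (Fin q) (Fin s) (R4 k)}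
    (hB : ∀ i j, B i j ∈ RZ k 1)
    (h : ∀ v : Fin q → R4 k, smv A v = 0 → ∃ w, v = smv B w) (n : ℤ) :
    GEx (RZ k) A B n := by
  intro v hv hA
  obtain ⟨w, hw⟩ := h v hA
  refine ⟨fun i => cmp (n - 1) (w i), fun i => cmp_mem _ _, ?_⟩
  funext i
  have e := congrFun hw i
  simp only [smv] at e
  rw [← cmp_same (hv i), e]
  simp only [smv, map_sum, smul_eq_mul]
  exact Finset.sum_congr rfl fun l _ => cmp_mul (hB i l) _

lemma GEx_R_zero {n : ℤ} (h : 0 < n) : GEx (RZ k) (KD0 k) (KD1 k) n := by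
  intro v hv _
  obtain ⟨w, hw, hvw⟩ := exists_eq_sum_X h (hv 0)
  refine ⟨w, hw, ?_⟩
  funext i
  rw [Subsingleton.elim i 0, hvw, smv_KD1]
  simp [Fin.sum_univ_four]

/-- The grading on a direct sum of shifted copies of `R`. -/
noncomputable def FreeGr {ι : Type*} (d : ι → ℤ) (n : ℤ) : Submodule k (ι → R4 k) :=
  Submodule.pi Set.univ fun j => RZ k (n - d j)

lemma mem_FreeGr {ι : Type*} {d : ι → ℤ} {n : ℤ} {w : ι → R4 k} :
    w ∈ FreeGr d n ↔ ∀ j, w j ∈ RZ k (n - d j) := by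
  simp [FreeGr, Submodule.mem_pi]

lemma FreeGr.grMod {ι : Type*} (d : ι → ℤ) : GrMod (k := k) (FreeGr d) :=
  fun _ _ _ hr hx => mem_FreeGr.2 fun j => mul_mem_RZ hr (mem_FreeGr.1 hx j) (by ring)

lemma GEx_free {ι : Type*} (d : ι → ℤ) {p q s : ℕ}
    {A : Matrix (Fin p) (Fin q) (R4 k)} {B : Matrix (Fin q) (Fin s) (R4 k)} {n : ℤ}
    (h : ∀ j, GEx (RZ k) A B (n - d j)) : GEx (k := k) (FreeGr d) A B n := by
  intro v hv hA
  choose w hw hvw using fun j => h j (fun i => v i j) (fun i => mem_FreeGr.1 (hv i) j) (by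
    funext i
    have := congrFun (congrFun hA i) j
    simpa [smv] using this)
  refine ⟨fun i j => w j i, fun i => mem_FreeGr.2 fun j => ?_, ?_⟩
  · have := hw j i
    rwa [show n - d j - 1 = n - 1 - d j by ring] at this
  · funext i j
    have e := congrFun (hvw j) i
    simp only [smv] at e
    rw [e]
    simp [smv]

lemma finrank_FreeGr {ι : Type*} [Fintype ι] (d : ι → ℤ) (n : ℤ) :
    Module.finrank k (FreeGr (k := k) d n) = ∑ j, Module.finrank k (RZ k (n - d j)) := by
  rw [← Module.finrank_pi_fintype]
  refine LinearEquiv.finrank_eq (LinearEquiv.mk (LinearMap.mk (AddHom.mk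
    (fun w j => ⟨w.1 j, mem_FreeGr.1 w.2 j⟩) fun _ _ => rfl) fun _ _ => rfl)
    (fun w => ⟨fun j => (w j).1, mem_FreeGr.2 fun j => (w j).2⟩) (fun _ => rfl) (fun _ => rfl))

instance {ι : Type*} [Fintype ι] (d : ι → ℤ) (n : ℤ) :
    Module.Finite k (FreeGr (k := k) d n) := by
  refine Module.Finite.of_injective (LinearMap.mk (AddHom.mk
    (fun w j => ⟨w.1 j, mem_FreeGr.1 w.2 j⟩) fun _ _ => rfl) fun _ _ => rfl :
    FreeGr (k := k) d n →ₗ[k] ∀ j, RZ k (n - d j)) fun w w' h => Subtype.ext ?_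
  funext j
  exact congrArg Subtype.val (congrFun h j)

/-- Functions on a set of points, as a module over `R` through evaluation. -/
def KZ {ι : Type*} (_v : ι → Fin 4 → k) : Type _ := ι → k

instance {ι : Type*} (v : ι → Fin 4 → k) : AddCommGroup (KZ v) :=
  inferInstanceAs (AddCommGroup (ι → k))
instance {ι : Type*} (v : ι → Fin 4 → k) : Module k (KZ v) :=
  inferInstanceAs (Module k (ι → k))
noncomputable instance {ι : Type*} (v : ι → Fin 4 → k) : Module (R4 k) (KZ v) :=
  Module.compHom (ι → k) (RingHom.pi fun i => (eval (v i) : R4 k →+* k))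

noncomputable def evKZ {ι : Type*} (v : ι → Fin 4 → k) : R4 k →ₗ[R4 k] KZ v where
  toFun F := fun i => eval (v i) F
  map_add' F G := by funext i; simp; rfl
  map_smul' F G := by funext i; simp; rfl

/-- A function viewed as an element of `KZ v`. -/
def toKZ {ι : Type*} (v : ι → Fin 4 → k) (x : ι → k) : KZ v := x
/-- The value of an element of `KZ v` at a point. -/
def KZ.val {ι : Type*} {v : ι → Fin 4 → k} (x : KZ v) (i : ι) : k := x i

section
variable {ι : Type*} (v : ι → Fin 4 → k)

lemma toKZ_val {k : Type} (v : ι → Fin 4 → k) (x : ι → k) (i : ι) : (toKZ v x).val i = x i := rfl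
lemma KZ_smul (F : R4 k) (x : KZ v) (i : ι) : (F • x).val i = eval (v i) F * x.val i := rfl
lemma KZ_add (x y : KZ v) (i : ι) : (x + y).val i = x.val i + y.val i := rfl
lemma KZ_sub (x y : KZ v) (i : ι) : (x - y).val i = x.val i - y.val i := rfl
lemma KZ_neg (x : KZ v) (i : ι) : (-x).val i = -x.val i := rfl
lemma KZ_zero (i : ι) : (0 : KZ v).val i = 0 := rfl
lemma evKZ_val (F : R4 k) (i : ι) : (evKZ v F).val i = eval (v i) F := rfl

lemma KZ.ext {k : Type} {v : ι → Fin 4 → k} {x y : KZ v} (h : ∀ i, x.val i = y.val i) : x = y :=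
  funext h
end

lemma exists_dual {z : Fin 4 → k} (hz : z ≠ 0) :
    ∃ l : Fin 4 → k, l 0 * z 0 + l 1 * z 1 + l 2 * z 2 + l 3 * z 3 = 1 := by
  obtain ⟨i, hi⟩ := Function.ne_iff.1 hz
  refine ⟨Pi.single i (z i)⁻¹, ?_⟩
  have hi : z i ≠ 0 := hi
  fin_cases i <;> simp at hi ⊢ <;> field_simp

section
variable {ι : Type*} {v : ι → Fin 4 → k}

lemma GEx_KZ1 (hv : ∀ i, v i ≠ 0) (n : ℤ) :
    GEx (fun _ => (⊤ : Submodule k (KZ v))) (KD1 k) (KD2 k) n := by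
  intro w _ h
  choose l hl using fun i => exists_dual (hv i)
  refine ⟨![toKZ v fun i => l i 1 * (w 0).val i - l i 0 * (w 1).val i,
    toKZ v fun i => l i 2 * (w 0).val i - l i 0 * (w 2).val i,
    toKZ v fun i => l i 3 * (w 0).val i - l i 0 * (w 3).val i,
    toKZ v fun i => l i 2 * (w 1).val i - l i 1 * (w 2).val i,
    toKZ v fun i => l i 3 * (w 1).val i - l i 1 * (w 3).val i,
    toKZ v fun i => l i 3 * (w 2).val i - l i 2 * (w 3).val i], fun _ => Submodule.mem_top, ?_⟩
  rw [smv_KD1] at h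
  rw [smv_KD2]
  funext j
  refine KZ.ext fun i => ?_
  have h0 := congrArg (KZ.val · i) (congrFun h 0)
  simp [KZ_smul, KZ_add, KZ_zero] at h0
  fin_cases j <;> simp [KZ_smul, KZ_add, KZ_sub, KZ_neg, toKZ_val]
  · linear_combination -(w 0).val i * hl i + l i 0 * h0
  · linear_combination -(w 1).val i * hl i + l i 1 * h0
  · linear_combination -(w 2).val i * hl i + l i 2 * h0
  · linear_combination -(w 3).val i * hl i + l i 3 * h0

lemma GEx_KZ2 (hv : ∀ i, v i ≠ 0) (n : ℤ) :
    GEx (fun _ => (⊤ : Submodule k (KZ v))) (KD2 k) (KD3 k) n := by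
  intro w _ h
  choose l hl using fun i => exists_dual (hv i)
  refine ⟨![toKZ v fun i => l i 2 * (w 0).val i - l i 1 * (w 1).val i + l i 0 * (w 3).val i,
    toKZ v fun i => l i 3 * (w 0).val i - l i 1 * (w 2).val i + l i 0 * (w 4).val i,
    toKZ v fun i => l i 3 * (w 1).val i - l i 2 * (w 2).val i + l i 0 * (w 5).val i,
    toKZ v fun i => l i 3 * (w 3).val i - l i 2 * (w 4).val i + l i 1 * (w 5).val i],
    fun _ => Submodule.mem_top, ?_⟩
  rw [smv_KD2] at h
  rw [smv_KD3]
  funext j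
  refine KZ.ext fun i => ?_
  have h0 := congrArg (KZ.val · i) (congrFun h 0)
  have h1 := congrArg (KZ.val · i) (congrFun h 1)
  have h2 := congrArg (KZ.val · i) (congrFun h 2)
  have h3 := congrArg (KZ.val · i) (congrFun h 3)
  simp [KZ_smul, KZ_add, KZ_sub, KZ_neg, KZ_zero] at h0 h1 h2 h3
  fin_cases j <;> simp [KZ_smul, KZ_add, KZ_sub, KZ_neg, toKZ_val]
  · linear_combination -(w 0).val i * hl i + l i 1 * h0 - l i 0 * h1
  · linear_combination -(w 1).val i * hl i + l i 2 * h0 - l i 0 * h2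
  · linear_combination -(w 2).val i * hl i + l i 3 * h0 - l i 0 * h3
  · linear_combination -(w 3).val i * hl i + l i 2 * h1 - l i 1 * h2
  · linear_combination -(w 4).val i * hl i + l i 3 * h1 - l i 1 * h3
  · linear_combination -(w 5).val i * hl i + l i 3 * h2 - l i 2 * h3

lemma GEx_KZ3 (hv : ∀ i, v i ≠ 0) (n : ℤ) :
    GEx (fun _ => (⊤ : Submodule k (KZ v))) (KD3 k) (KD4 k) n := by
  intro w _ h
  choose l hl using fun i => exists_dual (hv i)
  refine ⟨fun _ => toKZ v fun i =>
    l i 3 * (w 0).val i - l i 2 * (w 1).val i + l i 1 * (w 2).val i - l i 0 * (w 3).val i,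
    fun _ => Submodule.mem_top, ?_⟩
  rw [smv_KD3] at h
  rw [smv_KD4]
  funext j
  refine KZ.ext fun i => ?_
  have h0 := congrArg (KZ.val · i) (congrFun h 0)
  have h1 := congrArg (KZ.val · i) (congrFun h 1)
  have h2 := congrArg (KZ.val · i) (congrFun h 2)
  have h3 := congrArg (KZ.val · i) (congrFun h 3)
  have h4 := congrArg (KZ.val · i) (congrFun h 4)
  have h5 := congrArg (KZ.val · i) (congrFun h 5)
  simp [KZ_smul, KZ_add, KZ_sub, KZ_neg, KZ_zero] at h0 h1 h2 h3 h4 h5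
  fin_cases j <;> simp [KZ_smul, KZ_neg, toKZ_val]
  · linear_combination -(w 0).val i * hl i + l i 2 * h0 - l i 1 * h1 + l i 0 * h3
  · linear_combination -(w 1).val i * hl i + l i 3 * h0 - l i 1 * h2 + l i 0 * h4
  · linear_combination -(w 2).val i * hl i + l i 3 * h1 - l i 2 * h2 + l i 0 * h5
  · linear_combination -(w 3).val i * hl i + l i 3 * h3 - l i 2 * h4 + l i 1 * h5

end
end Koszul

section GradedPresentations
variable {k : Type} [Field k]

lemma exists_basis_mod {V : Type*} [AddCommGroup V] [Module k V] (N M : Submodule k V)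
    [Module.Finite k M] (hNM : N ≤ M) {ι : Type*} [Fintype ι]
    (h : Module.finrank k M = Module.finrank k N + Fintype.card ι) :
    ∃ g : ι → V, (∀ j, g j ∈ M) ∧ (∀ x ∈ M, ∃ c : ι → k, x - ∑ j, c j • g j ∈ N) ∧
      ∀ c : ι → k, ∑ j, c j • g j ∈ N → c = 0 := by
  classical
  set N' := N.comap M.subtype with hN'
  have e : Module.finrank k N' = Module.finrank k N :=
    LinearEquiv.finrank_eq (Submodule.comapSubtypeEquivOfLe hNM)
  have hq : Module.finrank k (M ⧸ N') = Fintype.card ι := by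
    have := Submodule.finrank_quotient_add_finrank N'
    omega
  have b : Module.Basis ι k (M ⧸ N') :=
    (Module.finBasisOfFinrankEq k _ hq).reindex (Fintype.equivFin ι).symm
  choose g hg using fun j => Submodule.Quotient.mk_surjective N' (b j)
  refine ⟨fun j => (g j : V), fun j => (g j).2, fun x hx => ?_, fun c hc => ?_⟩
  · refine ⟨b.repr (Submodule.Quotient.mk ⟨x, hx⟩), ?_⟩
    have h1 : (⟨x, hx⟩ - ∑ j, b.repr (Submodule.Quotient.mk ⟨x, hx⟩) j • g j : M) ∈ N' := by
      rw [← Submodule.Quotient.mk_eq_zero, Submodule.Quotient.mk_sub,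
          ← Submodule.mkQ_apply N' (∑ j, _),
        map_sum]
      simp only [map_smul, Submodule.mkQ_apply, hg]
      rw [b.sum_repr, sub_self]
    simpa [hN'] using h1
  · have h1 : (∑ j, c j • g j : M) ∈ N' := by simpa [hN'] using hc
    rw [← Submodule.Quotient.mk_eq_zero, ← Submodule.mkQ_apply, map_sum] at h1
    simp only [map_smul, Submodule.mkQ_apply, hg] at h1
    exact funext fun j => Fintype.linearIndependent_iff.1 b.linearIndependent c h1 j

lemma finrank_ker_add {V W : Type*} [AddCommGroup V] [Module k V] [AddCommGroup W] [Module k W]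
    (φ : V →ₗ[k] W) {K M : Submodule k V} {N : Submodule k W} [Module.Finite k M]
    (hK : ∀ x, x ∈ K ↔ x ∈ M ∧ φ x = 0) (hN : ∀ x ∈ M, φ x ∈ N)
    (hs : ∀ y ∈ N, ∃ x ∈ M, φ x = y) :
    Module.finrank k K + Module.finrank k N = Module.finrank k M := by
  have hr : (φ.domRestrict M).range = N := by
    ext y
    constructor
    · rintro ⟨x, rfl⟩; exact hN _ x.2
    · intro hy
      obtain ⟨x, hx, rfl⟩ := hs y hy
      exact ⟨⟨x, hx⟩, rfl⟩
  have hk : (φ.domRestrict M).ker.map M.subtype = K := by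
    ext x
    simp [hK, and_comm]
  have e := LinearEquiv.finrank_eq
    (Submodule.equivMapOfInjective M.subtype M.injective_subtype (φ.domRestrict M).ker)
  rw [hk] at e
  rw [← e, ← hr, add_comm]
  exact LinearMap.finrank_range_add_finrank_ker _

lemma submodule_eq_bot_of_finrank {V : Type*} [AddCommGroup V] [Module k V] {K M : Submodule k V}
    [Module.Finite k M] (hKM : K ≤ M) (h : Module.finrank k K = 0) {x : V} (hx : x ∈ K) :
    x = 0 := by
  have : Module.Finite k K := Module.Finite.of_injective (Submodule.inclusion hKM)
    (Submodule.inclusion_injective hKM)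
  rw [Submodule.finrank_eq_zero] at h
  subst h
  simpa using hx

/-- The homogeneous component of an element of a graded free module. -/
noncomputable def fc {ι : Type*} (d : ι → ℤ) (n : ℤ) (w : ι → R4 k) : ι → R4 k :=
  fun j => cmp (n - d j) (w j)

lemma fc_mem {ι : Type*} (d : ι → ℤ) (n : ℤ) (w : ι → R4 k) : fc d n w ∈ FreeGr d n :=
  mem_FreeGr.2 fun _ => cmp_mem _ _

lemma exists_forall_eq_sum_cmp (p : R4 k) :
    ∃ s : Finset ℤ, ∀ t, s ⊆ t → p = ∑ n ∈ t, cmp n p := by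
  classical
  refine ⟨p.support.image fun d => (d.degree : ℤ), fun t ht => ?_⟩
  ext d
  rw [coeff_sum]
  simp only [coeff_cmp, Finset.sum_ite_eq]
  split_ifs with h
  · rfl
  · by_contra h1
    exact h (ht (Finset.mem_image.2 ⟨d, by simpa [mem_support_iff] using h1, rfl⟩))

lemma exists_eq_sum_fc {ι : Type*} [Finite ι] (d : ι → ℤ) (w : ι → R4 k) :
    ∃ s : Finset ℤ, w = ∑ n ∈ s, fc d n w := by
  classical
  have := Fintype.ofFinite ι
  choose s hs using fun j => exists_forall_eq_sum_cmp (w j)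
  refine ⟨Finset.univ.biUnion fun j => (s j).image (· + d j), ?_⟩
  funext j
  rw [Finset.sum_apply]
  simp only [fc]
  conv_lhs => rw [hs j ((Finset.univ.biUnion fun j => (s j).image (· + d j)).image (· - d j)) (by
    intro x hx
    refine Finset.mem_image.2 ⟨x + d j, ?_, by ring⟩
    exact Finset.mem_biUnion.2 ⟨j, Finset.mem_univ _, Finset.mem_image.2 ⟨x, hx, rfl⟩⟩)]
  rw [Finset.sum_image]
  intro x _ y _ h
  simpa using h

section
variable {M : Type*} [AddCommGroup M] [Module k M] [Module (R4 k) M]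
  {ι : Type*} [Fintype ι]

/-- The map from a free module given by a family of generators. -/
noncomputable def gmap (g : ι → M) : (ι → R4 k) →ₗ[R4 k] M := Fintype.linearCombination (R4 k) g

lemma gmap_apply {M : Type*} [AddCommGroup M] [Module (R4 k) M] (g : ι → M) (w : ι → R4 k) :
    gmap g w = ∑ j, w j • g j := rfl

/-- A family of subspaces is strongly graded. -/
def GrMod' (𝓜 : ℤ → Submodule k M) : Prop :=
  ∀ (m n l : ℤ) (r : R4 k) (x : M), r ∈ RZ k m → x ∈ 𝓜 n → m + n = l → r • x ∈ 𝓜 l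

variable (d : ι → ℤ) (g : ι → M) {𝓝 : ℤ → Submodule k M}

/-- The generators `g` generate the piece of degree `n`. -/
def Onto (𝓝 : ℤ → Submodule k M) (n : ℤ) : Prop :=
  ∀ y ∈ 𝓝 n, ∃ w ∈ FreeGr (k := k) d n, gmap g w = y

lemma gmap_mem (h : GrMod' 𝓝) (hg : ∀ j, g j ∈ 𝓝 (d j)) (n : ℤ) (w : ι → R4 k)
    (hw : w ∈ FreeGr d n) : gmap g w ∈ 𝓝 n :=
  Submodule.sum_mem _ fun j _ => h _ _ _ _ _ (mem_FreeGr.1 hw j) (hg j) (by ring)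

lemma surj_step {n : ℤ} (hx : GEx 𝓝 (KD0 k) (KD1 k) n)
    (hs : Onto d g 𝓝 (n - 1)) :
    Onto d g 𝓝 n := by
  intro y hy
  obtain ⟨u, hu, e⟩ := hx (fun _ => y) (fun _ => hy) (funext fun i => i.elim0)
  choose w hw hwu using fun i => hs (u i) (hu i)
  refine ⟨∑ i, (X i : R4 k) • w i, Submodule.sum_mem _ fun i _ => ?_, ?_⟩
  · have := FreeGr.grMod d (n - 1) (X i) (w i) (X_mem_RZ i) (hw i)
    rwa [sub_add_cancel] at this
  · rw [map_sum]
    simp only [map_smul, hwu]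
    have := congrFun e 0
    rw [this, smv_KD1]
    simp [Fin.sum_univ_four]

lemma surj_ge {m : ℤ} (hx : ∀ n, m < n → GEx 𝓝 (KD0 k) (KD1 k) n)
    (hs : Onto d g 𝓝 m) (n : ℤ) (hn : m ≤ n) :
    Onto d g 𝓝 n := by
  induction n, hn using Int.leInduction with
  | base => exact hs
  | succ n hn ih =>
    refine surj_step d g (hx _ (by omega)) ?_
    rwa [add_sub_cancel_right]

/-- The graded syzygies on a family of generators. -/
noncomputable def Syz [IsScalarTower k (R4 k) M] (n : ℤ) : Submodule k (ι → R4 k) :=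
  FreeGr d n ⊓ LinearMap.ker ((gmap g).restrictScalars k)

variable [IsScalarTower k (R4 k) M]

lemma mem_Syz {n : ℤ} {w : ι → R4 k} :
    w ∈ Syz (k := k) d g n ↔ w ∈ FreeGr (k := k) d n ∧ gmap g w = 0 := by
  simp [Syz]

lemma FreeGr.grMod' {ι : Type*} (d : ι → ℤ) : GrMod' (k := k) (FreeGr d) :=
  fun _ _ _ _ _ hr hx h => mem_FreeGr.2 fun j => mul_mem_RZ hr (mem_FreeGr.1 hx j) (by omega)

lemma Syz.grMod' : GrMod' (k := k) (Syz d g) := fun _ _ _ r x hr hx h => by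
  rw [mem_Syz] at hx ⊢
  exact ⟨FreeGr.grMod' d _ _ _ _ _ hr hx.1 h, by rw [map_smul, hx.2, smul_zero]⟩

lemma finrank_Syz (h : GrMod' 𝓝) (hg : ∀ j, g j ∈ 𝓝 (d j)) {n : ℤ}
    (hs : Onto d g 𝓝 n) :
    Module.finrank k (Syz (k := k) d g n) + Module.finrank k (𝓝 n) =
      ∑ j, Module.finrank k (RZ k (n - d j)) := by
  rw [← finrank_FreeGr]
  exact finrank_ker_add ((gmap g).restrictScalars k) (fun _ => mem_Syz d g)
    (fun x hx => gmap_mem d g h hg n x hx) hs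

lemma GEx_Syz (h : GrMod' 𝓝) (hg : ∀ j, g j ∈ 𝓝 (d j)) {p q s u : ℕ}
    {A : Matrix (Fin p) (Fin q) (R4 k)} {B : Matrix (Fin q) (Fin s) (R4 k)}
    {C : Matrix (Fin s) (Fin u) (R4 k)} (hC : ∀ i j, C i j ∈ RZ k 1) (hBC : B * C = 0) {n : ℤ}
    (hs : Onto d g 𝓝 (n - 2))
    (h1 : ∀ j, GEx (RZ k) A B (n - d j)) (h2 : GEx 𝓝 B C (n - 1)) :
    GEx (k := k) (Syz d g) A B n :=
  GEx.ker hC hBC (FreeGr.grMod d) (gmap g) (fun _ _ hx => gmap_mem d g h hg _ _ hx)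
    (fun _ _ => mem_Syz d g) hs (GEx_free d h1) h2

end

/-- Passing from graded pieces to arbitrary elements, for generators of an ideal. -/
lemma fc_gmap_ideal {ι : Type*} [Fintype ι] (d : ι → ℤ) (g : ι → R4 k)
    (hg : ∀ j, g j ∈ RZ k (d j)) (n : ℤ) (w : ι → R4 k) :
    gmap g (fc d n w) = cmp n (gmap g w) := by
  simp only [gmap_apply, map_sum, smul_eq_mul, fc]
  refine Finset.sum_congr rfl fun j _ => ?_
  rw [mul_comm, mul_comm (w j), cmp_mul (hg j)]

lemma fc_gmap_free {ι κ : Type*} [Fintype ι] (d : ι → ℤ) (e : κ → ℤ) (g : ι → κ → R4 k)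
    (hg : ∀ j, g j ∈ FreeGr e (d j)) (n : ℤ) (w : ι → R4 k) :
    gmap (k := k) g (fc d n w) = fc e n (gmap g w) := by
  funext l
  simp only [gmap_apply, fc, Finset.sum_apply, Pi.smul_apply, smul_eq_mul, map_sum]
  refine Finset.sum_congr rfl fun j _ => ?_
  rw [mul_comm, mul_comm (w j), cmp_mul (mem_FreeGr.1 (hg j) l)]
  congr 3
  ring

lemma mem_range_of_fc {ι κ : Type*} [Fintype ι] [Finite κ] (d : ι → ℤ) (e : κ → ℤ)
    (g : ι → κ → R4 k) (w : κ → R4 k)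
    (h : ∀ n, ∃ u ∈ FreeGr (k := k) d n, gmap (k := k) g u = fc e n w) :
        ∃ u, gmap (k := k) g u = w := by
  obtain ⟨s, hs⟩ := exists_eq_sum_fc e w
  choose u _ hu using h
  refine ⟨∑ n ∈ s, u n, ?_⟩
  rw [map_sum]
  simp only [hu]
  exact hs.symm

lemma entryOk_of_mem {d e : ℕ} {q : R4 k} (hq : q ∈ RZ k ((d : ℤ) - e)) (h : e < d) :
    EntryOk k d e q := by
  obtain ⟨c, rfl⟩ := Nat.exists_eq_add_of_lt h
  have hc : ((e + c + 1 : ℕ) : ℤ) - e = ((c + 1 : ℕ) : ℤ) := by push_cast; ring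
  rw [hc] at hq
  refine ⟨Or.inr ⟨c + 1, by ring, mem_RZ_nat.1 hq⟩, ?_⟩
  by_contra h0
  have := mem_RZ.1 hq 0 h0
  simp at this
  omega

end GradedPresentations

section Resolution
variable {k : Type} [Field k]

/-- The properties of a set of points on a cubic surface that determine its resolution. -/
structure QProp (f : R4 k) (a : ℤ) {ι : Type*} [Fintype ι] (v : ι → Fin 4 → k) : Prop where
  card : 2 * (Fintype.card ι : ℤ) = 3 * a * (a - 1) + 2 * a + 2
  onX : ∀ i, eval (v i) f = 0
  interp : ∀ c : ι → k, ∃ F ∈ RZ k a, ∀ i, eval (v i) F = c i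
  dvd_of_vanish : ∀ F ∈ RZ k (a - 1), (∀ i, eval (v i) F = 0) → f ∣ F
  euler : ∀ T : Fin 4 → R4 k, (∀ j, T j ∈ RZ k (a - 1)) →
    (∀ i j l, eval (v i) (T j) * v i l = eval (v i) (T l) * v i j) →
    ∃ U, ∀ j, f ∣ T j - X j * U
  gen : 2 ≤ a → ∀ F ∈ RZ k (a + 1), (∀ i, eval (v i) F = 0) →
    ∃ G : Fin 4 → R4 k, (∀ j, G j ∈ RZ k a ∧ ∀ i, eval (v i) (G j) = 0) ∧
      f ∣ F - ∑ j, X j * G j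

/-- Evaluation at a set of points. -/
noncomputable def evL {ι : Type*} (v : ι → Fin 4 → k) : R4 k →ₗ[k] (ι → k) :=
  LinearMap.pi fun i => (aeval (v i)).toLinearMap

lemma evL_apply {ι : Type*} (v : ι → Fin 4 → k) (F : R4 k) (i : ι) :
    evL v F i = eval (v i) F := by
  simp [evL, aeval_eq_eval]

/-- The graded pieces of the ideal of a set of points. -/
noncomputable def IZ {ι : Type*} (v : ι → Fin 4 → k) (n : ℤ) : Submodule k (R4 k) :=
  RZ k n ⊓ LinearMap.ker (evL v)

lemma mem_IZ {ι : Type*} {v : ι → Fin 4 → k} {n : ℤ} {F : R4 k} :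
    F ∈ IZ v n ↔ F ∈ RZ k n ∧ ∀ i, eval (v i) F = 0 := by
  simp only [IZ, Submodule.mem_inf, LinearMap.mem_ker, funext_iff, evL_apply, Pi.zero_apply]

lemma IZ.grMod' {ι : Type*} (v : ι → Fin 4 → k) : GrMod' (IZ v) :=
  fun _ _ _ _ _ hr hx h => mem_IZ.2 ⟨mul_mem_RZ hr (mem_IZ.1 hx).1 h, fun i => by
    rw [smul_eq_mul, map_mul, (mem_IZ.1 hx).2 i, mul_zero]⟩

instance {ι : Type*} (v : ι → Fin 4 → k) (n : ℤ) : Module.Finite k (IZ v n) :=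
  Module.Finite.of_injective (Submodule.inclusion (inf_le_left : IZ v n ≤ RZ k n))
    (Submodule.inclusion_injective _)

lemma eval_zero_RZ {n : ℤ} (hn : 0 < n) {F : R4 k} (hF : F ∈ RZ k n) :
    eval (0 : Fin 4 → k) F = 0 := by
  lift n to ℕ using hn.le
  have := eval_smul_RZ hF 0 0
  rwa [zero_pow (by omega), zero_mul, smul_zero] at this

section
variable {f : R4 k} {a : ℤ} {ι : Type*} [Fintype ι] {v : ι → Fin 4 → k}

lemma QProp.ne_zero (hQ : QProp f a v) (ha : 0 < a) (i : ι) : v i ≠ 0 := by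
  intro h
  obtain ⟨F, hF, hi⟩ := hQ.interp fun _ => 1
  have := hi i
  rw [h, eval_zero_RZ ha hF] at this
  exact zero_ne_one this

lemma QProp.interp_ge (hQ : QProp f a v) (ha : 0 < a) (n : ℤ) (hn : a ≤ n) :
    ∀ c : ι → k, ∃ F ∈ RZ k n, ∀ i, eval (v i) F = c i := by
  induction n, hn using Int.leInduction with
  | base => exact hQ.interp
  | succ n hn ih =>
    intro c
    choose l hl using fun i => exists_dual (hQ.ne_zero ha i)
    choose F hF hFc using fun j => ih fun i => l i j * c i
    refine ⟨∑ j, X j * F j, Submodule.sum_mem _ fun j _ => X_mul_mem (hF j) j rfl, fun i => ?_⟩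
    rw [map_sum]
    simp only [map_mul, eval_X, hFc, Fin.sum_univ_four]
    linear_combination c i * hl i

lemma QProp.finrank_IZ (hQ : QProp f a v) (ha : 0 < a) {n : ℤ} (hn : a ≤ n) :
    6 * (Module.finrank k (IZ v n) : ℤ) + 3 * (3 * a * (a - 1) + 2 * a + 2) =
      (n + 1) * (n + 2) * (n + 3) := by
  have h := finrank_ker_add (evL v) (K := IZ v n) (M := RZ k n) (N := (⊤ : Submodule k (ι → k)))
    (fun x => by simp [IZ]) (fun _ _ => Submodule.mem_top) (fun y _ => by
      obtain ⟨F, hF, h⟩ := hQ.interp_ge ha n hn y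
      exact ⟨F, hF, funext fun i => by rw [evL_apply, h]⟩)
  rw [finrank_top, Module.finrank_fintype_fun_eq_card] at h
  rw [← finrank_RZ (k := k) (by omega), ← h, ← hQ.card]
  push_cast
  ring

lemma GEx_IZ {ι : Type*} {v : ι → Fin 4 → k} {p q s u : ℕ}
    {A : Matrix (Fin p) (Fin q) (R4 k)} {B : Matrix (Fin q) (Fin s) (R4 k)}
    {C : Matrix (Fin s) (Fin u) (R4 k)} (hC : ∀ i j, C i j ∈ RZ k 1) (hBC : B * C = 0) {n : ℤ}
    (hs : ∀ c : ι → k, ∃ F ∈ RZ k (n - 2), ∀ i, eval (v i) F = c i)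
    (h1 : GEx (RZ k) A B n) (h2 : GEx (fun _ => (⊤ : Submodule k (KZ v))) B C (n - 1)) :
    GEx (IZ v) A B n := by
  refine GEx.ker hC hBC RZ.grMod (evKZ v) (𝓝 := fun _ => ⊤) (fun _ _ _ => Submodule.mem_top)
    (fun n x => ?_) (fun y _ => ?_) h1 h2
  · rw [mem_IZ]
    refine and_congr_right fun _ => ⟨fun h => KZ.ext fun i => ?_, fun h i => ?_⟩
    · rw [evKZ_val, KZ_zero, h]
    · rw [← evKZ_val, h, KZ_zero]
  · obtain ⟨F, hF, h⟩ := hs y.val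
    exact ⟨F, hF, KZ.ext fun i => by rw [evKZ_val, h]⟩

lemma QProp.GEx0 (hQ : QProp f a v) (ha : 0 < a) {n : ℤ} (hn : a + 2 ≤ n) :
    GEx (IZ v) (KD0 k) (KD1 k) n :=
  GEx_IZ KD2_deg KD_mul_12 (hQ.interp_ge ha _ (by omega))
    (GEx_R_zero (by omega)) (GEx_KZ1 (hQ.ne_zero ha) _)

lemma QProp.GEx1 (hQ : QProp f a v) (ha : 0 < a) {n : ℤ} (hn : a + 2 ≤ n) :
    GEx (IZ v) (KD1 k) (KD2 k) n :=
  GEx_IZ KD3_deg KD_mul_23 (hQ.interp_ge ha _ (by omega))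
    (GEx_R KD2_deg (fun _ h => koszulR1 h) n) (GEx_KZ2 (hQ.ne_zero ha) _)

lemma QProp.GEx2 (hQ : QProp f a v) (ha : 0 < a) {n : ℤ} (hn : a + 2 ≤ n) :
    GEx (IZ v) (KD2 k) (KD3 k) n :=
  GEx_IZ KD4_deg KD_mul_34 (hQ.interp_ge ha _ (by omega))
    (GEx_R KD3_deg (fun _ h => koszulR2 h) n) (GEx_KZ3 (hQ.ne_zero ha) _)

lemma dvd_of_dvd_X_mul (hf : Prime f) (hf3 : f ∈ RZ k 3) {i : Fin 4} {F : R4 k}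
    (h : f ∣ X i * F) : f ∣ F := by
  refine (hf.dvd_or_dvd h).resolve_left fun h1 => ?_
  obtain ⟨q, hq, e⟩ := exists_quot hf3 (X_mem_RZ i) h1
  rw [RZ_neg (by omega) hq, mul_zero] at e
  exact X_ne_zero i e

lemma QProp.dvd_of_mem (hQ : QProp f a v) (hf : Prime f) (hf3 : f ∈ RZ k 3) {n : ℤ} (hn : n < a)
    {F : R4 k} (hF : F ∈ IZ v n) : f ∣ F := by
  obtain ⟨m, hm⟩ : ∃ m : ℕ, n + m = a - 1 := ⟨(a - 1 - n).toNat, by omega⟩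
  induction m generalizing n F with
  | zero =>
    obtain rfl : n = a - 1 := by simpa using hm
    exact hQ.dvd_of_vanish F (mem_IZ.1 hF).1 (mem_IZ.1 hF).2
  | succ m ih =>
    push_cast at hm
    exact dvd_of_dvd_X_mul hf hf3 (i := 0) (ih (n := n + 1) (by omega)
      (IZ.grMod' v 1 n _ _ _ (X_mem_RZ 0) hF (by ring)) (by omega))

end

section
variable {f : R4 k} {a : ℕ} {ι : Type*} [Fintype ι] {v : ι → Fin 4 → k}

/-- The degrees of the generators. -/
def deg1 (a : ℕ) : Fin (2 * a) ⊕ Fin 1 → ℤ := Sum.elim (fun _ => a) (fun _ => 3)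

/-- The degrees of the first syzygies. -/
def deg2 (a : ℕ) : Fin (3 * a - 3) ⊕ Fin 3 → ℤ := Sum.elim (fun _ => a + 1) (fun _ => a + 2)

lemma gmap_sum {α β M : Type*} [Fintype α] [Fintype β] [AddCommGroup M] [Module (R4 k) M]
    (g : α ⊕ β → M) (w : α ⊕ β → R4 k) :
    gmap g w = ∑ i, w (Sum.inl i) • g (Sum.inl i) + ∑ i, w (Sum.inr i) • g (Sum.inr i) := by
  rw [gmap_apply, Fintype.sum_sum_type]

theorem QProp.exists_gens (hQ : QProp f a v) (ha : 3 ≤ a) (hf : Prime f) (hf3 : f ∈ RZ k 3) :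
    ∃ g : Fin (2 * a) ⊕ Fin 1 → R4 k, (∀ i, g (Sum.inr i) = f) ∧ (∀ j, g j ∈ IZ v (deg1 a j)) ∧
      (∀ n, Onto (deg1 a) g (IZ v) n) ∧
      ∀ c : Fin (2 * a) → k, f ∣ ∑ j, C (c j) * g (Sum.inl j) → c = 0 := by
  have hf0 := hf.ne_zero
  set N : Submodule k (R4 k) := (RZ k ((a : ℤ) - 3)).map (LinearMap.mulLeft k f) with hN
  have hNM : N ≤ IZ v a := by
    rintro _ ⟨q, hq, rfl⟩
    refine mem_IZ.2 ⟨mul_mem_RZ hf3 hq (by ring), fun i => ?_⟩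
    simp [hQ.onX i]
  have hNr : Module.finrank k N = Module.finrank k (RZ k ((a : ℤ) - 3)) :=
    (LinearEquiv.finrank_eq (Submodule.equivMapOfInjective _
      (fun _ _ h => mul_left_cancel₀ hf0 h) _)).symm
  have hr : Module.finrank k (IZ v (a : ℤ)) = Module.finrank k N + Fintype.card (Fin (2 * a)) := by
    have h1 := hQ.finrank_IZ (by omega) le_rfl
    have h2 := finrank_RZ (k := k) (n := (a : ℤ) - 3) (by omega)
    rw [hNr, Fintype.card_fin]
    zify
    linarith
  obtain ⟨g0, hg0, hspan, hind⟩ := exists_basis_mod N _ hNM hr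
  set g : Fin (2 * a) ⊕ Fin 1 → R4 k := Sum.elim g0 fun _ => f with hg
  have hbase : Onto (deg1 a) g (IZ v) a := by
    intro y hy
    obtain ⟨c, q, hq, e⟩ := hspan y hy
    refine ⟨Sum.elim (fun j => C (c j)) fun _ => q, mem_FreeGr.2 ?_, ?_⟩
    · rintro (j | j)
      · simpa [deg1] using C_mem_RZ (c j)
      · exact hq
    · rw [gmap_sum]
      simp only [hg, Sum.elim_inl, Sum.elim_inr, smul_eq_mul, Finset.univ_unique,
        Finset.sum_const, Finset.card_singleton, one_smul, ← smul_eq_C_mul]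
      rw [LinearMap.mulLeft_apply] at e
      linear_combination e
  have hlow (n : ℤ) (F : R4 k) (hF : F ∈ RZ k n) (hd : f ∣ F) :
      ∃ w ∈ FreeGr (k := k) (deg1 a) n, gmap g w = F := by
    obtain ⟨q, hq, rfl⟩ := exists_quot hf3 hF hd
    refine ⟨Sum.elim (fun _ => 0) fun _ => q, mem_FreeGr.2 ?_, ?_⟩
    · rintro (j | j)
      · exact Submodule.zero_mem _
      · exact hq
    · rw [gmap_sum]
      simp [hg, mul_comm]
  refine ⟨g, fun _ => rfl, ?_, fun n => ?_, fun c hc => ?_⟩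
  · rintro (j | j)
    · exact hg0 j
    · exact mem_IZ.2 ⟨hf3, hQ.onX⟩
  · rcases lt_or_ge n a with h | h
    · exact fun y hy => hlow n y (mem_IZ.1 hy).1 (hQ.dvd_of_mem hf hf3 h hy)
    rcases h.eq_or_lt with rfl | h
    · exact hbase
    refine surj_ge (deg1 a) g (m := a + 1) (fun n hn => hQ.GEx0 (by omega) (by omega)) ?_ n h
    intro y hy
    obtain ⟨G, hG, hd⟩ := hQ.gen (by omega) y (mem_IZ.1 hy).1 (mem_IZ.1 hy).2
    choose w hw hwG using fun j => hbase (G j) (mem_IZ.2 (hG j))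
    obtain ⟨u, hu, huG⟩ := hlow (a + 1) _ (Submodule.sub_mem _ (mem_IZ.1 hy).1
      (Submodule.sum_mem _ fun j _ => X_mul_mem (hG j).1 j rfl)) hd
    refine ⟨u + ∑ j, (X j : R4 k) • w j, Submodule.add_mem _ hu
      (Submodule.sum_mem _ fun j _ => FreeGr.grMod _ _ _ _ (X_mem_RZ j) (hw j)), ?_⟩
    rw [map_add, map_sum, huG]
    simp only [map_smul, hwG, smul_eq_mul]
    ring
  · refine hind c ?_
    have hmem : ∑ j, c j • g0 j ∈ RZ k (a : ℤ) :=
      Submodule.sum_mem _ fun j _ => Submodule.smul_mem _ _ (mem_IZ.1 (hg0 j)).1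
    simp only [hg, Sum.elim_inl, ← smul_eq_C_mul] at hc
    obtain ⟨q, hq, e⟩ := exists_quot hf3 hmem hc
    exact ⟨q, hq, e.symm⟩

end
end Resolution

section FirstSyzygies
variable {k : Type} [Field k]

lemma C_smul_eq {M : Type*} [AddCommGroup M] [Module k M] [Module (R4 k) M]
    [IsScalarTower k (R4 k) M] (c : k) (x : M) : (C c : R4 k) • x = c • x := by
  rw [← algebraMap_eq, algebraMap_smul]

lemma exists_const_of_nonpos {n : ℤ} (hn : n ≤ 0) {p : R4 k} (hp : p ∈ RZ k n) :
    ∃ c, p = C c := by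
  rcases hn.lt_or_eq with h | rfl
  · exact ⟨0, by rw [RZ_neg h hp, C_0]⟩
  · exact RZ_zero_deg hp

lemma exists_linear {p : R4 k} (hp : p ∈ RZ k 1) : ∃ c : Fin 4 → k, p = ∑ i, X i * C (c i) := by
  obtain ⟨q, hq, e⟩ := exists_eq_sum_X one_pos hp
  choose c hc using fun i => RZ_zero_deg (by simpa using hq i)
  exact ⟨c, by rw [e]; simp only [hc]⟩

variable {f : R4 k} {a : ℕ} {ι : Type*} [Fintype ι] {v : ι → Fin 4 → k}
  {g : Fin (2 * a) ⊕ Fin 1 → R4 k}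

/-- Relations with constant coefficients on the generators of degree `a` are trivial. -/
lemma syz_eq_zero_of_const (hgr : ∀ i, g (Sum.inr i) = f)
    (hgi : ∀ c : Fin (2 * a) → k, f ∣ ∑ j, C (c j) * g (Sum.inl j) → c = 0)
    {w : Fin (2 * a) ⊕ Fin 1 → R4 k} (hw : f ∣ gmap g w) {c : Fin (2 * a) → k}
    (hc : ∀ j, w (Sum.inl j) = C (c j)) : c = 0 := by
  refine hgi c ?_
  rw [gmap_sum] at hw
  simp only [hc, hgr, smul_eq_mul, ← Finset.sum_mul] at hw
  exact (dvd_add_left (dvd_mul_left _ _)).1 hw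

lemma syz_eq_zero_of_inl (hf : Prime f) (hgr : ∀ i, g (Sum.inr i) = f)
    {w : Fin (2 * a) ⊕ Fin 1 → R4 k} (hw : gmap g w = 0)
    (h0 : ∀ j, w (Sum.inl j) = 0) : w = 0 := by
  rw [gmap_sum] at hw
  simp only [h0, hgr, smul_eq_mul, zero_mul, Finset.sum_const_zero, zero_add,
    Finset.univ_unique, Finset.sum_singleton] at hw
  funext j
  rcases j with j | j
  · exact h0 j
  · rw [Subsingleton.elim j default]
    exact (mul_eq_zero.1 hw).resolve_right hf.ne_zero

lemma syz_low (hf : Prime f) (hgr : ∀ i, g (Sum.inr i) = f)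
    (hgi : ∀ c : Fin (2 * a) → k, f ∣ ∑ j, C (c j) * g (Sum.inl j) → c = 0) {n : ℤ} (hn : n ≤ a)
    {w : Fin (2 * a) ⊕ Fin 1 → R4 k} (hw : w ∈ Syz (k := k) (deg1 a) g n) : w = 0 := by
  rw [mem_Syz, mem_FreeGr] at hw
  choose c hc using fun j => exists_const_of_nonpos (by simp [deg1, hn]) (hw.1 (Sum.inl j))
  have h0 := syz_eq_zero_of_const hgr hgi (by rw [hw.2]; exact dvd_zero _) hc
  exact syz_eq_zero_of_inl hf hgr hw.2 fun j => by rw [hc, h0]; simp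

lemma QProp.finrank_syz (hQ : QProp f a v) (ha : 3 ≤ a) (hgm : ∀ j, g j ∈ IZ v (deg1 a j))
    {n : ℤ} (hs : Onto (deg1 a) g (IZ v) n) (hn : a ≤ n) :
    6 * (Module.finrank k (Syz (k := k) (deg1 a) g n) : ℤ) + (n + 1) * (n + 2) * (n + 3) =
      2 * a * ((n - a + 1) * (n - a + 2) * (n - a + 3)) + (n - 2) * (n - 1) * n +
        3 * (3 * a * (a - 1) + 2 * a + 2) := by
  have h1 := finrank_Syz (deg1 a) g (IZ.grMod' v) hgm hs
  have h2 := hQ.finrank_IZ (by omega) hn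
  have h3 := finrank_RZ (k := k) (n := n - a) (by omega)
  have h4 := finrank_RZ (k := k) (n := n - 3) (by omega)
  rw [Fintype.sum_sum_type] at h1
  change _ = ∑ _ : Fin (2 * a), Module.finrank k (RZ k (n - a)) +
    ∑ _ : Fin 1, Module.finrank k (RZ k (n - 3)) at h1
  simp only [Finset.sum_const, Finset.card_univ, Fintype.card_fin, smul_eq_mul, one_mul] at h1
  zify at h1
  linear_combination 6 * h1 - h2 + 2 * (a : ℤ) * h3 + h4

lemma QProp.syz_koszul (hQ : QProp f a v) (hf : Prime f)
    (hgr : ∀ i, g (Sum.inr i) = f) (hgm : ∀ j, g j ∈ IZ v (deg1 a j))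
    (hgi : ∀ c : Fin (2 * a) → k, f ∣ ∑ j, C (c j) * g (Sum.inl j) → c = 0)
    {s : Fin 4 → Fin (2 * a) ⊕ Fin 1 → R4 k} (hs : ∀ i, s i ∈ Syz (k := k) (deg1 a) g (a + 1))
    (h0 : ∑ i, (X i : R4 k) • s i = 0) : s = 0 := by
  simp only [mem_Syz] at hs
  obtain ⟨c, hc, rfl⟩ := GEx_free (deg1 a) (n := a + 1)
    (fun j => GEx_R KD2_deg (fun _ h => koszulR1 h) _) s (fun i => (hs i).1) (by
      rw [smv_KD1, ← Fin.sum_univ_four (fun i => (X i : R4 k) • s i), h0]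
      funext i; simp)
  rw [add_sub_cancel_right] at hc
  have hG := fun e => gmap_mem (deg1 a) g (IZ.grMod' v) hgm _ _ (hc e)
  have hG0 : smv (KD2 k) (fun e => gmap g (c e)) = 0 := by
    rw [← map_smv]
    exact funext fun i => (hs i).2
  obtain ⟨T, hT, e⟩ := GEx_R KD3_deg (fun _ h => koszulR2 h) a _ (fun i => (mem_IZ.1 (hG i)).1) hG0
  rw [smv_KD3] at e
  have e0 := congrFun e 0
  have e1 := congrFun e 1
  have e2 := congrFun e 2
  have e3 := congrFun e 3
  have e4 := congrFun e 4
  have e5 := congrFun e 5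
  simp [smul_eq_mul] at e0 e1 e2 e3 e4 e5
  have ev := fun i j => (mem_IZ.1 (hG i)).2 j
  obtain ⟨U, hU⟩ := hQ.euler ![-T 3, T 2, -T 1, T 0] (by
      intro j
      fin_cases j
      exacts [Submodule.neg_mem _ (hT 3), hT 2, Submodule.neg_mem _ (hT 1), hT 0]) (by
      intro i j l
      have h0 := ev 0 i
      have h1 := ev 1 i
      have h2 := ev 2 i
      have h3 := ev 3 i
      have h4 := ev 4 i
      have h5 := ev 5 i
      rw [e0] at h0
      rw [e1] at h1
      rw [e2] at h2
      rw [e3] at h3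
      rw [e4] at h4
      rw [e5] at h5
      simp only [map_add, map_sub, map_mul, map_neg, eval_X] at h0 h1 h2 h3 h4 h5
      fin_cases j <;> fin_cases l <;> simp <;> first
        | linear_combination h0
        | linear_combination h1
        | linear_combination h2
        | linear_combination h3
        | linear_combination h4
        | linear_combination h5
        | linear_combination -h0
        | linear_combination -h1
        | linear_combination -h2
        | linear_combination -h3
        | linear_combination -h4
        | linear_combination -h5)
  have u0 := hU 0
  have u1 := hU 1
  have u2 := hU 2
  have u3 := hU 3
  simp at u0 u1 u2 u3
  have hd : ∀ i, f ∣ gmap g (c i) := by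
    have key : ∀ {p q : R4 k} (i j : Fin 4), f ∣ p - X i * U → f ∣ q - X j * U →
        f ∣ X i * q - X j * p := fun {p q} i j hp hq => by
      have := dvd_sub (hq.mul_left (X i)) (hp.mul_left (X j))
      rwa [show X i * (q - X j * U) - X j * (p - X i * U) = X i * q - X j * p by ring] at this
    intro i
    fin_cases i
    · simpa [e0] using key 2 3 u2 u3
    · have := key 3 1 u3 u1
      change f ∣ gmap g (c 1)
      rw [e1]
      rwa [show -(X 1 * T 0) + X 3 * T 2 = X 3 * T 2 - X 1 * T 0 by ring]
    · have := key 1 2 u1 u2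
      change f ∣ gmap g (c 2)
      rw [e2]
      rwa [show -(X 1 * T 1) - X 2 * T 2 = X 1 * -T 1 - X 2 * T 2 by ring]
    · simpa [e3] using key 0 3 u0 u3
    · have := key 2 0 u2 u0
      change f ∣ gmap g (c 4)
      rw [e4]
      rwa [show X 0 * T 1 - X 2 * T 3 = X 2 * -T 3 - X 0 * -T 1 by ring]
    · simpa [e5] using key 0 1 u0 u1
  have hc0 : ∀ e j, c e (Sum.inl j) = 0 := by
    intro e j
    choose b hb using fun j => RZ_zero_deg (by simpa [deg1] using mem_FreeGr.1 (hc e) (Sum.inl j))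
    rw [hb, syz_eq_zero_of_const hgr hgi (hd e) hb]
    simp
  refine funext fun i => ?_
  refine syz_eq_zero_of_inl hf hgr (hs i).2 fun j => ?_
  simp [smv, hc0]

end FirstSyzygies

section SecondSyzygies
variable {k : Type} [Field k]

/-- Multiplication of constant combinations of a family by the linear forms. -/
noncomputable def linMap {m : ℕ} {κ : Type*} (s : Fin m → κ → R4 k) :
    (Fin 4 → Fin m → k) →ₗ[k] (κ → R4 k) where
  toFun c := ∑ i, (X i : R4 k) • ∑ j, c i j • s j
  map_add' c d := by simp [add_smul, smul_add, Finset.sum_add_distrib]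
  map_smul' r c := by
    simp only [Pi.smul_apply, smul_eq_mul, RingHom.id_apply, Finset.smul_sum, mul_smul]
    refine Finset.sum_congr rfl fun i _ => Finset.sum_congr rfl fun j _ => ?_
    rw [smul_comm]

lemma linMap_apply {m : ℕ} {κ : Type*} (s : Fin m → κ → R4 k) (c : Fin 4 → Fin m → k) :
    linMap s c = ∑ i, (X i : R4 k) • ∑ j, c i j • s j := rfl

variable {f : R4 k} {a : ℕ} {ι : Type*} [Fintype ι] {v : ι → Fin 4 → k}
  {g : Fin (2 * a) ⊕ Fin 1 → R4 k}

instance {κ M : Type*} [Fintype κ] [AddCommGroup M] [Module k M] [Module (R4 k) M]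
    [IsScalarTower k (R4 k) M] (d : κ → ℤ) (g : κ → M) (n : ℤ) :
    Module.Finite k (Syz (k := k) d g n) :=
  Module.Finite.of_injective (Submodule.inclusion (inf_le_left : Syz (k := k) d g n ≤ FreeGr d n))
    (Submodule.inclusion_injective _)

theorem QProp.exists_syz (hQ : QProp f a v) (ha : 3 ≤ a) (hf : Prime f)
    (hgr : ∀ i, g (Sum.inr i) = f) (hgm : ∀ j, g j ∈ IZ v (deg1 a j))
    (hgo : ∀ n, Onto (deg1 a) g (IZ v) n)
    (hgi : ∀ c : Fin (2 * a) → k, f ∣ ∑ j, C (c j) * g (Sum.inl j) → c = 0) :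
    ∃ s : Fin (3 * a - 3) ⊕ Fin 3 → Fin (2 * a) ⊕ Fin 1 → R4 k,
      (∀ j, s j ∈ Syz (k := k) (deg1 a) g (deg2 a j)) ∧
      (∀ n, Onto (k := k) (deg2 a) s (Syz (k := k) (deg1 a) g) n) ∧
      ∀ n : ℤ, n ≤ a + 2 → ∀ w ∈ Syz (k := k) (deg2 a) s n, w = 0 := by
  obtain ⟨s0, hs0, hs0s, hs0i⟩ := exists_basis_mod (ι := Fin (3 * a - 3)) ⊥
    (Syz (k := k) (deg1 a) g (a + 1)) bot_le (by
      have := hQ.finrank_syz ha hgm (hgo (a + 1)) (by omega)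
      rw [finrank_bot, Fintype.card_fin]
      zify [show 3 ≤ 3 * a by omega]
      linarith)
  have hinj : Function.Injective (linMap s0) := by
    rw [injective_iff_map_eq_zero]
    intro c hc
    have := hQ.syz_koszul hf hgr hgm hgi (s := fun i => ∑ j, c i j • s0 j)
      (fun i => Submodule.sum_mem _ fun j _ => Submodule.smul_mem _ _ (hs0 j)) hc
    funext i
    exact hs0i (c i) (by rw [Submodule.mem_bot]; exact congrFun this i)
  have hP : (linMap s0).range ≤ Syz (k := k) (deg1 a) g (a + 2) := by
    rintro _ ⟨c, rfl⟩
    exact Submodule.sum_mem _ fun i _ => Syz.grMod' _ _ 1 (a + 1) _ _ _ (X_mem_RZ i)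
      (Submodule.sum_mem _ fun j _ => Submodule.smul_mem _ _ (hs0 j)) (by ring)
  obtain ⟨u, hu, hus, hui⟩ := exists_basis_mod (ι := Fin 3) _ _ hP (by
      have h1 := hQ.finrank_syz ha hgm (hgo (a + 2)) (by omega)
      have h2 := LinearMap.finrank_range_of_inj hinj
      rw [Module.finrank_pi_fintype] at h2
      simp only [Module.finrank_fin_fun, Finset.sum_const, Finset.card_univ, Fintype.card_fin,
        smul_eq_mul] at h2
      rw [h2, Fintype.card_fin]
      zify [show 3 ≤ 3 * a by omega]
      linarith)
  have hdec : ∀ (w : Fin (3 * a - 3) ⊕ Fin 3 → R4 k) (c : Fin 4 → Fin (3 * a - 3) → k)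
      (b : Fin 3 → k), (∀ j, w (Sum.inl j) = ∑ i, X i * C (c i j)) →
      (∀ j, w (Sum.inr j) = C (b j)) →
      gmap (Sum.elim s0 u) w = linMap s0 c + ∑ j, b j • u j := by
    intro w c b hc hb
    rw [gmap_sum, linMap_apply]
    simp only [Sum.elim_inl, Sum.elim_inr, hc, hb, C_smul_eq, Finset.sum_smul, Finset.smul_sum,
      mul_smul]
    rw [Finset.sum_comm]
  have h2 : Onto (k := k) (deg2 a) (Sum.elim s0 u) (Syz (k := k) (deg1 a) g) (a + 2) := by
    intro y hy
    obtain ⟨b, c, hc⟩ := hus y hy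
    refine ⟨Sum.elim (fun j => ∑ i, X i * C (c i j)) fun j => C (b j), mem_FreeGr.2 ?_, ?_⟩
    · rintro (j | j)
      · simp only [deg2, Sum.elim_inl]
        refine Submodule.sum_mem _ fun i _ => mul_mem_RZ (X_mem_RZ i) (C_mem_RZ _) (by ring)
      · simpa [deg2] using C_mem_RZ (b j)
    · rw [hdec _ c b (fun _ => rfl) (fun _ => rfl), hc, sub_add_cancel]
  refine ⟨Sum.elim s0 u, ?_, ?_, ?_⟩
  · rintro (j | j)
    exacts [hs0 j, hu j]
  · intro n
    rcases lt_or_ge (n : ℤ) (a + 2) with hn | hn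
    · rcases (show n ≤ a ∨ n = a + 1 by omega) with h | rfl
      · intro y hy
        exact ⟨0, Submodule.zero_mem _, by rw [map_zero, syz_low hf hgr hgi h hy]⟩
      · intro y hy
        obtain ⟨c, hc⟩ := hs0s y hy
        refine ⟨Sum.elim (fun j => C (c j)) 0, mem_FreeGr.2 ?_, ?_⟩
        · rintro (j | j)
          · simpa [deg2] using C_mem_RZ (c j)
          · exact Submodule.zero_mem _
        · rw [gmap_sum]
          simp only [Sum.elim_inl, Sum.elim_inr, C_smul_eq, Pi.zero_apply, zero_smul,
            Finset.sum_const_zero, add_zero]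
          exact (sub_eq_zero.1 ((Submodule.mem_bot _).1 hc)).symm
    · refine surj_ge _ _ (m := (a : ℤ) + 2) (fun n hn => ?_) h2 n hn
      refine GEx_Syz (deg1 a) g (IZ.grMod' v) hgm KD2_deg KD_mul_12 (hgo _) (fun j => ?_)
        (hQ.GEx1 (by omega) (by omega))
      refine GEx_R_zero ?_
      rcases j with j | j <;> simp [deg1] <;> omega
  · have key : ∀ w ∈ Syz (k := k) (deg2 a) (Sum.elim s0 u) (a + 2), w = 0 := by
      intro w hw
      rw [mem_Syz, mem_FreeGr] at hw
      choose c hc using fun j => exists_linear (by simpa [deg2] using hw.1 (Sum.inl j))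
      choose b hb using fun j => RZ_zero_deg (by simpa [deg2] using hw.1 (Sum.inr j))
      have h := hw.2
      rw [hdec w (fun i j => c j i) b hc hb] at h
      obtain rfl : b = 0 := hui b ⟨-(fun i j => c j i), by
        rw [map_neg, neg_eq_iff_add_eq_zero, h]⟩
      simp only [Pi.zero_apply, zero_smul, Finset.sum_const_zero, add_zero] at h
      have h0 := (injective_iff_map_eq_zero _).1 hinj _ h
      funext j
      rcases j with j | j
      · rw [hc]
        simp [fun i => congrFun (congrFun h0 i) j]
      · rw [hb]; simp
    intro n hn w hw
    obtain ⟨m, hm⟩ := Int.eq_ofNat_of_zero_le (sub_nonneg.2 hn)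
    have h := key ((X 0 : R4 k) ^ m • w) (Syz.grMod' _ _ (m : ℤ) n _ _ _ (by
      simpa [mem_RZ_nat] using (isHomogeneous_X k (0 : Fin 4)).pow m) hw (by omega))
    exact (smul_eq_zero.1 h).resolve_left (pow_ne_zero _ (X_ne_zero _))

end SecondSyzygies

section Assembly
variable {k : Type} [Field k]
variable {f : R4 k} {a : ℕ} {ι : Type*} [Fintype ι] {v : ι → Fin 4 → k}
  {g : Fin (2 * a) ⊕ Fin 1 → R4 k} {s : Fin (3 * a - 3) ⊕ Fin 3 → Fin (2 * a) ⊕ Fin 1 → R4 k}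

lemma QProp.finrank_syz₂ (hQ : QProp f a v) (ha : 3 ≤ a) (hgm : ∀ j, g j ∈ IZ v (deg1 a j))
    (hgo : ∀ n, Onto (deg1 a) g (IZ v) n)
    (hsm : ∀ j, s j ∈ Syz (k := k) (deg1 a) g (deg2 a j))
    (hso : ∀ n, Onto (k := k) (deg2 a) s (Syz (k := k) (deg1 a) g) n) {n : ℤ} (hn : a + 3 ≤ n) :
    6 * (Module.finrank k (Syz (k := k) (deg2 a) s n) : ℤ) =
      a * ((n - a - 2) * (n - a - 1) * (n - a)) := by
  have h1 := finrank_Syz (deg2 a) s (Syz.grMod' _ _) hsm (hso n)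
  have h2 := hQ.finrank_syz ha hgm (hgo n) (by omega)
  have h3 := finrank_RZ (k := k) (n := n - (a + 1)) (by omega)
  have h4 := finrank_RZ (k := k) (n := n - (a + 2)) (by omega)
  rw [Fintype.sum_sum_type] at h1
  change _ = ∑ _ : Fin (3 * a - 3), Module.finrank k (RZ k (n - (a + 1))) +
    ∑ _ : Fin 3, Module.finrank k (RZ k (n - (a + 2))) at h1
  simp only [Finset.sum_const, Finset.card_univ, Fintype.card_fin, smul_eq_mul] at h1
  zify [show 3 ≤ 3 * a by omega] at h1
  linear_combination 6 * h1 - h2 + (3 * (a : ℤ) - 3) * h3 + 3 * h4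

theorem QProp.exists_syz₂ (hQ : QProp f a v) (ha : 3 ≤ a)
    (hgm : ∀ j, g j ∈ IZ v (deg1 a j)) (hgo : ∀ n, Onto (deg1 a) g (IZ v) n)
    (hsm : ∀ j, s j ∈ Syz (k := k) (deg1 a) g (deg2 a j))
    (hso : ∀ n, Onto (k := k) (deg2 a) s (Syz (k := k) (deg1 a) g) n)
    (hs0 : ∀ n : ℤ, n ≤ a + 2 → ∀ w ∈ Syz (k := k) (deg2 a) s n, w = 0) :
    ∃ t : Fin a → Fin (3 * a - 3) ⊕ Fin 3 → R4 k,
      (∀ j, t j ∈ Syz (k := k) (deg2 a) s (a + 3)) ∧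
      (∀ n, Onto (k := k) (fun _ => (a : ℤ) + 3) t (Syz (k := k) (deg2 a) s) n) ∧
      ∀ n : ℤ, ∀ w ∈ Syz (k := k) (fun _ => (a : ℤ) + 3) t n, w = 0 := by
  obtain ⟨t, ht, hts, -⟩ := exists_basis_mod (ι := Fin a) ⊥
    (Syz (k := k) (deg2 a) s (a + 3)) bot_le (by
      have := hQ.finrank_syz₂ ha hgm hgo hsm hso (n := a + 3) le_rfl
      rw [finrank_bot, Fintype.card_fin]
      zify
      linarith)
  have hto : ∀ n, Onto (k := k) (fun _ => (a : ℤ) + 3) t (Syz (k := k) (deg2 a) s) n := by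
    intro n
    rcases lt_or_ge (n : ℤ) (a + 3) with hn | hn
    · intro y hy
      exact ⟨0, Submodule.zero_mem _, by rw [map_zero, hs0 n (by omega) y hy]⟩
    · refine surj_ge _ _ (m := (a : ℤ) + 3) (fun n hn => ?_) (fun y hy => ?_) n hn
      · refine GEx_Syz (deg2 a) s (Syz.grMod' _ _) hsm KD2_deg KD_mul_12 (hso _) (fun j => ?_) ?_
        · refine GEx_R_zero ?_
          rcases j with j | j <;> simp [deg2] <;> omega
        · exact GEx_Syz (deg1 a) g (IZ.grMod' v) hgm KD3_deg KD_mul_23 (hgo _)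
            (fun j => GEx_R KD2_deg (fun _ h => koszulR1 h) _) (hQ.GEx2 (by omega) (by omega))
      · obtain ⟨c, hc⟩ := hts y hy
        refine ⟨fun j => C (c j), mem_FreeGr.2 fun j => ?_, ?_⟩
        · simpa using C_mem_RZ (c j)
        · rw [gmap_apply]
          simp only [C_smul_eq]
          exact (sub_eq_zero.1 ((Submodule.mem_bot _).1 hc)).symm
  refine ⟨t, ht, hto, fun n w hw => ?_⟩
  rcases lt_or_ge (n : ℤ) (a + 3) with hn | hn
  · rw [mem_Syz, mem_FreeGr] at hw
    exact funext fun j => RZ_neg (by omega) (hw.1 j)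
  · refine submodule_eq_bot_of_finrank inf_le_left
      (?_ : Module.finrank k (Syz (k := k) _ t n) = 0) hw
    have h1 := finrank_Syz (fun _ => (a : ℤ) + 3) t (Syz.grMod' _ _) ht (hto n)
    have h2 := hQ.finrank_syz₂ ha hgm hgo hsm hso hn
    have h3 := finrank_RZ (k := k) (n := n - (a + 3)) (by omega)
    change _ = ∑ _ : Fin a, Module.finrank k (RZ k (n - (a + 3))) at h1
    simp only [Finset.sum_const, Finset.card_univ, Fintype.card_fin, smul_eq_mul] at h1
    zify at h1 ⊢
    linarith [congrArg ((a : ℤ) * ·) h3]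

/-- Exactness in every degree implies exactness. -/
lemma gmap_eq_zero_iff {ι κ M : Type*} [Fintype ι] [Fintype κ] [AddCommGroup M] [Module k M]
    [Module (R4 k) M] [IsScalarTower k (R4 k) M] {d : ι → ℤ} {e : κ → ℤ} {g : κ → M}
    {s : ι → κ → R4 k}
    (hs : ∀ j, s j ∈ Syz (k := k) e g (d j))
    (ho : ∀ n, Onto (k := k) d s (Syz (k := k) e g) n)
    (hfc : ∀ n w, gmap (k := k) g w = 0 → gmap (k := k) g (fc e n w) = 0) (w : κ → R4 k) :
    gmap (k := k) g w = 0 ↔ ∃ u, gmap (k := k) s u = w := by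
  constructor
  · intro h
    exact mem_range_of_fc d e s w fun n =>
      ho n _ ((mem_Syz e g).2 ⟨fc_mem _ _ _, hfc n w h⟩)
  · rintro ⟨u, rfl⟩
    rw [gmap_apply s, map_sum]
    exact Finset.sum_eq_zero fun j _ => by rw [map_smul, ((mem_Syz e g).1 (hs j)).2, smul_zero]

theorem QProp.hasMinFreeRes (hQ : QProp f a v) (ha : 3 ≤ a) (hf : Prime f) (hf3 : f ∈ RZ k 3)
    (J : Ideal (R4 k)) (hJ : ∀ n, ∀ x ∈ IZ v n, x ∈ J) (hJ' : ∀ x ∈ J, ∀ n, cmp n x ∈ IZ v n) :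
    HasMinFreeRes3 k ⊥ J (Fin.append (fun _ : Fin (2*a) => a) (fun _ : Fin (1) => 3))
      (Fin.append (fun _ : Fin (3*a-3) => a+1) (fun _ : Fin (3) => a+2))
      (fun _ : Fin (a) => a+3) := by
  obtain ⟨g, hgr, hgm, hgo, hgi⟩ := hQ.exists_gens ha hf hf3
  obtain ⟨s, hsm, hso, hs0⟩ := hQ.exists_syz ha hf hgr hgm hgo hgi
  obtain ⟨t, htm, hto, ht0⟩ := hQ.exists_syz₂ ha hgm hgo hsm hso hs0
  let e1 : Fin (2 * a) ⊕ Fin 1 ≃ Fin (2 * a + 1) := finSumFinEquiv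
  let e2 : Fin (3 * a - 3) ⊕ Fin 3 ≃ Fin (3 * a - 3 + 3) := finSumFinEquiv
  have hd1 : ∀ j, ((Fin.append (fun _ : Fin (2*a) => a) (fun _ : Fin (1) => 3) (e1 j) : ℕ) : ℤ) =
      deg1 a j := by
    rintro (j | j) <;> simp [e1, deg1]
  have hd2 : ∀ j, ((Fin.append (fun _ : Fin (3*a-3) => a+1)
      (fun _ : Fin (3) => a+2) (e2 j) : ℕ) : ℤ)
      = deg2 a j := by
    rintro (j | j) <;> simp [e2, deg2]
  have hlt1 : ∀ i j, deg1 a j < deg2 a i := by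
    rintro (i | i) (j | j) <;> simp [deg1, deg2] <;> omega
  have hlt2 : ∀ j, deg2 a j < a + 3 := by
    rintro (i | i) <;> simp [deg2]
  have hsum1 : ∀ w : Fin (2 * a + 1) → R4 k, ∑ j, w j * g (e1.symm j) =
      gmap g (fun i => w (e1 i)) := fun w => by
    rw [gmap_apply]
    exact Fintype.sum_equiv e1.symm _ _ fun j => by simp
  have hsum2 : ∀ (u : Fin (3 * a - 3 + 3) → R4 k) (i : Fin (2 * a + 1)),
      ∑ j, u j * s (e2.symm j) (e1.symm i) =
      gmap (k := k) s (fun i => u (e2 i)) (e1.symm i) := fun u i => by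
    rw [gmap_apply, Finset.sum_apply]
    exact Fintype.sum_equiv e2.symm _ _ fun j => by simp
  have hsum3 : ∀ (u : Fin a → R4 k) (i : Fin (3 * a - 3 + 3)),
      ∑ j, u j * t j (e2.symm i) = gmap (k := k) t u (e2.symm i) := fun u i => by
    rw [gmap_apply, Finset.sum_apply]
    rfl
  have hex1 := gmap_eq_zero_iff hsm hso fun n w h => by
    rw [fc_gmap_ideal _ _ (fun j => (mem_IZ.1 (hgm j)).1), h, map_zero]
  have hex2 := gmap_eq_zero_iff htm hto fun n w h => by
    rw [fc_gmap_free _ (deg1 a) _ (fun j => ((mem_Syz _ _).1 (hsm j)).1), h]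
    funext j
    simp [fc]
  refine ⟨fun j => g (e1.symm j), fun i j => s (e2.symm i) (e1.symm j),
    fun i j => t i (e2.symm j), fun j => ⟨hJ _ _ (hgm _), ?_⟩, fun x hx => ?_, fun i j => ?_,
    fun i j => ?_, fun w => ?_, fun u => ?_, fun u hu => ?_⟩
  · obtain ⟨j, rfl⟩ := e1.surjective j
    beta_reduce
    rw [e1.symm_apply_apply, ← mem_RZ_nat, hd1]
    exact (mem_IZ.1 (hgm j)).1
  · obtain ⟨m, hm⟩ := exists_forall_eq_sum_cmp x
    choose w _ hw using fun n => hgo n _ (hJ' x hx n)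
    refine ⟨fun j => (∑ n ∈ m, w n) (e1.symm j), ?_⟩
    rw [Submodule.mem_bot, hsum1]
    simp only [Equiv.symm_apply_apply]
    change x - gmap g (∑ n ∈ m, w n) = 0
    rw [map_sum]
    simp only [hw]
    rw [← hm m le_rfl, sub_self]
  · obtain ⟨i, rfl⟩ := e2.surjective i
    obtain ⟨j, rfl⟩ := e1.surjective j
    simp only [Equiv.symm_apply_apply]
    refine entryOk_of_mem ?_ ?_
    · rw [hd1, hd2]
      exact mem_FreeGr.1 ((mem_Syz _ _).1 (hsm i)).1 j
    · zify
      rw [hd1, hd2]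
      exact hlt1 i j
  · obtain ⟨j, rfl⟩ := e2.surjective j
    simp only [Equiv.symm_apply_apply]
    refine entryOk_of_mem ?_ ?_
    · rw [hd2]
      push_cast
      exact mem_FreeGr.1 ((mem_Syz _ _).1 (htm i)).1 j
    · zify
      rw [hd2]
      exact hlt2 j
  · rw [Submodule.mem_bot, hsum1, hex1]
    constructor
    · rintro ⟨u, hu⟩
      refine ⟨fun i => u (e2.symm i), fun j => ?_⟩
      rw [hsum2]
      simp only [Equiv.symm_apply_apply]
      rw [hu]
      simp
    · rintro ⟨u, hu⟩
      refine ⟨fun i => u (e2 i), funext fun j => ?_⟩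
      rw [hu, hsum2, Equiv.symm_apply_apply]
  · simp only [hsum2, hsum3]
    have h : (∀ j, gmap (k := k) s (fun i => u (e2 i)) (e1.symm j) = 0) ↔
        gmap (k := k) s (fun i => u (e2 i)) = 0 :=
      ⟨fun h => funext fun j => by simpa using h (e1 j), fun h j => by rw [h]; rfl⟩
    rw [h, hex2]
    refine exists_congr fun w => ⟨fun h i => ?_, fun h => funext fun i => ?_⟩
    · rw [h]; simp
    · rw [h, Equiv.symm_apply_apply]
  · have h0 : gmap (k := k) t u = 0 := funext fun j => by
      have := hu (e2 j)
      rwa [hsum3, e2.symm_apply_apply] at this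
    obtain ⟨m, hm⟩ := exists_eq_sum_fc (fun _ => (a : ℤ) + 3) u
    rw [hm]
    refine Finset.sum_eq_zero fun n _ => ht0 n _ ((mem_Syz _ _).2 ⟨fc_mem _ _ _, ?_⟩)
    rw [fc_gmap_free _ (deg2 a) _ (fun j => ((mem_Syz _ _).1 (htm j)).1), h0]
    funext j
    simp [fc]

end Assembly

section Openness
variable {k : Type} [Field k]

/-- A family of linear maps depending polynomially on parameters. -/
def PolyFam {τ m V : Type*} [AddCommGroup V] [Module k V]
    (Φ : (τ → k) → V →ₗ[k] (m → k)) : Prop :=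
  ∀ b j, ∃ q : MvPolynomial τ k, ∀ x, Φ x b j = eval x q

section
variable {τ m V : Type*} [AddCommGroup V] [Module k V] [Fintype m]
  {Φ : (τ → k) → V →ₗ[k] (m → k)}

lemma PolyFam.surjective_open (hΦ : PolyFam Φ) {x₀ : τ → k} (h : Function.Surjective (Φ x₀)) :
    ∃ G : MvPolynomial τ k, eval x₀ G ≠ 0 ∧ ∀ x, eval x G ≠ 0 → Function.Surjective (Φ x) := by
  classical
  choose b hb using fun j => h (Pi.single j 1)
  choose q hq using hΦ
  let M : Matrix m m (MvPolynomial τ k) := Matrix.of fun i j => q (b j) i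
  have hM : ∀ x, eval x M.det = (Matrix.of fun i j => Φ x (b j) i).det := fun x => by
    rw [RingHom.map_det]
    congr 1
    ext i j
    simp [M, hq]
  refine ⟨M.det, ?_, fun x hx y => ?_⟩
  · rw [hM]
    have : (Matrix.of fun i j => Φ x₀ (b j) i) = 1 := by
      ext i j
      simp [hb, Matrix.one_apply, Pi.single_apply]
    rw [this, Matrix.det_one]
    exact one_ne_zero
  · rw [hM] at hx
    set A := Matrix.of fun i j => Φ x (b j) i with hA
    refine ⟨∑ j, (A⁻¹.mulVec y) j • b j, ?_⟩
    have e : A.mulVec (A⁻¹.mulVec y) = y := by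
      rw [Matrix.mulVec_mulVec, Matrix.mul_nonsing_inv _ (isUnit_iff_ne_zero.2 hx),
        Matrix.one_mulVec]
    conv_rhs => rw [← e]
    funext i
    simp [hA, Matrix.mulVec, dotProduct, mul_comm]

lemma PolyFam.injective_open [Module.Finite k V] (hΦ : PolyFam Φ) {x₀ : τ → k}
    (h : Function.Injective (Φ x₀)) :
    ∃ G : MvPolynomial τ k, eval x₀ G ≠ 0 ∧ ∀ x, eval x G ≠ 0 → Function.Injective (Φ x) := by
  classical
  choose q hq using hΦ
  obtain ⟨L, hL⟩ := (Φ x₀).exists_leftInverse_of_injective (LinearMap.ker_eq_bot.2 h)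
  let b := Module.finBasis k V
  let M : Matrix (Fin (Module.finrank k V)) (Fin (Module.finrank k V)) (MvPolynomial τ k) :=
    Matrix.of fun i l => ∑ j, C (b.repr (L (Pi.single j 1)) i) * q (b l) j
  have hM : ∀ x, eval x M.det = (LinearMap.toMatrix b b (L ∘ₗ Φ x)).det := fun x => by
    rw [RingHom.map_det]
    congr 1
    ext i l
    have e : Φ x (b l) = ∑ j, Φ x (b l) j • Pi.single j (1 : k) :=
      pi_eq_sum_univ' (Φ x (b l))
    rw [LinearMap.toMatrix_apply, LinearMap.comp_apply, e, map_sum, map_sum]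
    simp [M, hq, mul_comm]
  refine ⟨M.det, ?_, fun x hx => ?_⟩
  · rw [hM, hL, LinearMap.toMatrix_id, Matrix.det_one]
    exact one_ne_zero
  · rw [hM, LinearMap.det_toMatrix] at hx
    have := (LinearMap.isUnit_iff_ker_eq_bot _).1
      ((LinearMap.isUnit_iff_isUnit_det _).2 (isUnit_iff_ne_zero.2 hx))
    exact Function.Injective.of_comp (f := L) (LinearMap.ker_eq_bot.1 this)

lemma PolyFam.ker_open [Module.Finite k V] (hΦ : PolyFam Φ) {x₀ : τ → k} (N : Submodule k V)
    (h : ∀ e, Φ x₀ e = 0 → e ∈ N) :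
    ∃ G : MvPolynomial τ k, eval x₀ G ≠ 0 ∧ ∀ x, (∀ e ∈ N, Φ x e = 0) → eval x G ≠ 0 →
      ∀ e, Φ x e = 0 → e ∈ N := by
  obtain ⟨W, hW⟩ := N.exists_isCompl
  obtain ⟨G, h0, hG⟩ := PolyFam.injective_open (Φ := fun x => (Φ x).domRestrict W)
    (fun b j => hΦ b j) (x₀ := x₀) (by
      rw [injective_iff_map_eq_zero]
      exact fun w hw => Subtype.ext (Submodule.disjoint_def.1 hW.disjoint _ (h _ hw) w.2))
  refine ⟨G, h0, fun x hx hxG e he => ?_⟩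
  obtain ⟨n, hn, w, hw, rfl⟩ := Submodule.mem_sup.1 (hW.sup_eq_top ▸ Submodule.mem_top : e ∈ N ⊔ W)
  have h1 := (injective_iff_map_eq_zero _).1 (hG x hxG) ⟨w, hw⟩ (by
    rw [map_add, hx n hn, zero_add] at he
    exact he)
  obtain rfl : w = 0 := congrArg Subtype.val h1
  simpa using hn

end

/-- Evaluation at a point of a family, as a polynomial in the coordinates of the family. -/
noncomputable def evP {ι : Type*} (i : ι) (F : R4 k) : MvPolynomial (ι × Fin 4) k :=
  rename (fun l => (i, l)) F

lemma eval_evP {ι : Type*} (i : ι) (F : R4 k) (x : ι × Fin 4 → k) :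
    eval x (evP i F) = eval (fun l => x (i, l)) F := by
  rw [evP, eval_rename]
  rfl

variable {f : R4 k} {a : ℤ} {ι : Type*} [Fintype ι] {v : ι → Fin 4 → k}

lemma QProp.interp_open (hQ : QProp f a v) :
    ∃ G : MvPolynomial (ι × Fin 4) k, eval (fun q => v q.1 q.2) G ≠ 0 ∧
      ∀ w : ι → Fin 4 → k, eval (fun q => w q.1 q.2) G ≠ 0 →
        ∀ c : ι → k, ∃ F ∈ RZ k a, ∀ i, eval (w i) F = c i := by
  obtain ⟨G, h0, hG⟩ := PolyFam.surjective_open (τ := ι × Fin 4)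
    (Φ := fun x => (evL fun i l => x (i, l)).domRestrict (RZ k a))
    (fun b j => ⟨evP j b.1, fun x => by simp [evL_apply, eval_evP]⟩)
    (x₀ := fun q => v q.1 q.2) (fun c => by
      obtain ⟨F, hF, h⟩ := hQ.interp c
      exact ⟨⟨F, hF⟩, funext fun i => by simpa [evL_apply] using h i⟩)
  refine ⟨G, h0, fun w hw c => ?_⟩
  obtain ⟨F, hF⟩ := hG _ hw c
  exact ⟨F.1, F.2, fun i => by simpa [evL_apply] using congrFun hF i⟩

lemma QProp.dvd_open (hQ : QProp f a v) :
    ∃ G : MvPolynomial (ι × Fin 4) k, eval (fun q => v q.1 q.2) G ≠ 0 ∧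
      ∀ w : ι → Fin 4 → k, (∀ i, eval (w i) f = 0) → eval (fun q => w q.1 q.2) G ≠ 0 →
        ∀ F ∈ RZ k (a - 1), (∀ i, eval (w i) F = 0) → f ∣ F := by
  obtain ⟨G, h0, hG⟩ := PolyFam.ker_open (τ := ι × Fin 4)
    (Φ := fun x => (evL fun i l => x (i, l)).domRestrict (RZ k (a - 1)))
    (fun b j => ⟨evP j b.1, fun x => by simp [evL_apply, eval_evP]⟩)
    (x₀ := fun q => v q.1 q.2)
    (((Ideal.span {f}).restrictScalars k).comap (RZ k (a - 1)).subtype) (fun e he => by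
      have := hQ.dvd_of_vanish e.1 e.2 fun i => by simpa [evL_apply] using congrFun he i
      simpa [Ideal.mem_span_singleton] using this)
  refine ⟨G, h0, fun w hwf hw F hF h => ?_⟩
  have := hG _ (fun e he => ?_) hw ⟨F, hF⟩ (funext fun i => by simp [evL_apply, h])
  · simpa [Ideal.mem_span_singleton] using this
  · obtain ⟨q, hq⟩ : f ∣ e.1 := by simpa [Ideal.mem_span_singleton] using he
    funext i
    simp [evL_apply, hq, hwf]

/-- The failure of a vector of forms to be proportional to the position vector. -/
noncomputable def eulerMap (n : ℤ) (w : ι → Fin 4 → k) :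
    (Fin 4 → RZ k n) →ₗ[k] (ι × Fin 4 × Fin 4 → k) where
  toFun T q := eval (w q.1) (T q.2.1).1 * w q.1 q.2.2 - eval (w q.1) (T q.2.2).1 * w q.1 q.2.1
  map_add' T T' := by
    funext q
    simp
    ring
  map_smul' c T := by
    funext q
    simp
    ring

lemma eulerMap_apply {ι : Type*} (n : ℤ) (w : ι → Fin 4 → k) (T : Fin 4 → RZ k n)
    (q : ι × Fin 4 × Fin 4) :
    eulerMap n w T q = eval (w q.1) (T q.2.1).1 * w q.1 q.2.2 -
      eval (w q.1) (T q.2.2).1 * w q.1 q.2.1 := rfl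

lemma QProp.euler_open (hQ : QProp f a v) :
    ∃ G : MvPolynomial (ι × Fin 4) k, eval (fun q => v q.1 q.2) G ≠ 0 ∧
      ∀ w : ι → Fin 4 → k, (∀ i, eval (w i) f = 0) → eval (fun q => w q.1 q.2) G ≠ 0 →
        ∀ T : Fin 4 → R4 k, (∀ j, T j ∈ RZ k (a - 1)) →
    (∀ i j l, eval (w i) (T j) * w i l = eval (w i) (T l) * w i j) →
    ∃ U, ∀ j, f ∣ T j - X j * U := by
  let N : Submodule k (Fin 4 → RZ k (a - 1)) :=
    { carrier := {T | ∃ U, ∀ j, f ∣ (T j).1 - X j * U}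
      zero_mem' := ⟨0, fun j => by simp⟩
      add_mem' := by
        rintro T T' ⟨U, h⟩ ⟨U', h'⟩
        refine ⟨U + U', fun j => ?_⟩
        have := dvd_add (h j) (h' j)
        rwa [show (T j).1 - X j * U + ((T' j).1 - X j * U') = ((T + T') j).1 - X j * (U + U') by
          simp; ring] at this
      smul_mem' := by
        rintro c T ⟨U, h⟩
        refine ⟨C c * U, fun j => ?_⟩
        have := (h j).mul_left (C c)
        rwa [show C c * ((T j).1 - X j * U) = ((c • T) j).1 - X j * (C c * U) by
          simp [smul_eq_C_mul]; ring] at this }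
  obtain ⟨G, h0, hG⟩ := PolyFam.ker_open (τ := ι × Fin 4)
    (Φ := fun x => eulerMap (a - 1) fun i l => x (i, l))
    (fun T q => ⟨evP q.1 (T q.2.1).1 * X (q.1, q.2.2) - evP q.1 (T q.2.2).1 * X (q.1, q.2.1),
      fun x => by simp [eulerMap_apply, eval_evP]⟩)
    (x₀ := fun q => v q.1 q.2) N (fun T hT =>
      hQ.euler (fun j => (T j).1) (fun j => (T j).2) fun i j l =>
        sub_eq_zero.1 (congrFun hT (i, j, l)))
  refine ⟨G, h0, fun w hwf hw T hT h => ?_⟩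
  refine hG _ (fun T hT => ?_) hw (fun j => ⟨T j, hT j⟩) (funext fun q => ?_)
  · obtain ⟨U, hU⟩ := hT
    have hv : ∀ i j, eval (w i) (T j).1 = w i j * eval (w i) U := fun i j => by
      obtain ⟨q, hq⟩ := hU j
      have := congrArg (eval (w i)) hq
      simp only [map_sub, map_mul, eval_X, hwf, zero_mul] at this
      exact sub_eq_zero.1 this
    funext q
    rw [eulerMap_apply]
    simp only [hv, Pi.zero_apply]
    ring
  · rw [eulerMap_apply]
    exact sub_eq_zero.2 (h q.1 q.2.1 q.2.2)

/-- The linear relations between forms of degree `n` modulo `f`. -/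
noncomputable def relMod (f : R4 k) (n : ℤ) : Submodule k (Fin 4 → R4 k) where
  carrier := {G | (∀ j, G j ∈ RZ k n) ∧ f ∣ ∑ j, X j * G j}
  zero_mem' := ⟨fun _ => Submodule.zero_mem _, by simp⟩
  add_mem' := fun {G G'} h h' => ⟨fun j => Submodule.add_mem _ (h.1 j) (h'.1 j), by
    have := dvd_add h.2 h'.2
    rwa [← Finset.sum_add_distrib,
      Finset.sum_congr rfl fun j _ => (mul_add (X j) _ _).symm] at this⟩
  smul_mem' := fun c G h => ⟨fun j => Submodule.smul_mem _ _ (h.1 j), by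
    have := h.2.mul_left (C c)
    rw [Finset.mul_sum] at this
    convert this using 2 with j
    rw [Pi.smul_apply, smul_eq_C_mul]
    ring⟩

/-- Values of relations at points, together with multiples of auxiliary vectors. -/
noncomputable def relMap (f : R4 k) (n : ℤ) (l w : ι → Fin 4 → k) :
    (relMod f n × (ι → k)) →ₗ[k] (ι × Fin 4 → k) where
  toFun p q := eval (w q.1) (p.1.1 q.2) + p.2 q.1 * l q.1 q.2
  map_add' p p' := by
    funext q
    simp
    ring
  map_smul' c p := by
    funext q
    simp
    ring

lemma relMap_apply {ι : Type*} (f : R4 k) (n : ℤ) (l w : ι → Fin 4 → k) (p : relMod f n × (ι → k))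
    (q : ι × Fin 4) :
    relMap f n l w p q = eval (w q.1) (p.1.1 q.2) + p.2 q.1 * l q.1 q.2 := rfl

lemma QProp.gen_open (hQ : QProp f a v) (ha : 2 ≤ a) :
    ∃ G : MvPolynomial (ι × Fin 4) k, eval (fun q => v q.1 q.2) G ≠ 0 ∧
      ∀ w : ι → Fin 4 → k, (∀ i, eval (w i) f = 0) → eval (fun q => w q.1 q.2) G ≠ 0 →
        ∀ F ∈ RZ k (a + 1), (∀ i, eval (w i) F = 0) →
    ∃ G : Fin 4 → R4 k, (∀ j, G j ∈ RZ k a ∧ ∀ i, eval (w i) (G j) = 0) ∧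
      f ∣ F - ∑ j, X j * G j := by
  choose l hl using fun i => exists_dual (hQ.ne_zero (by omega) i)
  obtain ⟨G, h0, hG⟩ := PolyFam.surjective_open (τ := ι × Fin 4)
    (Φ := fun x => relMap f a l fun i l => x (i, l))
    (fun p q => ⟨evP q.1 (p.1.1 q.2) + C (p.2 q.1 * l q.1 q.2), fun x => by
      simp [relMap_apply, eval_evP]⟩)
    (x₀ := fun q => v q.1 q.2) (fun b => by
      set d : ι → k := fun i => ∑ j, b (i, j) * v i j with hd
      choose H hH hHv using fun j => hQ.interp fun i => b (i, j) - d i * l i j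
      obtain ⟨G, hG, hGf⟩ := hQ.gen ha (∑ j, X j * H j)
        (Submodule.sum_mem _ fun j _ => X_mul_mem (hH j) j rfl) (fun i => by
          simp only [Fin.sum_univ_four, map_add, map_mul, eval_X, hHv, hd]
          linear_combination (-(b (i, 0) * v i 0) - b (i, 1) * v i 1 - b (i, 2) * v i 2
            - b (i, 3) * v i 3) * hl i)
      refine ⟨(⟨fun j => H j - G j, fun j => Submodule.sub_mem _ (hH j) (hG j).1, ?_⟩, d),
        funext fun q => ?_⟩
      · simpa only [mul_sub, Finset.sum_sub_distrib] using hGf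
      · rw [relMap_apply]
        change eval (v q.1) (H q.2 - G q.2) + d q.1 * l q.1 q.2 = b q
        rw [map_sub, hHv, (hG q.2).2]
        ring)
  refine ⟨G * ∏ i, ∑ j, C (l i j) * X (i, j), ?_, fun w hwf hw F hF hFw => ?_⟩
  · rw [map_mul, map_prod]
    refine mul_ne_zero h0 (Finset.prod_ne_zero_iff.2 fun i _ => ?_)
    simp [Fin.sum_univ_four, hl]
  rw [map_mul, map_prod] at hw
  have hlw : ∀ i, ∑ j, l i j * w i j ≠ 0 := fun i => by
    simpa using Finset.prod_ne_zero_iff.1 (right_ne_zero_of_mul hw) i (Finset.mem_univ _)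
  obtain ⟨H, hH, hFH⟩ := exists_eq_sum_X (by omega) hF
  rw [add_sub_cancel_right] at hH
  obtain ⟨⟨⟨R, hR, hRf⟩, d⟩, hp⟩ := hG _ (left_ne_zero_of_mul hw)
    fun q => eval (w q.1) (H q.2)
  have hval : ∀ i j, eval (w i) (R j) + d i * l i j = eval (w i) (H j) :=
    fun i j => congrFun hp (i, j)
  have hRw : ∀ i, ∑ j, w i j * eval (w i) (R j) = 0 := fun i => by
    obtain ⟨q, hq⟩ := hRf
    simpa [hwf] using congrArg (eval (w i)) hq
  have hd : ∀ i, d i = 0 := fun i => by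
    have h1 := hFw i
    rw [hFH, map_sum] at h1
    simp only [map_mul, eval_X, ← hval, mul_add, Finset.sum_add_distrib, hRw, zero_add] at h1
    have h2 : d i * ∑ j, l i j * w i j = 0 := by
      rw [← h1, Finset.mul_sum]
      exact Finset.sum_congr rfl fun j _ => by ring
    exact (mul_eq_zero.1 h2).resolve_right (hlw i)
  refine ⟨fun j => H j - R j, fun j => ⟨Submodule.sub_mem _ (hH j) (hR j), fun i => ?_⟩, ?_⟩
  · rw [map_sub, ← hval, hd]
    ring
  · rw [hFH]
    simp only [mul_sub, Finset.sum_sub_distrib, sub_sub_cancel]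
    exact hRf

theorem QProp.open (hQ : QProp f a v) (ha : 2 ≤ a) :
    ∃ G : MvPolynomial (ι × Fin 4) k, eval (fun q => v q.1 q.2) G ≠ 0 ∧
      ∀ w : ι → Fin 4 → k, (∀ i, eval (w i) f = 0) → eval (fun q => w q.1 q.2) G ≠ 0 →
        QProp f a w := by
  obtain ⟨G1, h1, H1⟩ := hQ.interp_open
  obtain ⟨G2, h2, H2⟩ := hQ.dvd_open
  obtain ⟨G3, h3, H3⟩ := hQ.euler_open
  obtain ⟨G4, h4, H4⟩ := hQ.gen_open ha
  refine ⟨G1 * G2 * G3 * G4, ?_, fun w hwf hw => ?_⟩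
  · simp only [map_mul]
    exact mul_ne_zero (mul_ne_zero (mul_ne_zero h1 h2) h3) h4
  · simp only [map_mul, mul_ne_zero_iff] at hw
    obtain ⟨⟨⟨w1, w2⟩, w3⟩, w4⟩ := hw
    exact ⟨hQ.card, hwf, H1 w w1, H2 w hwf w2, H3 w hwf w3, fun _ => H4 w hwf w4⟩

end Openness

section Configurations
variable {k : Type} [Field k]

lemma restrict_line_of_mem {n : ℕ} {p : R4 k} (hp : p ∈ RZ k n) (v : Fin 4 → k) :
    aeval (fun l => Polynomial.C (v l) * Polynomial.X) p =
      Polynomial.C (eval v p) * Polynomial.X ^ n := by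
  rw [aeval_def, eval₂_eq, eval_eq, map_sum, Finset.sum_mul]
  refine Finset.sum_congr rfl fun d hd => ?_
  have h : d.degree = n := by exact_mod_cast mem_RZ.1 hp d (mem_support_iff.1 hd)
  simp only [mul_pow, Finset.prod_mul_distrib, Finset.prod_pow_eq_pow_sum]
  rw [← h, Finsupp.degree_apply]
  simp only [map_mul, map_prod, map_pow, Polynomial.algebraMap_eq]
  rw [mul_assoc]

lemma coeff_restrict_line (n : ℕ) (p : R4 k) (v : Fin 4 → k) :
    (aeval (fun l => Polynomial.C (v l) * Polynomial.X) p : Polynomial k).coeff n =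
      eval v (cmp n p) := by
  obtain ⟨s, hs⟩ := exists_forall_eq_sum_cmp p
  have key : ∀ m : ℤ, (aeval (fun l => Polynomial.C (v l) * Polynomial.X) (cmp m p) :
      Polynomial k).coeff n = if m = n then eval v (cmp n p) else 0 := fun m => by
    rcases lt_or_ge m 0 with h | h
    · rw [RZ_neg h (cmp_mem m p), if_neg (by omega)]
      simp
    · lift m to ℕ using h
      rw [restrict_line_of_mem (cmp_mem _ _), Polynomial.coeff_C_mul, Polynomial.coeff_X_pow]
      by_cases h : m = n
      · subst h; simp
      · simp [h, Ne.symm h]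
  conv_lhs => rw [hs (insert (n : ℤ) s) (Finset.subset_insert _ _)]
  rw [map_sum, Polynomial.finsetSum_coeff]
  simp only [key, Finset.sum_ite_eq', Finset.mem_insert_self, if_true]

/-- The components of a polynomial vanishing on a line through the origin vanish there. -/
lemma eval_cmp_eq_zero [Infinite k] {p : R4 k} {v : Fin 4 → k}
    (h : ∀ c : k, c ≠ 0 → eval (c • v) p = 0) (n : ℤ) : eval v (cmp n p) = 0 := by
  rcases lt_or_ge n 0 with hn | hn
  · rw [RZ_neg hn (cmp_mem n p), map_zero]
  · lift n to ℕ using hn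
    rw [← coeff_restrict_line]
    rw [Polynomial.eq_zero_of_infinite_isRoot (aeval (fun l => Polynomial.C (v l) * Polynomial.X) p)
      ((Set.Finite.infinite_compl (Set.finite_singleton (0 : k))).mono fun c hc => ?_),
      Polynomial.coeff_zero]
    change Polynomial.eval c _ = 0
    have e : (Polynomial.aeval c).comp (aeval fun l => Polynomial.C (v l) * Polynomial.X) =
        aeval (R := k) (c • v) := by
      refine algHom_ext fun l => ?_
      rw [AlgHom.comp_apply, aeval_X, aeval_X, map_mul, Polynomial.aeval_C, Polynomial.aeval_X,
        Pi.smul_apply, smul_eq_mul, mul_comm]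
      rfl
    rw [← h c hc, ← Polynomial.coe_aeval_eq_eval, ← coe_aeval_eq_eval, RingHom.coe_coe, ← e]
    rfl

lemma eval_rep_eq_zero {n : ℤ} {p : R4 k} (hp : p ∈ RZ k n) {v w : Fin 4 → k} {hv : v ≠ 0}
    {hw : w ≠ 0} (h : Projectivization.mk k w hw = Projectivization.mk k v hv)
    (h0 : eval v p = 0) : eval w p = 0 := by
  obtain ⟨c, rfl⟩ := (Projectivization.mk_eq_mk_iff' k _ _ hw hv).1 h
  rcases lt_or_ge n 0 with hn | hn
  · rw [RZ_neg hn hp, map_zero]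
  · lift n to ℕ using hn
    rw [eval_smul_RZ hp, h0, mul_zero]

variable {f : R4 k} {a : ℤ} {ι : Type*} [Fintype ι] {v : ι → Fin 4 → k}

lemma QProp.reindex (hQ : QProp f a v) {κ : Type*} [Fintype κ] (e : κ ≃ ι) :
    QProp f a (v ∘ e) := by
  have hv : ∀ P : (Fin 4 → k) → Prop, (∀ i, P ((v ∘ e) i)) ↔ ∀ i, P (v i) := fun P =>
    e.forall_congr fun i => Iff.rfl
  refine ⟨by rw [Fintype.card_congr e]; exact hQ.card, fun i => hQ.onX _, fun c => ?_,
    fun F hF h => hQ.dvd_of_vanish F hF ((hv fun p => eval p F = 0).1 h), fun T hT h => ?_,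
    fun ha F hF h => ?_⟩
  · obtain ⟨F, hF, h⟩ := hQ.interp (c ∘ e.symm)
    exact ⟨F, hF, fun i => by simp [h]⟩
  · exact hQ.euler T hT
      ((hv fun p => ∀ j l, eval p (T j) * p l = eval p (T l) * p j).1 h)
  · obtain ⟨G, hG, hGf⟩ := hQ.gen ha F hF ((hv fun p => eval p F = 0).1 h)
    exact ⟨G, fun j => ⟨(hG j).1, fun i => (hG j).2 _⟩, hGf⟩

lemma QProp.mk_injective (hQ : QProp f a v) (ha : 0 < a) :
    Function.Injective fun i => Projectivization.mk k (v i) (hQ.ne_zero ha i) := by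
  classical
  intro i j hij
  by_contra hne
  obtain ⟨F, hF, h⟩ := hQ.interp (Pi.single i 1)
  have := eval_rep_eq_zero hF hij (by rw [h, Pi.single_eq_of_ne (Ne.symm hne)])
  rw [h, Pi.single_eq_same] at this
  exact one_ne_zero this

theorem generalPointsSatisfy_of_qProp [Infinite k] (S : SmoothCubicSurface k) (a : ℕ)
    (ha : 3 ≤ a) (hQ : QProp S.f a v) :
    GeneralPointsSatisfy k S (3 * (a * (a - 1) / 2) + a + 1) (fun Z =>
      HasMinFreeRes3 k ⊥ (pointsIdeal k (Set.range Z))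
        (Fin.append (fun _ : Fin (2 * a) => a) (fun _ : Fin (1) => 3))
        (Fin.append (fun _ : Fin (3 * a - 3) => a + 1) (fun _ : Fin (3) => a + 2))
        (fun _ : Fin (a) => a + 3)) := by
  have hf : Prime S.f := S.irred.prime
  have hf3 : S.f ∈ RZ k ((3 : ℕ) : ℤ) := mem_RZ_nat.2 S.homog
  have hcard : Fintype.card ι = 3 * (a * (a - 1) / 2) + a + 1 := by
    have h1 := hQ.card
    obtain ⟨c, hc⟩ : 2 ∣ a * (a - 1) := (Nat.even_mul_pred_self a).two_dvd
    have h2 : (a : ℤ) * (a - 1) = 2 * c := by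
      rw [← Nat.cast_one, ← Nat.cast_sub (by omega)]
      exact_mod_cast hc
    rw [hc, Nat.mul_div_cancel_left _ two_pos]
    rw [mul_assoc, h2] at h1
    omega
  have hQ' := hQ.reindex (Fintype.equivFinOfCardEq hcard).symm
  obtain ⟨G, hG0, hG⟩ := hQ'.open (by omega)
  refine ⟨G, ⟨_, ⟨hQ'.mk_injective (by omega), fun i w hw h => ?_⟩, _, fun i => ⟨_, rfl⟩, hG0⟩,
    fun Z hZ hav => ?_⟩
  · exact eval_rep_eq_zero hf3 h (hQ'.onX i)
  · obtain ⟨w, hw, hwG⟩ := hav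
    have hQw := hG w (fun i => by
      obtain ⟨h0, h⟩ := hw i
      exact hZ.2 i _ h0 h) hwG
    refine hQw.hasMinFreeRes ha hf hf3 _ (fun n x hx => ?_) fun x hx n => ?_
    · rintro _ ⟨i, rfl⟩ u hu h
      obtain ⟨h0, h1⟩ := hw i
      exact eval_rep_eq_zero (mem_IZ.1 hx).1 (h.trans h1.symm) ((mem_IZ.1 hx).2 i)
    · refine mem_IZ.2 ⟨cmp_mem n x, fun i => eval_cmp_eq_zero (fun c hc => ?_) n⟩
      obtain ⟨h0, h1⟩ := hw i
      refine hx _ ⟨i, rfl⟩ _ (smul_ne_zero hc h0) (h1 ▸ ?_)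
      exact (Projectivization.mk_eq_mk_iff' k _ _ _ _).2 ⟨c, rfl⟩

end Configurations

section
variable {k : Type} [Field k]

lemma exists_eq_C_mul_pow_add (v : Fin 4 → k) (i : Fin 4) {n : ℤ} {F : R4 k}
    (hF : F ∈ RZ k n) : ∃ (c : k) (G : Fin 4 → R4 k), (∀ j, G j ∈ RZ k (n - 1)) ∧
      F = C c * X i ^ n.toNat + ∑ j, (X j - C (v j) * X i) * G j := by
  rcases lt_or_ge n 0 with hn | hn
  · exact ⟨0, fun _ => 0, fun _ => Submodule.zero_mem _, by simp [RZ_neg hn hF]⟩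
  induction n, hn using Int.leInduction generalizing F with
  | base =>
    obtain ⟨c, rfl⟩ := RZ_zero_deg hF
    exact ⟨c, fun _ => 0, fun _ => Submodule.zero_mem _, by simp⟩
  | succ n hn ih =>
    obtain ⟨q, hq, rfl⟩ := exists_eq_sum_X (by omega) hF
    choose c G hG hc using fun j => ih (F := q j) (by simpa using hq j)
    have hX : (X i : R4 k) ^ n.toNat ∈ RZ k n := by
      have := prod_mem_RZ (k := k) (Finset.range n.toNat) (fun _ => X i) (fun _ => 1)
        fun _ _ => X_mem_RZ i
      simpa [hn] using this
    refine ⟨∑ j, v j * c j, fun j => C (c j) * X i ^ n.toNat + ∑ l, X l * G l j, fun j => ?_, ?_⟩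
    · rw [add_sub_cancel_right]
      exact Submodule.add_mem _ (C_mul_mem hX _)
        (Submodule.sum_mem _ fun l _ => X_mul_mem (hG l j) l (by omega))
    · have e : (n + 1).toNat = n.toNat + 1 := by omega
      rw [e]
      have h1 : ∀ j, X j * q j = (C (v j * c j) * X i ^ (n.toNat + 1) +
          (X j - C (v j) * X i) * (C (c j) * X i ^ n.toNat)) +
          ∑ l, (X l - C (v l) * X i) * (X j * G j l) := fun j => by
        simp only [mul_left_comm _ (X j : R4 k), ← Finset.mul_sum]
        conv_lhs => rw [hc j]
        rw [C_mul]; ring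
      rw [Finset.sum_congr rfl fun j _ => h1 j, Finset.sum_add_distrib, Finset.sum_add_distrib,
        Finset.sum_comm (γ := Fin 4), ← Finset.sum_mul, ← map_sum]
      simp only [mul_add, Finset.sum_add_distrib, Finset.mul_sum]
      ring

/-- A form vanishing at a point lies in the ideal of the point. -/
lemma exists_of_eval_eq_zero {v : Fin 4 → k} {i : Fin 4} (hv : v i = 1) {n : ℤ} {F : R4 k}
    (hF : F ∈ RZ k n) (h : eval v F = 0) : ∃ G : Fin 4 → R4 k, (∀ j, G j ∈ RZ k (n - 1)) ∧
      F = ∑ j, (X j - C (v j) * X i) * G j := by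
  obtain ⟨c, G, hG, rfl⟩ := exists_eq_C_mul_pow_add v i hF
  have hc : c = 0 := by simpa [hv] using h
  exact ⟨G, hG, by simp [hc]⟩

lemma exists_of_eval_e0 {n : ℤ} {F : R4 k} (hF : F ∈ RZ k n)
    (h : eval ![1, 0, 0, 0] F = 0) : ∃ A ∈ RZ k (n - 1), ∃ B ∈ RZ k (n - 1), ∃ D ∈ RZ k (n - 1),
      F = X 1 * A + X 2 * B + X 3 * D := by
  obtain ⟨G, hG, rfl⟩ := exists_of_eval_eq_zero (i := 0) (by rfl) hF h
  exact ⟨G 1, hG 1, G 2, hG 2, G 3, hG 3, by simp [Fin.sum_univ_four]⟩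

/-- The linear forms defining lines in the plane `x₃ = 0` avoiding `(1, 0, 0, 0)`. -/
noncomputable def lin (b : Fin 3 → k) : R4 k :=
  X 0 + C (b 0) * X 1 + C (b 1) * X 2 + C (b 2) * X 3

/-- The points of the line defined by `lin b` in the plane `x₃ = 0`. -/
def pt (b : Fin 3 → k) (r : k) : Fin 4 → k := ![-(b 0 * r) - b 1, r, 1, 0]

lemma eval_lin (b : Fin 3 → k) (v : Fin 4 → k) :
    eval v (lin b) = v 0 + b 0 * v 1 + b 1 * v 2 + b 2 * v 3 := by
  simp [lin]

@[simp] lemma eval_lin_pt (b : Fin 3 → k) (r : k) : eval (pt b r) (lin b) = 0 := by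
  simp [eval_lin, pt]
  ring

@[simp] lemma eval_lin_e0 (b : Fin 3 → k) : eval ![1, 0, 0, 0] (lin b) = 1 := by
  simp [eval_lin]

lemma lin_mem (b : Fin 3 → k) : lin b ∈ RZ k 1 :=
  Submodule.add_mem _ (Submodule.add_mem _ (Submodule.add_mem _ (X_mem_RZ 0)
    (C_mul_mem (X_mem_RZ 1) _)) (C_mul_mem (X_mem_RZ 2) _)) (C_mul_mem (X_mem_RZ 3) _)

lemma exists_of_eval_pt {b : Fin 3 → k} {r : k} {n : ℤ} {F : R4 k} (hF : F ∈ RZ k n)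
    (h : eval (pt b r) F = 0) : ∃ D ∈ RZ k (n - 1), ∃ B A,
      F = X 3 * B + lin b * A + (X 1 - C r * X 2) * D := by
  obtain ⟨G, hG, rfl⟩ := exists_of_eval_eq_zero (i := 2) (by rfl) hF h
  refine ⟨G 1 - C (b 0) * G 0, Submodule.sub_mem _ (hG 1) (C_mul_mem (hG 0) _),
    G 3 - C (b 2) * G 0, G 0, ?_⟩
  simp only [Fin.sum_univ_four, pt, lin]
  simp
  ring

lemma X_sub_C_mem (r : k) : (X 1 - C r * X 2 : R4 k) ∈ RZ k 1 :=
  Submodule.sub_mem _ (X_mem_RZ 1) (C_mul_mem (X_mem_RZ 2) _)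

lemma exists_of_eval_pts {b : Fin 3 → k} {r : Fin 3 → k} (hr : Function.Injective r) {n : ℤ}
    {F : R4 k} (hF : F ∈ RZ k n) (h : ∀ s, eval (pt b (r s)) F = 0) :
    ∃ D ∈ RZ k (n - 3), ∃ B A, F = X 3 * B + lin b * A +
      (X 1 - C (r 0) * X 2) * (X 1 - C (r 1) * X 2) * (X 1 - C (r 2) * X 2) * D := by
  have key : ∀ {s t}, s ≠ t → ∀ {A B D : R4 k}, eval (pt b (r t))
      (X 3 * B + lin b * A + (X 1 - C (r s) * X 2) * D) = 0 → eval (pt b (r t)) D = 0 := by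
    intro s t hst A B D h
    have h3 : eval (pt b (r t)) (X 3 : R4 k) = 0 := by simp [pt]
    rw [map_add, map_add, map_mul, map_mul, eval_lin_pt, h3, map_mul] at h
    have : eval (pt b (r t)) (X 1 - C (r s) * X 2) ≠ 0 := by
      simpa [pt, sub_eq_zero] using fun h => hst (hr h).symm
    simpa only [add_zero, zero_mul, zero_add, mul_eq_zero, this, false_or] using h
  obtain ⟨D, hD, B, A, rfl⟩ := exists_of_eval_pt hF (h 0)
  obtain ⟨D', hD', B', A', rfl⟩ := exists_of_eval_pt hD (key (by decide) (h 1))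
  obtain ⟨D'', hD'', B'', A'', rfl⟩ := exists_of_eval_pt hD'
    (key (s := 1) (by decide) (key (s := 0) (by decide) (h 2)))
  exact ⟨D'', by convert hD'' using 2; ring,
    B + (X 1 - C (r 0) * X 2) * (B' + (X 1 - C (r 1) * X 2) * B''),
    A + (X 1 - C (r 0) * X 2) * (A' + (X 1 - C (r 1) * X 2) * A''), by ring⟩

/-- A plane section line meeting the cubic surface in three distinct points. -/
structure Transversal (f : R4 k) (b : Fin 3 → k) (r : Fin 3 → k) : Prop where
  inj : Function.Injective r
  onX : ∀ s, eval (pt b (r s)) f = 0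
  ne : eval ![-b 0, 1, 0, 0] f ≠ 0

variable {f : R4 k} {b r : Fin 3 → k}

lemma Transversal.exists_eq (ht : Transversal f b r) (hf3 : f ∈ RZ k 3) {n : ℤ}
    {F : R4 k} (hF : F ∈ RZ k n) (h : ∀ s, eval (pt b (r s)) F = 0) :
    ∃ A B D, F = f * A + X 3 * B + lin b * D := by
  obtain ⟨c, hc, B, A, hf⟩ := exists_of_eval_pts ht.inj hf3 ht.onX
  obtain ⟨c, rfl⟩ := RZ_zero_deg hc
  obtain ⟨D, -, B', A', rfl⟩ := exists_of_eval_pts ht.inj hF h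
  have hc0 : c ≠ 0 := by
    rintro rfl
    refine ht.ne ?_
    rw [hf]
    simp [eval_lin]
  have e : (C c : R4 k) * C c⁻¹ = 1 := by rw [← C_mul, mul_inv_cancel₀ hc0, C_1]
  refine ⟨C c⁻¹ * D, B' - C c⁻¹ * D * B, A' - C c⁻¹ * D * A, ?_⟩
  conv_rhs => rw [hf]
  linear_combination (- ((X 1 - C (r 0) * X 2) * (X 1 - C (r 1) * X 2) * (X 1 - C (r 2) * X 2)
    * D)) * e

/-- Homogenization of representations in the ideal `(f, x₃, m)`. -/
lemma homogenize_three (hf3 : f ∈ RZ k 3) {m F A B D : R4 k} {N n : ℤ} (hm : m ∈ RZ k N)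
    (hF : F ∈ RZ k n) (h : F = f * A + X 3 * B + m * D) :
    ∃ A' ∈ RZ k (n - 3), ∃ B' ∈ RZ k (n - 1), ∃ D' ∈ RZ k (n - N),
      F = f * A' + X 3 * B' + m * D' := by
  refine ⟨_, cmp_mem _ A, _, cmp_mem _ B, _, cmp_mem _ D, ?_⟩
  rw [← cmp_mul hf3, ← cmp_mul (X_mem_RZ 3), ← cmp_mul hm, ← map_add, ← map_add, ← h, cmp_same hF]

/-- Reduction modulo `x₃` and `lin b`. -/
noncomputable def redLin (b : Fin 3 → k) : R4 k →ₐ[k] R4 k :=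
  aeval ![-(C (b 0) * X 1) - C (b 1) * X 2, X 1, X 2, 0]

lemma exists_redLin (b : Fin 3 → k) (p : R4 k) :
    ∃ A B, p = redLin b p + X 3 * A + lin b * B := by
  induction p using MvPolynomial.induction_on with
  | C a => exact ⟨0, 0, by simp [redLin]⟩
  | add p q hp hq =>
    obtain ⟨A, B, h⟩ := hp
    obtain ⟨A', B', h'⟩ := hq
    exact ⟨A + A', B + B', by rw [map_add]; linear_combination h + h'⟩
  | mul_X p i hp =>
    obtain ⟨A, B, h⟩ := hp
    have : ∃ A' B', (X i : R4 k) = redLin b (X i) + X 3 * A' + lin b * B' := by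
      fin_cases i
      · exact ⟨-C (b 2), 1, by simp [redLin, lin]; ring⟩
      · exact ⟨0, 0, by simp [redLin]⟩
      · exact ⟨0, 0, by simp [redLin]⟩
      · exact ⟨1, 0, by simp [redLin]⟩
    obtain ⟨A', B', h'⟩ := this
    refine ⟨A * X i + redLin b p * A', B * X i + redLin b p * B', ?_⟩
    rw [map_mul]
    linear_combination X i * h + redLin b p * h'

lemma redLin_lin (b : Fin 3 → k) : redLin b (lin b) = 0 := by
  simp [redLin, lin, ← algebraMap_eq]
  ring

lemma redLin_X3 (b : Fin 3 → k) : redLin b (X 3) = 0 := by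
  simp [redLin]

lemma X3_dvd_of_lin_mul (b : Fin 3 → k) {G : R4 k} (h : X 3 ∣ lin b * G) : X 3 ∣ G := by
  refine ((X_prime (i := (3 : Fin 4)) (R := k)).dvd_or_dvd h).resolve_left ?_
  rintro ⟨q, hq⟩
  have := congrArg (eval ![1, 0, 0, 0]) hq
  simp at this

/-- `lin b` is a nonzerodivisor modulo `f` and `x₃`. -/
lemma exists_of_lin_mul (hne : eval ![-b 0, 1, 0, 0] f ≠ 0) {G A B : R4 k}
    (h : lin b * G = f * A + X 3 * B) : ∃ A' B', G = f * A' + X 3 * B' := by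
  have h0 := congrArg (redLin b) h
  rw [map_mul, redLin_lin, zero_mul, map_add, map_mul, map_mul, redLin_X3, zero_mul, add_zero,
    eq_comm, mul_eq_zero] at h0
  have hfr : redLin b f ≠ 0 := by
    intro h1
    obtain ⟨A, B, h2⟩ := exists_redLin b f
    refine hne ?_
    rw [h2, h1]
    simp [eval_lin]
  obtain ⟨A1, A2, hA⟩ := exists_redLin b A
  rw [h0.resolve_left hfr, zero_add] at hA
  obtain ⟨q, hq⟩ := X3_dvd_of_lin_mul b (G := G - f * A2)
    ⟨f * A1 + B, by rw [mul_sub, h, hA]; ring⟩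
  exact ⟨A2, q, by linear_combination hq⟩

lemma koszul_three_mod {b₀₁ b₀₂ b₁₂ e : R4 k}
    (h : X 0 * b₁₂ - X 1 * b₀₂ + X 2 * b₀₁ = X 3 * e) : ∃ (ρ : Fin 3 → R4 k) (s : Fin 3 → R4 k),
      b₀₁ = ρ 0 * X 1 - ρ 1 * X 0 + X 3 * s 0 ∧ b₀₂ = ρ 0 * X 2 - ρ 2 * X 0 + X 3 * s 1 ∧
      b₁₂ = ρ 1 * X 2 - ρ 2 * X 1 + X 3 * s 2 := by
  obtain ⟨c, hc⟩ := koszul_four (w := ![b₁₂, -b₀₂, b₀₁, -e]) (by simp; linear_combination h)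
  rw [smv_KD2] at hc
  have h0 := congrFun hc 0
  have h1 := congrFun hc 1
  have h2 := congrFun hc 2
  simp at h0 h1 h2
  exact ⟨![-c 3, c 1, -c 0], ![c 5, -c 4, c 2], by simp; linear_combination h2,
    by simp; linear_combination -h1, by simp; linear_combination h0⟩

lemma koszul_cross_mod {N₀ N₁ N₂ e e' : R4 k} (h01 : N₀ * X 1 - N₁ * X 0 = X 3 * e)
    (h02 : N₀ * X 2 - N₂ * X 0 = X 3 * e') : ∃ U t₀ t₁ t₂,
      N₀ = X 0 * U + X 3 * t₀ ∧ N₁ = X 1 * U + X 3 * t₁ ∧ N₂ = X 2 * U + X 3 * t₂ := by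
  obtain ⟨a, b, c, h1, h2, -⟩ := koszul_three (i := 1) (j := 0) (l := 3) (by decide) (by decide)
    (by decide) (u := N₀) (v := -N₁) (w := -e) (by linear_combination h01)
  obtain ⟨q, hq, -⟩ := koszul_two (i := 0) (j := 3) (by decide) (a := a * X 2 - N₂)
    (b := b * X 2 - e') (by linear_combination h02 - X 2 * h1)
  exact ⟨a, b, -c, -q, h1, by linear_combination -h2, by linear_combination -hq⟩

end

section
variable {k : Type} [Field k]

/-- The points added to a set of points in the inductive step: the point `(1, 0, 0, 0)` and three
points on each of `n` lines in the plane `x₃ = 0`. -/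
def addPts {ι : Type*} {n : ℕ} (v : ι → Fin 4 → k) (b r : Fin n → Fin 3 → k) :
    ι ⊕ Option (Fin n × Fin 3) → Fin 4 → k :=
  Sum.elim v fun q => q.elim ![1, 0, 0, 0] fun q => pt (b q.1) (r q.1 q.2)

lemma forall_addPts {ι : Type*} {n : ℕ} {v : ι → Fin 4 → k} {b r : Fin n → Fin 3 → k}
    {P : (Fin 4 → k) → Prop} : (∀ i, P (addPts v b r i)) ↔
      (∀ i, P (v i)) ∧ P ![1, 0, 0, 0] ∧ ∀ l s, P (pt (b l) (r l s)) := by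
  simp [addPts, Sum.forall, Option.forall]

/-- The conditions on the points added in the inductive step. -/
structure StepData (f : R4 k) {ι : Type*} [Fintype ι] {n : ℕ} (v : ι → Fin 4 → k)
    (b r : Fin n → Fin 3 → k) (θ : ι → Fin 4 → k) : Prop where
  mem : f ∈ RZ k 3
  e0 : eval ![1, 0, 0, 0] f = 0
  v3 : ∀ i, v i 3 ≠ 0
  trans : ∀ l, Transversal f (b l) (r l)
  off : ∀ l l' s, l ≠ l' → eval (pt (b l) (r l s)) (lin (b l')) ≠ 0
  dot : ∀ i, ∑ j, θ i j * v i j = 0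
  sum : ∀ F ∈ RZ k ((n : ℤ) - 1), ∀ j, ∑ i, θ i j * eval (v i) F = 0
  phi : ∑ i, θ i 0 * (eval (v i) (∏ l, lin (b l)) / v i 3) ≠ 0

variable {f : R4 k} {ι : Type*} [Fintype ι] {n : ℕ} {v : ι → Fin 4 → k} {b r : Fin n → Fin 3 → k}
  {θ : ι → Fin 4 → k}

lemma prod_lin_mem (b : Fin n → Fin 3 → k) : ∏ l, lin (b l) ∈ RZ k (n : ℤ) := by
  have := prod_mem_RZ Finset.univ (fun l => lin (b l)) (fun _ => 1) fun l _ => lin_mem (b l)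
  simpa using this

lemma eval_prod_e0 (s : Finset (Fin n)) : eval ![1, 0, 0, 0] (∏ l ∈ s, lin (b l)) = 1 := by
  rw [map_prod]
  exact Finset.prod_eq_one fun l _ => eval_lin_e0 _

lemma eval_prod_pt (l : Fin n) (t : k) : eval (pt (b l) t) (∏ l, lin (b l)) = 0 := by
  rw [map_prod]
  exact Finset.prod_eq_zero (Finset.mem_univ l) (eval_lin_pt _ _)

lemma eval_pt_X3 (b : Fin 3 → k) (t : k) : eval (pt b t) (X 3 : R4 k) = 0 := by
  simp [pt]

/-- A form vanishing on the points on the lines lies in `(f, x₃, m)`. -/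
lemma StepData.exists_eq (hS : StepData f v b r θ) {N : ℤ} {F : R4 k} (hF : F ∈ RZ k N)
    (h : ∀ l s, eval (pt (b l) (r l s)) F = 0) : ∃ A ∈ RZ k (N - 3), ∃ B ∈ RZ k (N - 1),
      ∃ D ∈ RZ k (N - n), F = f * A + X 3 * B + (∏ l, lin (b l)) * D := by
  classical
  suffices H : ∀ s : Finset (Fin n), ∃ A B, ∃ D ∈ RZ k (N - s.card),
      F = f * A + X 3 * B + (∏ l ∈ s, lin (b l)) * D by
    obtain ⟨A, B, D, -, e⟩ := H Finset.univ
    exact homogenize_three hS.mem (prod_lin_mem b) hF e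
  intro s
  induction s using Finset.induction_on with
  | empty => exact ⟨0, 0, F, by simpa using hF, by simp⟩
  | insert l s hl ih =>
    obtain ⟨A, B, D, hD, e⟩ := ih
    have hv : ∀ t, eval (pt (b l) (r l t)) D = 0 := fun t => by
      have h1 := h l t
      rw [e, map_add, map_add, map_mul, (hS.trans l).onX, map_mul, eval_pt_X3, map_mul, map_prod,
        zero_mul, zero_mul, zero_add, zero_add, mul_eq_zero, Finset.prod_eq_zero_iff] at h1
      refine h1.resolve_left ?_
      rintro ⟨l', hl', h2⟩
      exact hS.off l l' t (fun h => hl (h ▸ hl')) h2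
    obtain ⟨A', B', D', e'⟩ := (hS.trans l).exists_eq hS.mem hD hv
    obtain ⟨A', -, B', -, D', hD', e'⟩ := homogenize_three hS.mem (lin_mem (b l)) hD e'
    refine ⟨A + (∏ l ∈ s, lin (b l)) * A', B + (∏ l ∈ s, lin (b l)) * B', D', ?_, ?_⟩
    · rw [Finset.card_insert_of_notMem hl]
      convert hD' using 2
      push_cast
      ring
    · rw [Finset.prod_insert hl, e, e']
      ring

lemma StepData.exists_of_prod_mul (hS : StepData f v b r θ) {G A B : R4 k}
    (h : (∏ l, lin (b l)) * G = f * A + X 3 * B) : ∃ A' B', G = f * A' + X 3 * B' := by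
  classical
  suffices H : ∀ s : Finset (Fin n), ∀ G A B, (∏ l ∈ s, lin (b l)) * G = f * A + X 3 * B →
      ∃ A' B', G = f * A' + X 3 * B' from H _ _ _ _ h
  intro s
  induction s using Finset.induction_on with
  | empty => exact fun G A B h => ⟨A, B, by simpa using h⟩
  | insert l s hl ih =>
    intro G A B h
    rw [Finset.prod_insert hl, mul_right_comm, mul_assoc, mul_comm G] at h
    obtain ⟨A', B', h'⟩ := exists_of_lin_mul (hS.trans l).ne h
    exact ih G A' B' h'

lemma StepData.eval_e0_eq_zero (hS : StepData f v b r θ) {F A B D : R4 k}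
    (h : F = f * A + X 3 * B + (∏ l, lin (b l)) * D) (h0 : eval ![1, 0, 0, 0] F = 0) :
    eval ![1, 0, 0, 0] D = 0 := by
  have h3 : eval ![1, 0, 0, 0] (X 3 : R4 k) = 0 := by simp
  rwa [h, map_add, map_add, map_mul, hS.e0, map_mul, h3, map_mul, eval_prod_e0, zero_mul,
    zero_mul, zero_add, zero_add, one_mul] at h0

lemma StepData.interp (hS : StepData f v b r θ) (hQ : QProp f n v)
    (c : ι ⊕ Option (Fin n × Fin 3) → k) :
    ∃ F ∈ RZ k ((n : ℤ) + 1), ∀ i, eval (addPts v b r i) F = c i := by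
  classical
  let E : Fin n × Fin 3 → R4 k := fun q =>
    (∏ l ∈ Finset.univ.erase q.1, lin (b l)) *
      ∏ s ∈ Finset.univ.erase q.2, (X 1 - C (r q.1 s) * X 2)
  have hE : ∀ q, E q ∈ RZ k ((n : ℤ) + 1) := fun q => by
    have h1 := prod_mem_RZ (Finset.univ.erase q.1) (fun l => lin (b l)) (fun _ => 1)
      fun l _ => lin_mem (b l)
    have h2 := prod_mem_RZ (Finset.univ.erase q.2) (fun s => (X 1 - C (r q.1 s) * X 2 : R4 k))
      (fun _ => 1) fun s _ => X_sub_C_mem _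
    have := Fin.pos q.1
    refine mul_mem_RZ h1 h2 ?_
    simp
    omega
  have hE0 : ∀ q, eval ![1, 0, 0, 0] (E q) = 0 := fun q => by
    simp only [E, map_mul, map_prod]
    refine mul_eq_zero_of_right _ (Finset.prod_eq_zero (i := q.2 + 1) ?_ (by simp))
    simp
  have hne : ∀ q q', q ≠ q' → eval (pt (b q'.1) (r q'.1 q'.2)) (E q) = 0 := fun q q' h => by
    simp only [E, map_mul, map_prod]
    by_cases hq : q'.1 = q.1
    · refine mul_eq_zero_of_right _ (Finset.prod_eq_zero (i := q'.2) ?_ (by simp [pt, hq]))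
      simp only [Finset.mem_erase, Finset.mem_univ, and_true]
      exact fun h' => h (Prod.ext hq.symm h'.symm)
    · exact mul_eq_zero_of_left (Finset.prod_eq_zero (i := q'.1) (by simpa using hq)
        (eval_lin_pt _ _)) _
  have heq : ∀ q, eval (pt (b q.1) (r q.1 q.2)) (E q) ≠ 0 := fun q => by
    simp only [E, map_mul, map_prod]
    refine mul_ne_zero (Finset.prod_ne_zero_iff.2 fun l hl => ?_)
      (Finset.prod_ne_zero_iff.2 fun s hs => ?_)
    · exact hS.off _ _ _ (Finset.ne_of_mem_erase hl).symm
    · have := Finset.ne_of_mem_erase hs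
      simpa [pt, sub_eq_zero] using fun h => this ((hS.trans q.1).inj h).symm
  let F₁ : R4 k := C (c (Sum.inr none)) * (X 0 * ∏ l, lin (b l)) +
    ∑ q, C (c (Sum.inr (some q)) / eval (pt (b q.1) (r q.1 q.2)) (E q)) * E q
  obtain ⟨G, hG, hGc⟩ := hQ.interp fun i => (c (Sum.inl i) - eval (v i) F₁) / v i 3
  refine ⟨F₁ + X 3 * G, Submodule.add_mem _ (Submodule.add_mem _
    (C_mul_mem (X_mul_mem (prod_lin_mem b) 0 rfl) _)
    (Submodule.sum_mem _ fun q _ => C_mul_mem (hE q) _)) (X_mul_mem hG 3 rfl), ?_⟩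
  rintro (i | _ | q)
  · simp only [addPts, Sum.elim_inl, map_add, map_mul, eval_X, hGc]
    rw [mul_div_cancel₀ _ (hS.v3 i)]
    ring
  · simp only [addPts, Sum.elim_inr, Option.elim, F₁, map_add, map_mul, eval_C, map_sum, hE0,
      eval_prod_e0]
    simp
  · simp only [addPts, Sum.elim_inr, Option.elim, map_add, map_mul, eval_pt_X3, F₁, eval_C,
      map_sum, eval_prod_pt]
    rw [Finset.sum_eq_single q (fun q' _ h => by rw [hne q' q h, mul_zero]) (by simp),
      div_mul_cancel₀ _ (heq q)]
    ring

lemma StepData.dvd_of_vanish (hS : StepData f v b r θ) (hQ : QProp f n v) {F : R4 k}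
    (hF : F ∈ RZ k (n : ℤ)) (h : ∀ i, eval (addPts v b r i) F = 0) : f ∣ F := by
  obtain ⟨h1, h2, h3⟩ := (forall_addPts (P := fun p => eval p F = 0)).1 h
  obtain ⟨A, -, B, hB, D, hD, e⟩ := hS.exists_eq hF h3
  have hD0 := hS.eval_e0_eq_zero e h2
  obtain ⟨d, rfl⟩ := RZ_zero_deg (by simpa using hD)
  rw [eval_C] at hD0
  subst hD0
  have : f ∣ B := hQ.dvd_of_vanish B hB fun i => by
    have := h1 i
    rw [e] at this
    simpa [hQ.onX i, hS.v3 i] using this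
  rw [e, C_0, mul_zero, add_zero]
  exact dvd_add (dvd_mul_right _ _) (this.mul_left _)

end

section
variable {k : Type} [Field k]

lemma eval_add_RZ_one {L : R4 k} (hL : L ∈ RZ k 1) (p q : Fin 4 → k) :
    eval (p + q) L = eval p L + eval q L := by
  obtain ⟨c, rfl⟩ := exists_linear hL
  simp [add_mul, Finset.sum_add_distrib]

/-- A quadratic form vanishing on a line is a combination of linear forms doing so. -/
lemma exists_of_eval_line {p q : Fin 4 → k} {lam mu F : R4 k} (hl : lam ∈ RZ k 1)
    (hm : mu ∈ RZ k 1) (hlp : eval p lam = 1) (hlq : eval q lam = 0) (hmp : eval p mu = 0)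
    (hmq : eval q mu = 1) (hF : F ∈ RZ k 2) (hp : eval p F = 0) (hq : eval q F = 0)
    (hpq : eval (p + q) F = 0) : ∃ L : Fin 4 → R4 k,
      (∀ j, L j ∈ RZ k 1 ∧ eval p (L j) = 0 ∧ eval q (L j) = 0) ∧ F = ∑ j, X j * L j := by
  obtain ⟨G, hG, rfl⟩ := exists_eq_sum_X (by norm_num) hF
  replace hG : ∀ j, G j ∈ RZ k 1 := fun j => by simpa using hG j
  let pr : R4 k → R4 k := fun a => a - C (eval p a) * lam - C (eval q a) * mu
  have hpr : ∀ a ∈ RZ k 1, pr a ∈ RZ k 1 ∧ eval p (pr a) = 0 ∧ eval q (pr a) = 0 :=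
    fun a ha => ⟨Submodule.sub_mem _ (Submodule.sub_mem _ ha (C_mul_mem hl _)) (C_mul_mem hm _),
      by simp [pr, hlp, hmp], by simp [pr, hlq, hmq]⟩
  let A : R4 k := ∑ j, X j * C (eval p (G j))
  let B : R4 k := ∑ j, X j * C (eval q (G j))
  have hA : A ∈ RZ k 1 := Submodule.sum_mem _ fun j _ => X_mul_mem (C_mem_RZ _) j rfl
  have hB : B ∈ RZ k 1 := Submodule.sum_mem _ fun j _ => X_mul_mem (C_mem_RZ _) j rfl
  obtain ⟨cl, hcl⟩ := exists_linear hl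
  obtain ⟨cm, hcm⟩ := exists_linear hm
  have e1 : eval p A = 0 := by simpa [A] using hp
  have e2 : eval q B = 0 := by simpa [B] using hq
  have e3 : eval q A + eval p B = 0 := by
    simp only [map_sum, map_mul, eval_X, eval_add_RZ_one (hG _), Pi.add_apply] at hp hq hpq
    simp only [A, B, map_sum, map_mul, eval_X, eval_C, ← Finset.sum_add_distrib]
    simp only [Fin.sum_univ_four] at hp hq hpq ⊢
    linear_combination hpq - hp - hq
  refine ⟨fun j => pr (G j) + (C (cl j) * pr A + C (cm j) * pr B), fun j => ⟨?_, ?_, ?_⟩, ?_⟩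
  · exact Submodule.add_mem _ (hpr _ (hG j)).1 (Submodule.add_mem _ (C_mul_mem (hpr _ hA).1 _)
      (C_mul_mem (hpr _ hB).1 _))
  · simp [(hpr _ (hG j)).2.1, (hpr _ hA).2.1, (hpr _ hB).2.1]
  · simp [(hpr _ (hG j)).2.2, (hpr _ hA).2.2, (hpr _ hB).2.2]
  · have h1 : ∑ j, X j * (pr (G j) + (C (cl j) * pr A + C (cm j) * pr B)) =
        ∑ j, X j * pr (G j) + (lam * pr A + mu * pr B) := by
      rw [hcl, hcm]
      simp only [Fin.sum_univ_four]
      ring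
    have h2 : ∑ j, X j * pr (G j) = ∑ j, X j * G j - A * lam - B * mu := by
      simp only [A, B, pr, Fin.sum_univ_four]
      ring
    have h3 : (C (eval q A) : R4 k) + C (eval p B) = 0 := by rw [← C_add, e3, C_0]
    have h4 : lam * pr A + mu * pr B = A * lam + B * mu := by
      simp only [pr, e1, e2, C_0]
      linear_combination (-lam * mu) * h3
    rw [h1, h2, h4]
    ring

variable {f : R4 k} {ι : Type*} [Fintype ι] {n : ℕ} {v : ι → Fin 4 → k} {b r : Fin n → Fin 3 → k}
  {θ : ι → Fin 4 → k}

/-- The forms of degree `a + 1` generated in degree `a` by forms vanishing at `w`, modulo `f`. -/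
def GenBy (f : R4 k) (a : ℤ) {κ : Type*} (w : κ → Fin 4 → k) (F : R4 k) : Prop :=
  ∃ G : Fin 4 → R4 k, (∀ j, G j ∈ RZ k a ∧ ∀ i, eval (w i) (G j) = 0) ∧ f ∣ F - ∑ j, X j * G j

lemma GenBy.add {a : ℤ} {κ : Type*} {w : κ → Fin 4 → k} {F F' : R4 k} (h : GenBy f a w F)
    (h' : GenBy f a w F') : GenBy f a w (F + F') := by
  obtain ⟨G, hG, hd⟩ := h
  obtain ⟨G', hG', hd'⟩ := h'
  refine ⟨fun j => G j + G' j, fun j => ⟨Submodule.add_mem _ (hG j).1 (hG' j).1, fun i => ?_⟩, ?_⟩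
  · rw [map_add, (hG j).2, (hG' j).2, add_zero]
  · simp only [mul_add, Finset.sum_add_distrib]
    convert dvd_add hd hd' using 1
    ring

lemma GenBy.linear_mul {a : ℤ} {κ : Type*} {w : κ → Fin 4 → k} {L F : R4 k} (hL : L ∈ RZ k 1)
    (hF : F ∈ RZ k a) (h : ∀ i, eval (w i) F = 0) : GenBy f a w (L * F) := by
  obtain ⟨c, rfl⟩ := exists_linear hL
  refine ⟨fun j => C (c j) * F, fun j => ⟨C_mul_mem hF _, fun i => by simp [h]⟩, ?_⟩
  simp only [Fin.sum_univ_four]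
  convert dvd_zero f using 1
  ring

lemma eval_addPts_X3_mul {ι : Type*} {v : ι → Fin 4 → k} {G : R4 k}
    (h : ∀ i, eval (v i) G = 0) (i) :
    eval (addPts v b r i) (X 3 * G) = 0 := by
  revert i
  rw [forall_addPts (P := fun p => eval p (X 3 * G) = 0)]
  exact ⟨fun i => by rw [map_mul, h, mul_zero], by simp, fun l s => by
    rw [map_mul, eval_pt_X3, zero_mul]⟩

lemma StepData.exists_aux (hS : StepData f v b r θ) (hQ : QProp f n v) {y : R4 k}
    (hy : y ∈ RZ k 1) (hy0 : eval ![1, 0, 0, 0] y = 0) : ∃ G ∈ RZ k (n : ℤ),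
      (∏ l, lin (b l)) * y + X 3 * G ∈ RZ k ((n : ℤ) + 1) ∧
      ∀ i, eval (addPts v b r i) ((∏ l, lin (b l)) * y + X 3 * G) = 0 := by
  obtain ⟨G, hG, hGc⟩ := hQ.interp fun i => -(eval (v i) ((∏ l, lin (b l)) * y)) / v i 3
  refine ⟨G, hG, Submodule.add_mem _ (mul_mem_RZ (prod_lin_mem b) hy rfl) (X_mul_mem hG 3 rfl), ?_⟩
  rw [forall_addPts (P := fun p => eval p ((∏ l, lin (b l)) * y + X 3 * G) = 0)]
  refine ⟨fun i => ?_, by simp [hy0], fun l s => ?_⟩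
  · rw [map_add, map_mul (eval _) (X 3), hGc, eval_X, mul_div_cancel₀ _ (hS.v3 i), add_neg_cancel]
  · rw [map_add, map_mul, map_mul, eval_prod_pt, eval_pt_X3, zero_mul, zero_mul, add_zero]

/-- In the first step, multiples of `x₃` by quadrics through the two points are generated by
quadrics. -/
lemma StepData.genBy_one (hS : StepData f v b r θ) (hQ : QProp f n v) (hn : n = 1) {F : R4 k}
    (hF : F ∈ RZ k 2) (h : ∀ i, eval (v i) F = 0) :
    GenBy f (n + 1 : ℤ) (addPts v b r) (X 3 * F) := by
  classical
  have hcard : Fintype.card ι = 2 := by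
    have := hQ.card
    rw [hn] at this
    push_cast at this
    omega
  obtain ⟨i, j, hij, hu⟩ := Finset.card_eq_two.1 (Finset.card_univ.trans hcard)
  have huniv : ∀ l, l = i ∨ l = j := fun l => by
    have := Finset.mem_univ l
    rw [hu] at this
    simpa using this
  have hsum : ∀ g : ι → k, ∑ l, g l = g i + g j := fun g => by
    rw [hu, Finset.sum_pair hij]
  obtain ⟨lam, hl, hlc⟩ := hQ.interp (Pi.single i 1)
  obtain ⟨mu, hm, hmc⟩ := hQ.interp (Pi.single j 1)
  have hn1 : (n : ℤ) = 1 := by omega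
  rw [hn1] at hl hm
  set M := ∏ l, lin (b l) with hM
  have hMm : M ∈ RZ k 1 := hn1 ▸ prod_lin_mem b
  have hθ : ∀ l, θ j l = - θ i l := fun l => by
    have := hS.sum 1 (by rw [hn1]; exact one_mem_RZ) l
    rw [hsum] at this
    simp only [map_one, mul_one] at this
    linear_combination this
  have hphi := hS.phi
  rw [hsum, hθ] at hphi
  have hvi := hS.v3 i
  have hvj := hS.v3 j
  have hμ : eval (v i) M * v j 3 - eval (v j) M * v i 3 ≠ 0 := by
    intro h0
    apply hphi
    field_simp
    linear_combination (θ i 0) * h0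
  have hθ0 : θ i 0 ≠ 0 := by
    intro h0
    apply hphi
    rw [h0]
    ring
  have hdi := hS.dot i
  have hdj := hS.dot j
  simp only [Fin.sum_univ_four, hθ] at hdi hdj
  have hpar : v i 3 * v j 1 - v j 3 * v i 1 ≠ 0 ∨ v i 3 * v j 2 - v j 3 * v i 2 ≠ 0 := by
    by_contra! hc
    have h0 : v i 3 * v j 0 - v j 3 * v i 0 = 0 := by
      refine (mul_eq_zero.1 ?_).resolve_left hθ0
      linear_combination -(v i 3) * hdj - (v j 3) * hdi - θ i 1 * hc.1 - θ i 2 * hc.2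
    obtain ⟨c, hc'⟩ := exists_linear hm
    have e1 : v i 3 * eval (v j) mu = v j 3 * eval (v i) mu := by
      rw [hc']
      simp [Fin.sum_univ_four]
      linear_combination c 0 * h0 + c 1 * hc.1 + c 2 * hc.2
    rw [hmc, hmc] at e1
    simp [hij, hvi] at e1
  have key : ∃ y : Fin 4, y ≠ 0 ∧ v i 3 * v j y - v j 3 * v i y ≠ 0 := by
    rcases hpar with h | h
    exacts [⟨1, by decide, h⟩, ⟨2, by decide, h⟩]
  obtain ⟨y, hy, hyne⟩ := key
  obtain ⟨G, hG, hmem, hvan⟩ := hS.exists_aux hQ (X_mem_RZ y) (by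
    fin_cases y <;> simp at hy ⊢)
  rw [← hM] at hmem hvan
  rw [hn1] at hG
  set F₁ := M * X y + X 3 * G with hF₁
  have h1 : ∀ l, eval (v l) F₁ = 0 := fun l => hvan (Sum.inl l)
  have hc : eval (v i + v j) F₁ ≠ 0 := by
    intro h0
    have hi := h1 i
    have hj := h1 j
    simp only [hF₁, map_add, map_mul, eval_X, eval_add_RZ_one hMm, eval_add_RZ_one hG,
      Pi.add_apply] at h0 hi hj
    have : (eval (v i) M * v j 3 - eval (v j) M * v i 3) * (v i 3 * v j y - v j 3 * v i y) = 0 := by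
      linear_combination (v i 3 * v j 3) * (h0 - hi - hj) - (v j 3) ^ 2 * hi - (v i 3) ^ 2 * hj
    exact (mul_ne_zero hμ hyne) this
  have hF₁m : F₁ ∈ RZ k 2 := by
    convert hmem using 2
    omega
  set d := eval (v i + v j) F / eval (v i + v j) F₁ with hd
  obtain ⟨L, hL, e⟩ := exists_of_eval_line (p := v i) (q := v j) hl hm
    (by simp [hlc]) (by simp [hlc, hij.symm])
    (by simp [hmc, hij]) (by simp [hmc])
    (Submodule.sub_mem _ hF (C_mul_mem hF₁m d)) (by simp [h, h1]) (by simp [h, h1])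
    (by rw [map_sub, map_mul, eval_C, hd, div_mul_cancel₀ _ hc, sub_self])
  have e2 : X 3 * F = (C d * X 3) * F₁ + X 3 * ∑ j, X j * L j := by
    rw [← e]; ring
  rw [e2]
  refine (GenBy.linear_mul (C_mul_mem (X_mem_RZ 3) d) hmem hvan).add
    ⟨fun j => X 3 * L j, fun l => ⟨X_mul_mem (hL l).1 3 (by omega), eval_addPts_X3_mul fun t => ?_⟩,
      ?_⟩
  · rcases huniv t with rfl | rfl
    exacts [(hL l).2.1, (hL l).2.2]
  · simp only [Fin.sum_univ_four]
    convert dvd_zero f using 1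
    ring

lemma StepData.gen (hS : StepData f v b r θ) (hQ : QProp f n v) (hn : 1 ≤ n) {F : R4 k}
    (hF : F ∈ RZ k ((n : ℤ) + 1 + 1)) (h : ∀ i, eval (addPts v b r i) F = 0) :
    GenBy f (n + 1 : ℤ) (addPts v b r) F := by
  obtain ⟨h1, h2, h3⟩ := (forall_addPts (P := fun p => eval p F = 0)).1 h
  obtain ⟨A, -, B, hB, D, hD, e⟩ := hS.exists_eq hF h3
  obtain ⟨D₁, hD₁, D₂, hD₂, D₃, hD₃, rfl⟩ := exists_of_eval_e0 hD (hS.eval_e0_eq_zero e h2)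
  have hdeg : (n : ℤ) + 1 + 1 - n - 1 = 1 := by ring
  rw [hdeg] at hD₁ hD₂ hD₃
  obtain ⟨G₁, hG₁, hm₁, hv₁⟩ := hS.exists_aux hQ (X_mem_RZ 1) (by simp)
  obtain ⟨G₂, hG₂, hm₂, hv₂⟩ := hS.exists_aux hQ (X_mem_RZ 2) (by simp)
  set M := ∏ l, lin (b l) with hM
  set F₁ := M * X 1 + X 3 * G₁ with hF₁
  set F₂ := M * X 2 + X 3 * G₂ with hF₂
  set E := B + M * D₃ - D₁ * G₁ - D₂ * G₂ with hE
  have eE : F = f * A + (D₁ * F₁ + D₂ * F₂ + X 3 * E) := by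
    rw [e, hE, hF₁, hF₂]; ring
  have hEm : E ∈ RZ k ((n : ℤ) + 1) := by
    refine Submodule.sub_mem _ (Submodule.sub_mem _ (Submodule.add_mem _ ?_
      (mul_mem_RZ (prod_lin_mem b) hD₃ rfl)) (mul_mem_RZ hD₁ hG₁ (by ring)))
      (mul_mem_RZ hD₂ hG₂ (by ring))
    simpa using hB
  have hEv : ∀ i, eval (v i) E = 0 := fun i => by
    have h5 := h1 i
    have e1 : eval (v i) F₁ = 0 := hv₁ (Sum.inl i)
    have e2 : eval (v i) F₂ = 0 := hv₂ (Sum.inl i)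
    rw [eE] at h5
    simpa only [map_add, map_mul, e1, e2, hQ.onX, eval_X, mul_zero, zero_mul, zero_add,
      mul_eq_zero, hS.v3 i, false_or] using h5
  have hgE : GenBy f (n + 1 : ℤ) (addPts v b r) (X 3 * E) := by
    rcases hn.lt_or_eq with hn | hn
    · obtain ⟨G, hG, q, hq⟩ := hQ.gen (by omega) E hEm hEv
      refine ⟨fun j => X 3 * G j, fun j => ⟨X_mul_mem (hG j).1 3 rfl,
        eval_addPts_X3_mul (hG j).2⟩, X 3 * q, ?_⟩
      simp only [Fin.sum_univ_four] at hq ⊢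
      linear_combination X 3 * hq
    · refine hS.genBy_one hQ hn.symm ?_ hEv
      convert hEm using 2
      omega
  obtain ⟨G, hG, q, hq⟩ := ((GenBy.linear_mul hD₁ hm₁ hv₁).add
    (GenBy.linear_mul hD₂ hm₂ hv₂)).add hgE
  exact ⟨G, hG, A + q, by rw [eE]; linear_combination hq⟩

end

section
variable {k : Type} [Field k]
variable {f : R4 k} {ι : Type*} [Fintype ι] {n : ℕ} {v : ι → Fin 4 → k} {b r : Fin n → Fin 3 → k}
  {θ : ι → Fin 4 → k}

/-- A tangential field modulo `(f, x₃)`, up to a multiple of the distinguished direction. -/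
lemma StepData.exists_decomp (hS : StepData f v b r θ) (hn : 1 ≤ n) {T : Fin 4 → R4 k}
    (hT : ∀ j, T j ∈ RZ k (n : ℤ))
    (h : ∀ i j l, eval (addPts v b r i) (T j) * addPts v b r i l =
      eval (addPts v b r i) (T l) * addPts v b r i j) :
    ∃ (d : k) (U : R4 k) (ρ t : Fin 4 → R4 k), (∀ j, t j ∈ RZ k ((n : ℤ) - 1)) ∧
      ∀ j, T j = C ((![1, 0, 0, 0] : Fin 4 → k) j * d) * (∏ l, lin (b l)) + X j * U + X 3 * t j
        + f * ρ j := by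
  obtain ⟨-, h2, h3⟩ := (forall_addPts (P := fun p => ∀ j l, eval p (T j) * p l =
    eval p (T l) * p j)).1 h
  have hT0 : ∀ j, j ≠ 0 → eval ![1, 0, 0, 0] (T j) = 0 := fun j hj => by
    have := h2 j 0
    rw [show (![1, 0, 0, 0] : Fin 4 → k) j = 0 by fin_cases j <;> simp at hj ⊢] at this
    simpa using this
  have hT3 : ∀ l s, eval (pt (b l) (r l s)) (T 3) = 0 := fun l s => by
    simpa [pt] using h3 l s 3 2
  obtain ⟨A₃, -, B₃, -, D₃, hD₃, e₃⟩ := hS.exists_eq (hT 3) hT3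
  have hD30 := hS.eval_e0_eq_zero e₃ (hT0 3 (by decide))
  obtain ⟨d₃, rfl⟩ := RZ_zero_deg (by simpa using hD₃)
  rw [eval_C] at hD30
  subst hD30
  have cross : ∀ i j : Fin 4, ∃ A B c₁ c₂, T i * X j - T j * X i =
      f * A + X 3 * B + (∏ l, lin (b l)) * (C c₁ * X 1 + C c₂ * X 2) := fun i j => by
    have hm : T i * X j - T j * X i ∈ RZ k ((n : ℤ) + 1) :=
      Submodule.sub_mem _ (mul_mem_RZ (hT i) (X_mem_RZ j) rfl) (mul_mem_RZ (hT j) (X_mem_RZ i) rfl)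
    obtain ⟨A, -, B, -, D, hD, e⟩ := hS.exists_eq hm fun l s => by
      rw [map_sub, map_mul, map_mul, eval_X, eval_X, h3 l s i j, sub_self]
    obtain ⟨D₁, hD₁, D₂, hD₂, D₃, hD₃, rfl⟩ := exists_of_eval_e0 hD (hS.eval_e0_eq_zero e (by
      rw [map_sub, map_mul, map_mul, eval_X, eval_X, h2 i j, sub_self]))
    have hdeg : (n : ℤ) + 1 - n - 1 = 0 := by ring
    rw [hdeg] at hD₁ hD₂ hD₃
    obtain ⟨c₁, rfl⟩ := RZ_zero_deg hD₁
    obtain ⟨c₂, rfl⟩ := RZ_zero_deg hD₂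
    exact ⟨A, B + (∏ l, lin (b l)) * D₃, c₁, c₂, by rw [e]; ring⟩
  obtain ⟨a01, b01, γ₁, γ₂, e01⟩ := cross 0 1
  obtain ⟨a02, b02, β₁, β₂, e02⟩ := cross 0 2
  obtain ⟨a12, b12, α₁, α₂, e12⟩ := cross 1 2
  set M := ∏ l, lin (b l) with hM
  let Q : R4 k := X 0 * (C α₁ * X 1 + C α₂ * X 2) - X 1 * (C β₁ * X 1 + C β₂ * X 2) +
    X 2 * (C γ₁ * X 1 + C γ₂ * X 2)
  have hQm : Q ∈ RZ k 2 := by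
    have : ∀ c₁ c₂ : k, C c₁ * X 1 + C c₂ * X 2 ∈ RZ k 1 := fun c₁ c₂ =>
      Submodule.add_mem _ (C_mul_mem (X_mem_RZ 1) _) (C_mul_mem (X_mem_RZ 2) _)
    exact Submodule.add_mem _ (Submodule.sub_mem _ (X_mul_mem (this _ _) 0 rfl)
      (X_mul_mem (this _ _) 1 rfl)) (X_mul_mem (this _ _) 2 rfl)
  obtain ⟨A', B', eQ⟩ := hS.exists_of_prod_mul (G := Q)
    (A := -(X 0 * a12 - X 1 * a02 + X 2 * a01)) (B := -(X 0 * b12 - X 1 * b02 + X 2 * b01)) (by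
      simp only [Q]
      linear_combination X 1 * e02 - X 0 * e12 - X 2 * e01)
  have eQ2 : Q = X 3 * cmp 1 B' := by
    have := congrArg (cmp 2) eQ
    rwa [cmp_same hQm, map_add, cmp_mul hS.mem, RZ_neg (by norm_num) (cmp_mem (2 - 3) A'),
      cmp_mul (X_mem_RZ 3), mul_zero, zero_add] at this
  have ev : ∀ x y z : k,
      x * (α₁ * y + α₂ * z) - y * (β₁ * y + β₂ * z) + z * (γ₁ * y + γ₂ * z) = 0 :=
    fun x y z => by
      have := congrArg (eval ![x, y, z, 0]) eQ2
      simpa [Q] using this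
  have hβ₁ : β₁ = 0 := by simpa using ev 0 1 0
  have hγ₂ : γ₂ = 0 := by simpa using ev 0 0 1
  have hα₁ : α₁ = 0 := by simpa [hβ₁] using ev 1 1 0
  have hα₂ : α₂ = 0 := by simpa [hγ₂] using ev 1 0 1
  have hβ₂ : β₂ = γ₁ := by
    have := ev 0 1 1
    simp only [hβ₁, hγ₂] at this
    linear_combination -this
  subst hβ₁ hγ₂ hα₁ hα₂ hβ₂
  simp only [C_0, zero_mul, zero_add, add_zero, mul_zero] at e01 e02 e12
  have hne := (hS.trans ⟨0, hn⟩).ne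
  have hX3 : ¬ (X 3 : R4 k) ∣ f := by
    rintro ⟨q, hq⟩
    rw [hq] at hne
    simp at hne
  obtain ⟨e, he⟩ := ((X_prime (i := (3 : Fin 4)) (R := k)).dvd_or_dvd
    (a := f) (b := X 0 * a12 - X 1 * a02 + X 2 * a01)
    ⟨-(X 0 * b12 - X 1 * b02 + X 2 * b01), by
      linear_combination X 1 * e02 - X 0 * e12 - X 2 * e01⟩).resolve_left hX3
  obtain ⟨ρ, s, r01, r02, r12⟩ := koszul_three_mod he
  obtain ⟨U, t₀, t₁, t₂, u0, u1, u2⟩ := koszul_cross_mod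
    (N₀ := T 0 - C β₂ * M - f * ρ 0) (N₁ := T 1 - f * ρ 1) (N₂ := T 2 - f * ρ 2)
    (e := b01 + f * s 0) (e' := b02 + f * s 1)
    (by linear_combination e01 + f * r01) (by linear_combination e02 + f * r02)
  let ρ' : Fin 4 → R4 k := ![ρ 0, ρ 1, ρ 2, A₃]
  let t : Fin 4 → R4 k := ![t₀, t₁, t₂, B₃ - U]
  have hdec : ∀ j, T j = C ((![1, 0, 0, 0] : Fin 4 → k) j * β₂) * M + X j * U + X 3 * t j
      + f * ρ' j := fun j => by
    fin_cases j
    · simp [t, ρ']; linear_combination u0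
    · simp [t, ρ']; linear_combination u1
    · simp [t, ρ']; linear_combination u2
    · simp [t, ρ']; rw [C_0] at e₃; linear_combination e₃
  refine ⟨β₂, cmp (n - 1) U, fun j => cmp (n - 3) (ρ' j), fun j => cmp (n - 1) (t j),
    fun j => cmp_mem _ _, fun j => ?_⟩
  rw [← cmp_mul (X_mem_RZ j), ← cmp_mul (X_mem_RZ 3), ← cmp_mul hS.mem]
  conv_lhs => rw [← cmp_same (hT j), hdec j]
  rw [map_add, map_add, map_add, cmp_same (C_mul_mem (prod_lin_mem b) _)]

lemma StepData.euler (hS : StepData f v b r θ) (hQ : QProp f n v) (hn : 1 ≤ n) {T : Fin 4 → R4 k}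
    (hT : ∀ j, T j ∈ RZ k (n : ℤ))
    (h : ∀ i j l, eval (addPts v b r i) (T j) * addPts v b r i l =
      eval (addPts v b r i) (T l) * addPts v b r i j) :
    ∃ U, ∀ j, f ∣ T j - X j * U := by
  obtain ⟨d, U, ρ, t, ht, e⟩ := hS.exists_decomp hn hT h
  set M := ∏ l, lin (b l) with hM
  have h1 : ∀ i j l, eval (v i) (T j) * v i l = eval (v i) (T l) * v i j := fun i =>
    h (Sum.inl i)
  have e1 : ∀ i j, eval (v i) (T j) = (![1, 0, 0, 0] : Fin 4 → k) j * d * eval (v i) M +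
      v i j * eval (v i) U + v i 3 * eval (v i) (t j) := fun i j => by
    rw [e j]
    simp [hQ.onX i]
  have e2 : ∀ i, d * (θ i 0 * (eval (v i) M / v i 3)) + ∑ j, θ i j * eval (v i) (t j) = 0 :=
    fun i => by
      have hv := hS.v3 i
      have hd := hS.dot i
      have c0 := h1 i 0 3
      have c1 := h1 i 1 3
      have c2 := h1 i 2 3
      simp only [e1] at c0 c1 c2
      simp at c0 c1 c2
      simp only [Fin.sum_univ_four] at hd ⊢
      field_simp
      refine mul_left_cancel₀ hv ?_
      linear_combination θ i 0 * c0 + θ i 1 * c1 + θ i 2 * c2 + v i 3 * eval (v i) (t 3) * hd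
  have hd : d = 0 := by
    have := Finset.sum_eq_zero fun i (_ : i ∈ Finset.univ) => e2 i
    rw [Finset.sum_add_distrib, ← Finset.mul_sum, Finset.sum_comm,
      Finset.sum_eq_zero fun j _ => hS.sum (t j) (ht j) j, add_zero] at this
    exact (mul_eq_zero.1 this).resolve_right hS.phi
  obtain ⟨U', hU'⟩ := hQ.euler t ht fun i j l => by
    have := h1 i j l
    rw [e1, e1, hd] at this
    refine mul_left_cancel₀ (hS.v3 i) ?_
    linear_combination this
  refine ⟨U + X 3 * U', fun j => ?_⟩
  obtain ⟨q, hq⟩ := hU' j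
  refine ⟨ρ j + X 3 * q, ?_⟩
  rw [e j, hd, mul_zero, C_0]
  linear_combination X 3 * hq

/-- The inductive step in normalized coordinates. -/
lemma StepData.qProp (hS : StepData f v b r θ) (hQ : QProp f n v) (hn : 1 ≤ n) :
    QProp f (n + 1 : ℕ) (addPts v b r) where
  card := by
    have := hQ.card
    simp only [Fintype.card_sum, Fintype.card_option, Fintype.card_prod, Fintype.card_fin]
    push_cast
    linarith
  onX := (forall_addPts (P := fun p => eval p f = 0)).2 ⟨hQ.onX, hS.e0, fun l s =>
    (hS.trans l).onX s⟩
  interp c := by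
    push_cast
    exact hS.interp hQ c
  dvd_of_vanish F hF h := hS.dvd_of_vanish hQ (by simpa using hF) h
  euler T hT h := hS.euler hQ hn (by simpa using hT) h
  gen _ F hF h := by
    push_cast at hF ⊢
    exact hS.gen hQ hn hF h

end

section
variable {k : Type} [Field k]

/-- A property of points of affine space that holds where some nonzero polynomial is nonzero. -/
def Generic {σ : Type*} (P : (σ → k) → Prop) : Prop :=
  ∃ p : MvPolynomial σ k, p ≠ 0 ∧ ∀ b, eval b p ≠ 0 → P b

section Generic
variable {σ : Type*} {P Q : (σ → k) → Prop}

lemma Generic.of_eval (p : MvPolynomial σ k) (b : σ → k) (hb : eval b p ≠ 0)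
    (h : ∀ b, eval b p ≠ 0 → P b) : Generic P :=
  ⟨p, fun h0 => hb (by simp [h0]), h⟩

lemma Generic.and (hP : Generic P) (hQ : Generic Q) : Generic fun b => P b ∧ Q b := by
  obtain ⟨p, hp, hP⟩ := hP
  obtain ⟨q, hq, hQ⟩ := hQ
  refine ⟨p * q, mul_ne_zero hp hq, fun b hb => ?_⟩
  rw [map_mul] at hb
  exact ⟨hP b (left_ne_zero_of_mul hb), hQ b (right_ne_zero_of_mul hb)⟩

lemma Generic.forall {τ : Type*} [Finite τ] {P : τ → (σ → k) → Prop} (h : ∀ i, Generic (P i)) :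
    Generic fun b => ∀ i, P i b := by
  cases nonempty_fintype τ
  choose p hp h using h
  refine ⟨∏ i, p i, Finset.prod_ne_zero_iff.2 fun i _ => hp i, fun b hb i => h i b ?_⟩
  rw [map_prod] at hb
  exact Finset.prod_ne_zero_iff.1 hb i (Finset.mem_univ i)

lemma Generic.exists [Infinite k] (h : Generic P) : ∃ b, P b := by
  obtain ⟨p, hp, h⟩ := h
  by_contra! H
  exact hp (MvPolynomial.funext fun b => by
    rw [map_zero]
    by_contra hb
    exact H b (h b hb))

end Generic

/-- The restriction of a form to the line parametrized by `t ↦ t U + W`. -/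
noncomputable def lineRes {A : Type*} [CommRing A] [Algebra k A] (f : R4 k) (U W : Fin 4 → A) :
    Polynomial A :=
  aeval (fun i => Polynomial.X * Polynomial.C (U i) + Polynomial.C (W i)) f

/-- The cubic polynomial obtained by restricting a form to a line. -/
noncomputable def lineCubic {A : Type*} [CommRing A] [Algebra k A] (f : R4 k) (U W : Fin 4 → A) :
    Cubic A :=
  ⟨(lineRes f U W).coeff 3, (lineRes f U W).coeff 2, (lineRes f U W).coeff 1,
    (lineRes f U W).coeff 0⟩

lemma map_lineRes {A B : Type*} [CommRing A] [Algebra k A] [CommRing B] [Algebra k B]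
    (φ : A →ₐ[k] B) (f : R4 k) (U W : Fin 4 → A) :
    (lineRes f U W).map (φ : A →+* B) = lineRes f (fun i => φ (U i)) fun i => φ (W i) := by
  have : (Polynomial.mapAlgHom φ).comp (aeval fun i => Polynomial.X * Polynomial.C (U i) +
      Polynomial.C (W i)) = aeval fun i => Polynomial.X * Polynomial.C (φ (U i)) +
      Polynomial.C (φ (W i)) := by
    ext i : 1
    simp
  exact DFunLike.congr_fun this f

lemma map_lineDiscr {A B : Type*} [CommRing A] [Algebra k A] [CommRing B] [Algebra k B]
    (φ : A →ₐ[k] B) (f : R4 k) (U W : Fin 4 → A) :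
    φ (lineCubic f U W).discr = (lineCubic f (fun i => φ (U i)) fun i => φ (W i)).discr := by
  simp only [lineCubic, ← map_lineRes, Polynomial.coeff_map, Cubic.discr]
  simp [map_ofNat]

lemma eval_lineRes (f : R4 k) (U W : Fin 4 → k) (t : k) :
    (lineRes f U W).eval t = eval (fun i => t * U i + W i) f := by
  have : (Polynomial.aeval t : Polynomial k →ₐ[k] k).comp
      (aeval fun i => Polynomial.X * Polynomial.C (U i) +
      Polynomial.C (W i)) = aeval fun i => t * U i + W i := by
    ext i : 1
    simp only [AlgHom.comp_apply, aeval_X, map_add, map_mul, Polynomial.aeval_X,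
      Polynomial.aeval_C, Algebra.algebraMap_self, RingHom.id_apply]
  exact DFunLike.congr_fun this f

lemma coeff_lineRes {n : ℕ} {f : R4 k} (hf : f ∈ RZ k n) (U W : Fin 4 → k) :
    (lineRes f U W).natDegree ≤ n ∧ (lineRes f U W).coeff n = eval U f := by
  induction n generalizing f with
  | zero =>
    obtain ⟨c, rfl⟩ := RZ_zero_deg (by simpa using hf)
    simp [lineRes, Polynomial.algebraMap_eq]
  | succ n ih =>
    obtain ⟨q, hq, rfl⟩ := exists_eq_sum_X (by positivity) hf
    have hq' := fun i => ih (f := q i) (by simpa using hq i)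
    have e : lineRes (∑ i, X i * q i) U W =
        ∑ i, (Polynomial.X * Polynomial.C (U i) + Polynomial.C (W i)) * lineRes (q i) U W := by
      simp [lineRes]
    rw [e]
    constructor
    · refine Polynomial.natDegree_sum_le_of_forall_le _ _ fun i _ => ?_
      refine Polynomial.natDegree_mul_le.trans ?_
      have := (hq' i).1
      have : (Polynomial.X * Polynomial.C (U i) + Polynomial.C (W i)).natDegree ≤ 1 := by
        compute_degree
      omega
    · rw [Polynomial.finsetSum_coeff, map_sum]
      refine Finset.sum_congr rfl fun i _ => ?_
      rw [add_mul, mul_assoc, Polynomial.coeff_add, Polynomial.coeff_X_mul,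
          Polynomial.coeff_C_mul, Polynomial.coeff_C_mul, (hq' i).2,
        Polynomial.coeff_eq_zero_of_natDegree_lt (n := n + 1) (by have := (hq' i).1; omega)]
      simp

lemma toPoly_lineCubic {f : R4 k} (hf : f ∈ RZ k 3) (U W : Fin 4 → k) :
    (lineCubic f U W).toPoly = lineRes f U W := by
  have h := (coeff_lineRes (n := 3) hf U W).1
  rw [Polynomial.as_sum_range' _ 4 (by omega : (lineRes f U W).natDegree < 4)]
  simp [Finset.sum_range_succ, Cubic.toPoly, lineCubic, ← Polynomial.C_mul_X_pow_eq_monomial]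
  ring

lemma pt_eq (b : Fin 3 → k) (t : k) :
    pt b t = fun i => t * (![-b 0, 1, 0, 0] : Fin 4 → k) i + (![-b 1, 0, 1, 0] : Fin 4 → k) i := by
  ext i
  fin_cases i <;> simp [pt]
  ring

lemma exists_transversal [IsAlgClosed k] {f : R4 k} (hf : f ∈ RZ k 3) {b : Fin 3 → k}
    (h1 : eval ![-b 0, 1, 0, 0] f ≠ 0)
    (h2 : (lineCubic f ![-b 0, 1, 0, 0] ![-b 1, 0, 1, 0]).discr ≠ 0) :
    ∃ r, Transversal f b r := by
  set P := lineCubic f ![-b 0, 1, 0, 0] ![-b 1, 0, 1, 0] with hP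
  have ha : P.a ≠ 0 := by
    rw [← (coeff_lineRes (n := 3) hf _ ![-b 1, 0, 1, 0]).2] at h1
    exact h1
  obtain ⟨x, y, z, h3⟩ := (Cubic.splits_iff_roots_eq_three (φ := RingHom.id k) ha).1
    (IsAlgClosed.splits _)
  have hnd := (Cubic.discr_ne_zero_iff_roots_nodup (φ := RingHom.id k) ha
    (IsAlgClosed.splits _)).1 h2
  rw [h3] at hnd
  have hr : ∀ t ∈ ({x, y, z} : Multiset k), eval (pt b t) f = 0 := fun t ht => by
    rw [← h3, Cubic.map_roots, Polynomial.mem_roots', Polynomial.map_id, hP,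
      toPoly_lineCubic hf] at ht
    rw [pt_eq, ← eval_lineRes]
    exact ht.2
  refine ⟨![x, y, z], fun i j => ?_, fun s => hr _ ?_, h1⟩
  · simp at hnd
    fin_cases i <;> fin_cases j <;> simp <;> grind
  · fin_cases s <;> simp

lemma Transversal.exists_root {f : R4 k} (hf : f ∈ RZ k 3) {b r : Fin 3 → k}
    (h : Transversal f b r) {t : k} (ht : eval (pt b t) f = 0) : ∃ s, t = r s := by
  by_contra! H
  have hd := coeff_lineRes (n := 3) hf ![-b 0, 1, 0, 0] ![-b 1, 0, 1, 0]
  have : lineRes f ![-b 0, 1, 0, 0] ![-b 1, 0, 1, 0] = 0 := by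
    refine Polynomial.eq_zero_of_natDegree_lt_card_of_eval_eq_zero _
      (f := fun o : Option (Fin 3) => o.elim t r) ?_ ?_ ?_
    · rintro (_ | i) (_ | j) hij
      · rfl
      · exact absurd hij (H j)
      · exact absurd hij.symm (H i)
      · exact congrArg some (h.inj hij)
    · rintro (_ | i)
      · rw [eval_lineRes, ← pt_eq]; exact ht
      · rw [eval_lineRes, ← pt_eq]; exact h.onX i
    · simp; omega
  rw [this] at hd
  exact h.ne hd.2.symm

end

section
variable {k : Type} [Field k]

lemma generic_lin_ne {w : Fin 4 → k} (hw : w ≠ 0) : Generic fun b => eval w (lin b) ≠ 0 := by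
  have key : ∀ b : Fin 3 → k, eval b (C (w 0) + X 0 * C (w 1) + X 1 * C (w 2) + X 2 * C (w 3)) =
      eval w (lin b) := fun b => by simp [eval_lin]
  suffices H : ∃ b : Fin 3 → k, eval w (lin b) ≠ 0 by
    obtain ⟨b, hb⟩ := H
    exact Generic.of_eval _ b (by rwa [key]) fun b hb => by rwa [key] at hb
  by_contra! H
  simp only [eval_lin] at H
  have h0 := H 0
  have h1 := H ![1, 0, 0]
  have h2 := H ![0, 1, 0]
  have h3 := H ![0, 0, 1]
  simp at h0 h1 h2 h3
  simp only [h0, zero_add] at h1 h2 h3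
  exact hw (by ext i; fin_cases i <;> simp [h0, h1, h2, h3])

lemma generic_apply_lin_mul (L : R4 k →ₗ[k] k) (M : R4 k) {n : ℤ} (hn : 0 < n)
    {F : R4 k} (hF : F ∈ RZ k n) (h : L (M * F) ≠ 0) :
    Generic fun b => ∃ G ∈ RZ k (n - 1), L (M * lin b * G) ≠ 0 := by
  obtain ⟨q, hq, rfl⟩ := exists_eq_sum_X hn hF
  rw [Finset.mul_sum, map_sum] at h
  obtain ⟨i, -, hi⟩ := Finset.exists_ne_zero_of_sum_ne_zero h
  have e : ∀ b : Fin 3 → k, M * lin b * q i = M * (X 0 * q i) + b 0 • (M * (X 1 * q i)) +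
      b 1 • (M * (X 2 * q i)) + b 2 • (M * (X 3 * q i)) := fun b => by
    simp only [lin, smul_eq_C_mul]
    ring
  have key : ∀ b : Fin 3 → k, eval b (C (L (M * (X 0 * q i))) + X 0 * C (L (M * (X 1 * q i))) +
      X 1 * C (L (M * (X 2 * q i))) + X 2 * C (L (M * (X 3 * q i)))) = L (M * lin b * q i) :=
    fun b => by simp [e]
  suffices H : ∃ b : Fin 3 → k, L (M * lin b * q i) ≠ 0 by
    obtain ⟨b, hb⟩ := H
    exact Generic.of_eval _ b (by rwa [key]) fun b hb => ⟨q i, hq i, by rwa [key] at hb⟩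
  by_contra! H
  simp only [e, map_add, map_smul, smul_eq_mul] at H
  have h0 := H 0
  have h1 := H ![1, 0, 0]
  have h2 := H ![0, 1, 0]
  have h3 := H ![0, 0, 1]
  simp at h0 h1 h2 h3
  simp only [h0, zero_add] at h1 h2 h3
  exact hi (by fin_cases i <;> assumption)

lemma generic_transversal [IsAlgClosed k] {f : R4 k} (hf : f ∈ RZ k 3)
    (h1 : eval ![0, 1, 0, 0] f ≠ 0)
    (h2 : (lineCubic f (![0, 1, 0, 0] : Fin 4 → k) ![0, 0, 1, 0]).discr ≠ 0) :
    Generic fun b => ∃ r, Transversal f b r := by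
  have key : ∀ (b : Fin 3 → k) (j : Fin 3) (x y z : k),
      (fun i : Fin 4 => aeval b ((![-X j, C x, C y, C z] : Fin 4 → MvPolynomial (Fin 3) k) i)) =
      ![-b j, x, y, z] := fun b j x y z => by
    ext i; fin_cases i <;> simp
  have h1' : Generic fun b : Fin 3 → k => eval ![-b 0, 1, 0, 0] f ≠ 0 := by
    have e : ∀ b : Fin 3 → k,
        eval b (aeval (![-X 0, C 1, C 0, C 0] : Fin 4 → MvPolynomial (Fin 3) k) f) =
        eval ![-b 0, 1, 0, 0] f := fun b => by
      rw [← MvPolynomial.coe_aeval_eq_eval, ← MvPolynomial.coe_aeval_eq_eval, ← key]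
      exact DFunLike.congr_fun (comp_aeval _ (aeval b)) f
    exact Generic.of_eval _ 0 (by rw [e]; simpa using h1) fun b hb => by rwa [e] at hb
  have h2' : Generic fun b : Fin 3 → k =>
      (lineCubic f ![-b 0, 1, 0, 0] ![-b 1, 0, 1, 0]).discr ≠ 0 := by
    have e : ∀ b : Fin 3 → k,
        eval b (lineCubic f (![-X 0, C 1, C 0, C 0] : Fin 4 → MvPolynomial (Fin 3) k)
        ![-X 1, C 0, C 1, C 0]).discr =
        (lineCubic f ![-b 0, 1, 0, 0] ![-b 1, 0, 1, 0]).discr := fun b => by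
      rw [← MvPolynomial.coe_aeval_eq_eval]
      refine (map_lineDiscr (aeval b) f _ _).trans ?_
      rw [key, key]
    exact Generic.of_eval _ 0 (by rw [e]; simpa using h2) fun b hb => by rwa [e] at hb
  obtain ⟨p, hp, h⟩ := h1'.and h2'
  exact ⟨p, hp, fun b hb => exists_transversal hf (h b hb).1 (h b hb).2⟩

lemma pt_ne_zero (b : Fin 3 → k) (t : k) : pt b t ≠ 0 := fun h => by
  simpa [pt] using congrFun h 2

lemma exists_lines [IsAlgClosed k] {f : R4 k} (hf : f ∈ RZ k 3)
    (h1 : eval ![0, 1, 0, 0] f ≠ 0)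
    (h2 : (lineCubic f (![0, 1, 0, 0] : Fin 4 → k) ![0, 0, 1, 0]).discr ≠ 0)
    (L : R4 k →ₗ[k] k) {N : ℤ} {F : R4 k} (hF : F ∈ RZ k N) (hL : L F ≠ 0) (n : ℕ) (hn : n ≤ N) :
    ∃ b r : Fin n → Fin 3 → k, (∀ l, Transversal f (b l) (r l)) ∧
      (∀ l l' s, l ≠ l' → eval (pt (b l) (r l s)) (lin (b l')) ≠ 0) ∧
      ∃ G ∈ RZ k (N - n), L ((∏ l, lin (b l)) * G) ≠ 0 := by
  induction n with
  | zero => exact ⟨Fin.elim0, Fin.elim0, fun l => l.elim0, fun l => l.elim0, F, by simpa using hF,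
      by simpa using hL⟩
  | succ n ih =>
    push_cast at hn
    obtain ⟨b, r, ht, hoff, G, hG, hLG⟩ := ih (by omega)
    obtain ⟨b', ⟨r', hr'⟩, ⟨G', hG', hL'⟩, hb'⟩ := ((generic_transversal hf h1 h2).and
      ((generic_apply_lin_mul L _ (by omega) hG hLG).and
      (Generic.forall fun l => Generic.forall fun s =>
        generic_lin_ne (pt_ne_zero (b l) (r l s))))).exists
    refine ⟨Fin.snoc b b', Fin.snoc r r', fun l => ?_, fun l l' s hll => ?_, G', ?_, ?_⟩
    · induction l using Fin.lastCases with
      | last => simpa using hr'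
      | cast l => simpa using ht l
    · induction l using Fin.lastCases with
      | last =>
        induction l' using Fin.lastCases with
        | last => exact absurd rfl hll
        | cast l' =>
          simp only [Fin.snoc_last, Fin.snoc_castSucc]
          intro h0
          have e : pt b' (r' s) = pt (b l') (r' s) := by
            rw [eval_lin] at h0
            have : pt b' (r' s) 0 = pt (b l') (r' s) 0 := by
              simp [pt] at h0 ⊢
              linear_combination h0
            ext i
            fin_cases i
            · exact this
            all_goals rfl
          obtain ⟨s', hs'⟩ := (ht l').exists_root hf (e ▸ hr'.onX s)
          refine hb' l' s' ?_
          rw [← hs', ← e, eval_lin_pt]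
      | cast l =>
        induction l' using Fin.lastCases with
        | last => simpa using hb' l s
        | cast l' => simpa using hoff l l' s (by rintro rfl; exact hll rfl)
    · convert hG' using 2
      push_cast
      ring
    · rw [Fin.prod_univ_castSucc]
      simpa using hL'

lemma exists_stepData [IsAlgClosed k] {f : R4 k} (hf : f ∈ RZ k 3)
    (h0 : eval ![1, 0, 0, 0] f = 0) (h1 : eval ![0, 1, 0, 0] f ≠ 0)
    (h2 : (lineCubic f (![0, 1, 0, 0] : Fin 4 → k) ![0, 0, 1, 0]).discr ≠ 0)
    {ι : Type*} [Fintype ι] {n : ℕ} {v : ι → Fin 4 → k} (hQ : QProp f n v) (hv : ∀ i, v i 3 ≠ 0)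
    {θ : ι → Fin 4 → k} (hdot : ∀ i, ∑ j, θ i j * v i j = 0)
    (hsum : ∀ F ∈ RZ k ((n : ℤ) - 1), ∀ j, ∑ i, θ i j * eval (v i) F = 0)
    (hθ : ∃ i, θ i 0 ≠ 0) : ∃ b r : Fin n → Fin 3 → k, StepData f v b r θ := by
  classical
  obtain ⟨i₀, hi₀⟩ := hθ
  let L : R4 k →ₗ[k] k := ∑ i, (θ i 0 / v i 3) • (LinearMap.proj i ∘ₗ evL v)
  have hL : ∀ F, L F = ∑ i, θ i 0 * (eval (v i) F / v i 3) := fun F => by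
    simp only [L, LinearMap.sum_apply, LinearMap.smul_apply, LinearMap.comp_apply,
      LinearMap.proj_apply, evL_apply, smul_eq_mul]
    exact Finset.sum_congr rfl fun i _ => by ring
  obtain ⟨F, hF, hFi⟩ := hQ.interp (Pi.single i₀ 1)
  have hLF : L F ≠ 0 := by
    rw [hL, Finset.sum_eq_single i₀]
    · simp [hFi, hi₀, hv]
    · intro i _ hi
      simp [hFi, hi]
    · simp
  obtain ⟨b, r, ht, hoff, G, hG, hLG⟩ := exists_lines hf h1 h2 L hF hLF n le_rfl
  refine ⟨b, r, hf, h0, hv, ht, hoff, hdot, hsum, fun h => hLG ?_⟩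
  rw [sub_self] at hG
  obtain ⟨c, rfl⟩ := RZ_zero_deg hG
  rw [mul_comm, ← smul_eq_C_mul, map_smul, hL, h, smul_zero]

end

section
variable {k : Type} [Field k]

/-- Substitution of the linear forms given by the rows of a matrix. -/
noncomputable def subst (A : Matrix (Fin 4) (Fin 4) k) : R4 k →ₐ[k] R4 k :=
  aeval fun i => ∑ j, C (A i j) * X j

lemma subst_X (A : Matrix (Fin 4) (Fin 4) k) (i : Fin 4) :
    subst A (X i) = ∑ j, C (A i j) * X j := by
  simp [subst]

lemma eval_subst (A : Matrix (Fin 4) (Fin 4) k) (v : Fin 4 → k) (p : R4 k) :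
    eval v (subst A p) = eval (A.mulVec v) p := by
  have : (aeval v).comp (subst A) = aeval (A.mulVec v) := by
    ext i
    simp [subst_X, Matrix.mulVec, dotProduct]
  exact DFunLike.congr_fun this p

lemma sum_mul_sum_mul {A B : Matrix (Fin 4) (Fin 4) k} (h : B * A = 1) (i : Fin 4)
    (p : Fin 4 → R4 k) : ∑ j, C (B i j) * ∑ l, C (A j l) * p l = p i := by
  have h2 : ∀ l, ∑ j, C (B i j) * (C (A j l) * p l) = if l = i then p i else 0 := fun l => by
    simp only [← mul_assoc, ← C_mul]
    rw [← Finset.sum_mul, ← map_sum]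
    have := congrFun (congrFun h i) l
    rw [Matrix.mul_apply] at this
    rw [this, Matrix.one_apply]
    split_ifs with h1 h3 h3
    · simp [h1]
    · exact absurd h1.symm h3
    · exact absurd h3.symm h1
    · simp
  simp only [Finset.mul_sum]
  rw [Finset.sum_comm, Finset.sum_congr rfl fun l _ => h2 l]
  simp

lemma subst_subst {A B : Matrix (Fin 4) (Fin 4) k} (h : B * A = 1) (p : R4 k) :
    subst A (subst B p) = p := by
  have : (subst A).comp (subst B) = AlgHom.id k _ := by
    ext i : 1
    simp only [AlgHom.comp_apply, subst_X, map_sum, map_mul, AlgHom.id_apply]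
    simp only [← algebraMap_eq, AlgHom.commutes]
    simp only [algebraMap_eq]
    exact sum_mul_sum_mul h i X
  exact DFunLike.congr_fun this p

lemma subst_mem (A : Matrix (Fin 4) (Fin 4) k) {n : ℤ} {p : R4 k} (hp : p ∈ RZ k n) :
    subst A p ∈ RZ k n := by
  rcases lt_or_ge n 0 with hn | hn
  · rw [RZ_neg hn hp, map_zero]
    exact Submodule.zero_mem _
  lift n to ℕ using hn
  rw [mem_RZ_nat] at hp ⊢
  have := hp.aeval (fun i => ∑ j, C (A i j) * X j) (n := 1) fun i =>
    IsHomogeneous.sum _ _ _ fun j _ => by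
      simpa using (isHomogeneous_C (Fin 4) (A i j)).mul (isHomogeneous_X k j)
  simpa [subst] using this

lemma lineCubic_subst (A : Matrix (Fin 4) (Fin 4) k) (f : R4 k) (U W : Fin 4 → k) :
    lineCubic (subst A f) U W = lineCubic f (A.mulVec U) (A.mulVec W) := by
  have : lineRes (subst A f) U W = lineRes f (A.mulVec U) (A.mulVec W) := by
    have : (aeval fun i => Polynomial.X * Polynomial.C (U i) + Polynomial.C (W i)).comp
        (subst A) = aeval fun i => Polynomial.X * Polynomial.C (A.mulVec U i) +
          Polynomial.C (A.mulVec W i) := by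
      ext i : 1
      simp [subst_X, Matrix.mulVec, dotProduct, mul_add, Finset.sum_add_distrib, Finset.mul_sum,
        Polynomial.algebraMap_eq]
      exact Finset.sum_congr rfl fun _ _ => by ring
    exact DFunLike.congr_fun this f
  simp only [lineCubic, this]

variable {f : R4 k} {a : ℤ} {ι : Type*} [Fintype ι] {v : ι → Fin 4 → k}

/-- Invariance of the properties under linear changes of coordinates. -/
lemma QProp.subst (hQ : QProp f a v) {A B : Matrix (Fin 4) (Fin 4) k} (hAB : A * B = 1)
    (hBA : B * A = 1) : QProp (subst A f) a fun i => B.mulVec (v i) := by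
  have evA : ∀ i (p : R4 k), eval (B.mulVec (v i)) (CubicMRC.subst A p) = eval (v i) p :=
    fun i p => by rw [eval_subst, Matrix.mulVec_mulVec, hAB, Matrix.one_mulVec]
  refine ⟨hQ.card, fun i => ?_, fun c => ?_, fun F hF h => ?_, fun T hT h => ?_,
    fun ha F hF h => ?_⟩
  · rw [evA, hQ.onX]
  · obtain ⟨F, hF, e⟩ := hQ.interp c
    exact ⟨_, subst_mem A hF, fun i => by rw [evA, e]⟩
  · have := hQ.dvd_of_vanish _ (subst_mem B hF) fun i => by rw [eval_subst, h]
    rw [← subst_subst hBA F]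
    exact map_dvd _ this
  · obtain ⟨U, hU⟩ := hQ.euler (fun j => ∑ l, C (A j l) * CubicMRC.subst B (T l))
      (fun j => Submodule.sum_mem _ fun l _ => C_mul_mem (subst_mem B (hT l)) _) fun i j m => by
      have hv : ∀ m, v i m = ∑ p, A m p * B.mulVec (v i) p := fun m => by
        have : A.mulVec (B.mulVec (v i)) = v i := by
          rw [Matrix.mulVec_mulVec, hAB, Matrix.one_mulVec]
        exact (congrFun this m).symm
      simp only [map_sum, map_mul, eval_C, eval_subst, hv m, hv j, Finset.sum_mul_sum]
      rw [Finset.sum_comm]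
      refine Finset.sum_congr rfl fun p _ => Finset.sum_congr rfl fun l _ => ?_
      linear_combination A j l * A m p * h i l p
    refine ⟨CubicMRC.subst A U, fun l => ?_⟩
    have h1 := Finset.dvd_sum fun j (_ : j ∈ Finset.univ) =>
      (map_dvd (CubicMRC.subst A) (hU j)).mul_left (C (B l j))
    convert h1 using 1
    simp only [map_sub, mul_sub, Finset.sum_sub_distrib, map_sum, map_mul, subst_X]
    simp only [← algebraMap_eq, AlgHom.commutes, subst_subst hBA]
    simp only [algebraMap_eq, ← mul_assoc, ← Finset.sum_mul]
    rw [sum_mul_sum_mul hBA]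
    congr 2
    exact (sum_mul_sum_mul hBA l X).symm
  · obtain ⟨G, hG, e⟩ := hQ.gen ha _ (subst_mem B hF) fun i => by rw [eval_subst, h]
    refine ⟨fun l => ∑ j, C (A j l) * CubicMRC.subst A (G j), fun l =>
      ⟨Submodule.sum_mem _ fun j _ => C_mul_mem (subst_mem A (hG j).1) _, fun i => ?_⟩, ?_⟩
    · simp [evA, (hG _).2]
    · have := map_dvd (CubicMRC.subst A) e
      rw [map_sub, subst_subst hBA, map_sum] at this
      convert this using 2
      simp only [map_mul, subst_X, Finset.mul_sum, Finset.sum_mul]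
      rw [Finset.sum_comm]
      exact Finset.sum_congr rfl fun _ _ => Finset.sum_congr rfl fun _ _ => by ring

end

section
variable {k : Type} [Field k]

lemma exists_eval_ne_of_not_dvd [IsAlgClosed k] {f G : R4 k} (hf : Prime f) (h : ¬ f ∣ G) :
    ∃ v, eval v f = 0 ∧ eval v G ≠ 0 := by
  have hP : (Ideal.span {f}).IsPrime := (Ideal.span_singleton_prime hf.ne_zero).2 hf
  by_contra! H
  refine h (Ideal.mem_span_singleton.1 ?_)
  rw [← IsPrime.vanishingIdeal_zeroLocus (K := k) (Ideal.span {f})]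
  intro v hv
  exact H v (hv f (Ideal.mem_span_singleton_self f))

/-- The linear form with given coefficients. -/
noncomputable def linf (c : Fin 4 → k) : R4 k := ∑ j, C (c j) * X j

lemma eval_linf (c v : Fin 4 → k) : eval v (linf c) = ∑ j, c j * v j := by
  simp [linf]

lemma linf_mem (c : Fin 4 → k) : linf c ∈ RZ k 1 :=
  Submodule.sum_mem _ fun j _ => C_mul_mem (X_mem_RZ j) _

lemma linf_ne_zero {c : Fin 4 → k} (hc : c ≠ 0) : linf c ≠ 0 := by
  obtain ⟨j, hj⟩ := Function.ne_iff.1 hc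
  intro h
  have := eval_linf c (Pi.single j 1)
  rw [h, map_zero] at this
  simp [Pi.single_apply] at this
  exact hj this.symm

lemma not_dvd_of_mem {f : R4 k} {m n : ℤ} (hf : f ∈ RZ k m) {p : R4 k} (hp : p ∈ RZ k n)
    (hn : n < m) (h0 : p ≠ 0) : ¬ f ∣ p := fun h => by
  obtain ⟨q, hq, rfl⟩ := exists_quot hf hp h
  exact h0 (by rw [RZ_neg (by omega) hq, mul_zero])

lemma not_dvd_linf {f : R4 k} (hf : f ∈ RZ k 3) {c : Fin 4 → k} (hc : c ≠ 0) : ¬ f ∣ linf c :=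
  not_dvd_of_mem hf (linf_mem c) (by norm_num) (linf_ne_zero hc)

lemma pderiv_mem {n : ℕ} {p : R4 k} (hp : p ∈ RZ k (n + 1 : ℕ)) (i : Fin 4) :
    pderiv i p ∈ RZ k n := by
  rw [mem_RZ_nat] at hp ⊢
  simpa using hp.pderiv (i := i)

lemma coeff_one_lineRes (F : R4 k) (U W : Fin 4 → k) : (lineRes F U W).coeff 0 = eval W F ∧
    (lineRes F U W).coeff 1 = ∑ j, U j * eval W (pderiv j F) := by
  induction F using MvPolynomial.induction_on with
  | C c => simp [lineRes, Polynomial.algebraMap_eq]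
  | add p q hp hq =>
    have : lineRes (p + q) U W = lineRes p U W + lineRes q U W := map_add _ _ _
    rw [this, Polynomial.coeff_add, Polynomial.coeff_add, hp.1, hp.2, hq.1, hq.2]
    simp [mul_add, Finset.sum_add_distrib]
  | mul_X p i hp =>
    have : lineRes (p * X i) U W = lineRes p U W * Polynomial.C (U i) * Polynomial.X +
        lineRes p U W * Polynomial.C (W i) := by
      simp only [lineRes, map_mul, aeval_X]
      ring
    rw [this]
    constructor
    · simp [hp.1]
    · rw [Polynomial.coeff_add, Polynomial.coeff_mul_X, Polynomial.coeff_mul_C,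
        Polynomial.coeff_mul_C, hp.1, hp.2]
      have h : ∀ j, U j * eval W (pderiv j (p * X i)) = U j * eval W (pderiv j p) * W i +
          if i = j then eval W p * U j else 0 := fun j => by
        rw [pderiv_mul, pderiv_X, Pi.single_apply]
        split_ifs with hij
        · simp [hij]
          ring
        · simp
          ring
      rw [Finset.sum_congr rfl fun j _ => h j, Finset.sum_add_distrib, ← Finset.sum_mul]
      simp [add_comm]

lemma reflect_lineRes {n : ℕ} {F : R4 k} (hF : F ∈ RZ k n) (U W : Fin 4 → k) :
    (lineRes F U W).reflect n = lineRes F W U := by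
  induction n generalizing F with
  | zero =>
    obtain ⟨c, rfl⟩ := RZ_zero_deg (by simpa using hF)
    simp [lineRes, Polynomial.algebraMap_eq]
  | succ n ih =>
    obtain ⟨q, hq, rfl⟩ := exists_eq_sum_X (by positivity) hF
    have hq0 := fun i => (coeff_lineRes (f := q i) (n := n) (by simpa using hq i) U W).1
    have hq' := fun i => ih (F := q i) (by simpa using hq i)
    have e : ∀ U W : Fin 4 → k, lineRes (∑ i, X i * q i) U W = ∑ i, lineRes (q i) U W *
        (Polynomial.C (U i) * Polynomial.X + Polynomial.C (W i)) := fun U W => by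
      simp only [lineRes, map_sum, map_mul, aeval_X]
      exact Finset.sum_congr rfl fun _ _ => by ring
    rw [e, e]
    simp only [Fin.sum_univ_four, Polynomial.reflect_add]
    have h1 : ∀ i, Polynomial.reflect (n + 1) (lineRes (q i) U W *
        (Polynomial.C (U i) * Polynomial.X + Polynomial.C (W i))) =
        lineRes (q i) W U * (Polynomial.C (W i) * Polynomial.X + Polynomial.C (U i)) := fun i => by
      rw [Polynomial.reflect_mul _ _ (hq0 i) (by compute_degree), hq' i, Polynomial.reflect_add]
      congr 1
      ext m
      simp [Polynomial.coeff_X, Polynomial.coeff_C]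
      rcases m with _ | _ | m <;> simp
    rw [h1, h1, h1, h1]

lemma discr_of_eval_eq_zero {f : R4 k} (hf : f ∈ RZ k 3) {U W : Fin 4 → k} (hU : eval U f = 0)
    (hW : eval W f = 0) : (lineCubic f U W).discr =
      (∑ j, W j * eval U (pderiv j f)) ^ 2 * (∑ j, U j * eval W (pderiv j f)) ^ 2 := by
  have h3 := (coeff_lineRes (n := 3) hf U W).2
  have h2 := (coeff_one_lineRes f W U).2
  rw [← reflect_lineRes (n := 3) hf, Polynomial.coeff_reflect] at h2
  simp only [Polynomial.revAt_le (show 1 ≤ 3 by norm_num)] at h2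
  norm_num at h2
  rw [Cubic.discr, lineCubic]
  simp only [h3, h2, (coeff_one_lineRes f U W).1, (coeff_one_lineRes f U W).2, hU, hW]
  ring

lemma exists_discr_ne_zero [IsAlgClosed k] {f : R4 k} (hf : f ∈ RZ k 3) (hfp : Prime f)
    (hs : ∀ v ≠ 0, eval v f = 0 → ∃ i, eval v (pderiv i f) ≠ 0) :
    ∃ U W : Fin 4 → k, (lineCubic f U W).discr ≠ 0 := by
  obtain ⟨j, hj⟩ : ∃ j, pderiv j f ≠ 0 := by
    obtain ⟨v, hv, hv0⟩ := exists_eval_ne_of_not_dvd hfp (not_dvd_linf hf (c := Pi.single 0 1)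
      (by simp))
    obtain ⟨i, hi⟩ := hs v (by rintro rfl; exact hv0 (by rw [eval_linf]; simp)) hv
    exact ⟨i, fun h => hi (by rw [h, map_zero])⟩
  obtain ⟨c, hc⟩ : ∃ c, eval c (pderiv j f) ≠ 0 := by
    by_contra! H
    exact hj (MvPolynomial.funext fun c => by rw [H c, map_zero])
  obtain ⟨b, hb, hb1⟩ := exists_eval_ne_of_not_dvd hfp
    (not_dvd_linf hf (c := fun j => eval c (pderiv j f)) fun h => hc (congrFun h j))
  rw [eval_linf] at hb1
  obtain ⟨i, hi⟩ := hs b (by rintro rfl; simp at hb1) hb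
  have h1 := not_dvd_linf hf (c := fun j => eval b (pderiv j f)) fun h => hi (congrFun h i)
  have h2 : ¬ f ∣ ∑ j, C (b j) * pderiv j f := by
    refine not_dvd_of_mem hf (n := 2) (Submodule.sum_mem _ fun j _ => C_mul_mem
      (pderiv_mem (n := 2) hf j) _) (by norm_num) fun h => hb1 ?_
    have := congrArg (eval c) h
    simpa [mul_comm] using this
  obtain ⟨a, ha, ha1⟩ := exists_eval_ne_of_not_dvd hfp fun h => (hfp.dvd_or_dvd h).elim h1 h2
  rw [map_mul, eval_linf] at ha1
  refine ⟨a, b, ?_⟩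
  rw [discr_of_eval_eq_zero hf ha hb]
  refine mul_ne_zero (pow_ne_zero _ ?_) (pow_ne_zero _ ?_)
  · simpa using right_ne_zero_of_mul ha1
  · simpa [mul_comm] using left_ne_zero_of_mul ha1

end

section
variable {k : Type} [Field k]
variable {f : R4 k} {a : ℤ} {ι : Type*} [Fintype ι] {v : ι → Fin 4 → k}

lemma QProp.finrank_map (hQ : QProp f a v) (hf : f ∈ RZ k 3) (hfp : Prime f) {m : ℤ} (hm : m < a) :
    Module.finrank k ((RZ k m).map (evL v)) + Module.finrank k (RZ k (m - 3)) =
      Module.finrank k (RZ k m) := by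
  have h1 := finrank_ker_add (evL v) (K := IZ v m) (M := RZ k m) (N := (RZ k m).map (evL v))
    (fun x => by simp [IZ]) (fun x hx => Submodule.mem_map_of_mem hx) fun y hy => hy
  have h2 := finrank_ker_add (LinearMap.mulLeft k f) (K := ⊥) (M := RZ k (m - 3)) (N := IZ v m)
    (fun x => by
      simp only [Submodule.mem_bot, LinearMap.mulLeft_apply, mul_eq_zero, hfp.ne_zero, false_or]
      exact ⟨fun h => ⟨h ▸ Submodule.zero_mem _, h⟩, fun h => h.2⟩)
    (fun x hx => mem_IZ.2 ⟨mul_mem_RZ hf hx (by ring), fun i => by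
      simp [hQ.onX i]⟩)
    fun y hy => by
      obtain ⟨q, hq, e⟩ := exists_quot hf (mem_IZ.1 hy).1 (hQ.dvd_of_mem hfp hf hm hy)
      exact ⟨q, hq, e.symm⟩
  rw [finrank_bot, zero_add] at h2
  omega

lemma apply_eq_sum_single [DecidableEq ι] (g : (ι → Fin 4 → k) →ₗ[k] k) (w : ι → Fin 4 → k) :
    g w = ∑ i, ∑ j, w i j * g (Pi.single i (Pi.single j 1)) := by
  have : w = ∑ i, ∑ j, w i j • (Pi.single i (Pi.single j 1) : ι → Fin 4 → k) := by
    ext i j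
    simp only [Finset.sum_apply, Pi.smul_apply, smul_eq_mul]
    rw [Finset.sum_eq_single i, Finset.sum_eq_single j]
    · simp
    · intro l _ hl
      simp [hl.symm]
    · simp
    · intro i' _ hi
      simp [hi.symm]
    · simp
  conv_lhs => rw [this]
  simp

/-- A nonzero functional orthogonal to the tangent directions obtained from forms of degree
`n - 1` and from the points themselves. -/
lemma QProp.exists_functional {n : ℕ} (hQ : QProp f n v) (hf : f ∈ RZ k 3) (hfp : Prime f)
    (hn : 1 ≤ n) : ∃ θ : ι → Fin 4 → k, (∀ i, ∑ j, θ i j * v i j = 0) ∧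
      (∀ F ∈ RZ k ((n : ℤ) - 1), ∀ j, ∑ i, θ i j * eval (v i) F = 0) ∧ ∃ i, θ i ≠ 0 := by
  classical
  set V₁ := (RZ k ((n : ℤ) - 1)).map (evL v) with hV₁
  set V₂ := (RZ k ((n : ℤ) - 2)).map (evL v) with hV₂
  let T : (Fin 4 → V₁) × (ι → k) →ₗ[k] (ι → Fin 4 → k) :=
    { toFun := fun x i j => (x.1 j).1 i + x.2 i * v i j
      map_add' := fun x y => by ext i j; simp; ring
      map_smul' := fun c x => by ext i j; simp; ring }
  have hmul : ∀ (x : V₂) (j : Fin 4), (fun i => v i j * x.1 i) ∈ V₁ := by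
    rintro ⟨_, F, hF, rfl⟩ j
    exact ⟨X j * F, X_mul_mem hF j (by ring), by ext i; simp [evL_apply]⟩
  let K : V₂ →ₗ[k] (Fin 4 → V₁) × (ι → k) :=
    { toFun := fun x => (fun j => ⟨fun i => v i j * x.1 i, hmul x j⟩, -x.1)
      map_add' := fun x y => by ext i j <;> simp <;> ring
      map_smul' := fun c x => by ext i j <;> simp; ring }
  have hK : Function.Injective K := fun x y h => by
    have := (Prod.ext_iff.1 h).2
    exact Subtype.ext (neg_injective this)
  have hTK : K.range ≤ T.ker := by
    rintro _ ⟨x, rfl⟩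
    rw [LinearMap.mem_ker]
    ext i j
    simp [T, K]
    ring
  have h1 := LinearMap.finrank_range_add_finrank_ker T
  have h2 := Submodule.finrank_mono hTK
  rw [LinearMap.finrank_range_of_inj hK] at h2
  rw [Module.finrank_prod, Module.finrank_pi_fintype, Module.finrank_fintype_fun_eq_card] at h1
  simp only [Finset.sum_const, Finset.card_univ, Fintype.card_fin, smul_eq_mul] at h1
  have h3 := hQ.finrank_map hf hfp (m := (n : ℤ) - 1) (by omega)
  have h4 := hQ.finrank_map hf hfp (m := (n : ℤ) - 2) (by omega)
  have h5 := finrank_RZ (k := k) (n := (n : ℤ) - 1) (by omega)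
  have h6 := finrank_RZ (k := k) (n := (n : ℤ) - 1 - 3) (by omega)
  have h7 := finrank_RZ (k := k) (n := (n : ℤ) - 2) (by omega)
  have h9 := hQ.card
  have hlt : Module.finrank k T.range < 4 * Fintype.card ι := by
    rw [← hV₁] at h3
    rw [← hV₂] at h4
    zify at h1 h2 h3 h4 ⊢
    rcases hn.eq_or_lt with rfl | hn
    · norm_num at h3 h5 h6 h9
      omega
    · have h8 := finrank_RZ (k := k) (n := (n : ℤ) - 2 - 3) (by omega)
      nlinarith
  have hne : T.range < ⊤ := lt_top_iff_ne_top.2 fun h => by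
    rw [h, finrank_top, Module.finrank_pi_fintype] at hlt
    simp [mul_comm] at hlt
  obtain ⟨g, hg, hle⟩ := Submodule.exists_le_ker_of_lt_top _ hne
  have hg' : ∀ (t : Fin 4 → V₁) (c : ι → k), ∑ i, ∑ j, ((t j).1 i + c i * v i j) *
      g (Pi.single i (Pi.single j 1)) = 0 := fun t c => by
    rw [← apply_eq_sum_single g (fun i j => (t j).1 i + c i * v i j)]
    exact hle ⟨(t, c), rfl⟩
  refine ⟨fun i j => g (Pi.single i (Pi.single j 1)), fun i => ?_, fun F hF j => ?_, ?_⟩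
  · have := hg' 0 (Pi.single i 1)
    rw [Finset.sum_eq_single i] at this
    · simpa [mul_comm] using this
    · intro i' _ hi
      simp [hi]
    · simp
  · have := hg' (Pi.single j ⟨evL v F, F, hF, rfl⟩) 0
    rw [Finset.sum_comm, Finset.sum_eq_single j] at this
    · simpa [mul_comm, evL_apply] using this
    · intro j' _ hj
      simp [hj]
    · simp
  · by_contra! H
    refine hg (LinearMap.ext fun w => ?_)
    rw [apply_eq_sum_single g w]
    exact Finset.sum_eq_zero fun i _ => Finset.sum_eq_zero fun j _ => by
      rw [show g (Pi.single i (Pi.single j 1)) = 0 from congrFun (H i) j, mul_zero]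

end

section
variable {k : Type} [Field k]

lemma exists_point [IsAlgClosed k] {f : R4 k} (hf : f ∈ RZ k 3) (hfp : Prime f) {ι : Type*}
    [Fintype ι] {v : ι → Fin 4 → k} (hv : ∀ i, v i ≠ 0) {c : Fin 4 → k} (hc : c ≠ 0) :
    ∃ P, eval P f = 0 ∧ ∑ j, c j * P j ≠ 0 ∧ ∀ i, ∃ l m, P l * v i m ≠ P m * v i l := by
  choose m hm using fun i => Function.ne_iff.1 (hv i)
  choose l hl using fun i => exists_ne (m i)
  let d : ι → Fin 4 → k := fun i => Pi.single (l i) (v i (m i)) - Pi.single (m i) (v i (l i))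
  have hd : ∀ i, d i ≠ 0 := fun i h => hm i (by
    simpa [d, hl i] using congrFun h (l i))
  obtain ⟨P, hP, h⟩ := exists_eval_ne_of_not_dvd (G := linf c * ∏ i, linf (d i)) hfp fun h => by
    rcases hfp.dvd_or_dvd h with h | h
    · exact not_dvd_linf hf hc h
    · obtain ⟨i, -, h⟩ := hfp.exists_mem_finset_dvd h
      exact not_dvd_linf hf (hd i) h
  rw [map_mul, map_prod, mul_ne_zero_iff, Finset.prod_ne_zero_iff, eval_linf] at h
  refine ⟨P, hP, h.1, fun i => ⟨l i, m i, fun e => h.2 i (Finset.mem_univ i) ?_⟩⟩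
  rw [eval_linf]
  simp [d, sub_mul, Finset.sum_sub_distrib, Pi.single_apply]
  linear_combination e

/-- The matrix with four given columns. -/
def frame {A : Type*} (c₀ c₁ c₂ c₃ : Fin 4 → A) : Matrix (Fin 4) (Fin 4) A :=
  Matrix.of fun i => ![c₀ i, c₁ i, c₂ i, c₃ i]

lemma exists_frame_det_ne_zero {P z : Fin 4 → k} (h : ∃ l m, P l * z m ≠ P m * z l) :
    ∃ u w, (frame P u w z).det ≠ 0 := by
  by_contra! H
  have h01 := H ![0, 0, 1, 0] ![0, 0, 0, 1]
  have h02 := H ![0, 1, 0, 0] ![0, 0, 0, 1]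
  have h03 := H ![0, 1, 0, 0] ![0, 0, 1, 0]
  have h12 := H ![1, 0, 0, 0] ![0, 0, 0, 1]
  have h13 := H ![1, 0, 0, 0] ![0, 0, 1, 0]
  have h23 := H ![1, 0, 0, 0] ![0, 1, 0, 0]
  simp [frame, Matrix.det_succ_row_zero, Fin.sum_univ_succ, Fin.succAbove]
    at h01 h02 h03 h12 h13 h23
  obtain ⟨l, m, h⟩ := h
  fin_cases l <;> fin_cases m <;> first | exact h rfl | (simp only at h; grind)

lemma exists_frame [IsAlgClosed k] {f : R4 k} (hf : f ∈ RZ k 3) (hfp : Prime f)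
    (hs : ∀ v ≠ 0, eval v f = 0 → ∃ i, eval v (pderiv i f) ≠ 0) {ι : Type*} [Finite ι]
    {v : ι → Fin 4 → k} {P : Fin 4 → k} (hP : ∀ i, ∃ l m, P l * v i m ≠ P m * v i l) :
    ∃ u w : Fin 4 → k, eval u f ≠ 0 ∧ (lineCubic f u w).discr ≠ 0 ∧
      ∀ i, (frame P u w (v i)).det ≠ 0 := by
  let u : (Fin 2 × Fin 4 → k) → Fin 4 → k := fun x j => x (0, j)
  let w : (Fin 2 × Fin 4 → k) → Fin 4 → k := fun x j => x (1, j)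
  let pair : (Fin 4 → k) → (Fin 4 → k) → Fin 2 × Fin 4 → k := fun a b q => ![a, b] q.1 q.2
  have h1 : Generic fun x => eval (u x) f ≠ 0 := by
    have key : ∀ x, eval x (rename (Prod.mk (0 : Fin 2)) f) = eval (u x) f := fun x =>
      eval_rename _ _ _
    obtain ⟨a, ha⟩ : ∃ a, eval a f ≠ 0 := by
      by_contra! H
      exact hfp.ne_zero (MvPolynomial.funext fun c => by rw [H c, map_zero])
    exact Generic.of_eval _ (pair a a) (by rw [key]; exact ha) fun x hx => by rwa [key] at hx
  have h2 : Generic fun x => (lineCubic f (u x) (w x)).discr ≠ 0 := by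
    have key : ∀ x, eval x (lineCubic f (fun j => (X (0, j) : MvPolynomial (Fin 2 × Fin 4) k))
        fun j => X (1, j)).discr = (lineCubic f (u x) (w x)).discr := fun x => by
      refine (map_lineDiscr (aeval x) f _ _).trans ?_
      simp only [aeval_X, u, w]
    obtain ⟨a, b, h⟩ := exists_discr_ne_zero hf hfp hs
    exact Generic.of_eval _ (pair a b) (by rw [key]; exact h) fun x hx => by rwa [key] at hx
  have h3 : Generic fun x => ∀ i, (frame P (u x) (w x) (v i)).det ≠ 0 := by
    refine Generic.forall fun i => ?_
    have key : ∀ x, eval x (frame (fun j => C (P j)) (fun j => (X (0, j) : MvPolynomial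
        (Fin 2 × Fin 4) k)) (fun j => X (1, j)) fun j => C (v i j)).det =
        (frame P (u x) (w x) (v i)).det := fun x => by
      rw [RingHom.map_det]
      congr 1
      ext l m
      fin_cases m <;> simp [frame, u, w]
    obtain ⟨a, b, h⟩ := exists_frame_det_ne_zero (hP i)
    exact Generic.of_eval _ (pair a b) (by rw [key]; exact h) fun x hx => by rwa [key] at hx
  obtain ⟨x, hx1, hx2, hx3⟩ := (h1.and (h2.and h3)).exists
  exact ⟨u x, w x, hx1, hx2, hx3⟩

lemma frame_mulVec (c₀ c₁ c₂ c₃ x : Fin 4 → k) (i : Fin 4) : (frame c₀ c₁ c₂ c₃).mulVec x i =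
    c₀ i * x 0 + c₁ i * x 1 + c₂ i * x 2 + c₃ i * x 3 := by
  simp [frame, Matrix.mulVec, dotProduct, Fin.sum_univ_four]

lemma QProp.exists_succ [IsAlgClosed k] {f : R4 k} (hf : f ∈ RZ k 3) (hfp : Prime f)
    (hs : ∀ v ≠ 0, eval v f = 0 → ∃ i, eval v (pderiv i f) ≠ 0) {ι : Type} [Fintype ι]
    {v : ι → Fin 4 → k} {n : ℕ} (hn : 1 ≤ n) (hQ : QProp f n v) :
    ∃ (κ : Type) (_ : Fintype κ) (w : κ → Fin 4 → k), QProp f (n + 1 : ℕ) w := by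
  obtain ⟨θ, hdot, hsum, i₀, hi₀⟩ := hQ.exists_functional hf hfp hn
  obtain ⟨P, hP, hθP, hpar⟩ := exists_point hf hfp (hQ.ne_zero (by omega)) hi₀
  obtain ⟨u, w, hu, huw, hdet⟩ := exists_frame hf hfp hs hpar
  set A := frame P u w (v i₀) with hA
  have hAB : A * A⁻¹ = 1 := Matrix.mul_nonsing_inv _ (hdet i₀).isUnit
  have hBA : A⁻¹ * A = 1 := Matrix.nonsing_inv_mul _ (hdet i₀).isUnit
  have hAv : ∀ i, A.mulVec (A⁻¹.mulVec (v i)) = v i := fun i => by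
    rw [Matrix.mulVec_mulVec, hAB, Matrix.one_mulVec]
  have e0 : A.mulVec ![1, 0, 0, 0] = P := by ext i; simp [hA, frame_mulVec]
  have e1 : A.mulVec ![0, 1, 0, 0] = u := by ext i; simp [hA, frame_mulVec]
  have e2 : A.mulVec ![0, 0, 1, 0] = w := by ext i; simp [hA, frame_mulVec]
  have hQ' := hQ.subst hAB hBA
  have hne : ∀ i, A⁻¹.mulVec (v i) 3 ≠ 0 := fun i h => hdet i <| by
    refine Matrix.exists_mulVec_eq_zero_iff.1 ⟨A⁻¹.mulVec (v i) - Pi.single 3 1, fun h0 => ?_, ?_⟩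
    · simpa [h] using congrFun h0 3
    · ext l
      have : (frame P u w (v i₀)).mulVec (A⁻¹.mulVec (v i)) l = v i l := congrFun (hAv i) l
      rw [frame_mulVec, h] at this
      rw [frame_mulVec]
      simp [h]
      linear_combination this
  have hdot' : ∀ i, ∑ j, (∑ m, θ i m * A m j) * A⁻¹.mulVec (v i) j = 0 := fun i => by
    have hv : ∀ m, v i m = ∑ j, A m j * A⁻¹.mulVec (v i) j := fun m => (congrFun (hAv i) m).symm
    rw [← hdot i]
    simp only [Finset.sum_mul]
    rw [Finset.sum_comm]
    refine Finset.sum_congr rfl fun m _ => ?_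
    conv_rhs => rw [hv m, Finset.mul_sum]
    exact Finset.sum_congr rfl fun _ _ => by ring
  have hsum' : ∀ F ∈ RZ k ((n : ℤ) - 1), ∀ j,
      ∑ i, (∑ m, θ i m * A m j) * eval (A⁻¹.mulVec (v i)) F = 0 := fun F hF j => by
    have := fun m => hsum _ (subst_mem A⁻¹ hF) m
    simp only [eval_subst] at this
    simp only [Finset.sum_mul]
    rw [Finset.sum_comm]
    refine Finset.sum_eq_zero fun m _ => ?_
    rw [← zero_mul (A m j), ← this m, Finset.sum_mul]
    exact Finset.sum_congr rfl fun _ _ => by ring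
  obtain ⟨b, r, hS⟩ := exists_stepData (subst_mem A hf)
    (by rw [eval_subst, e0, hP]) (by rwa [eval_subst, e1])
    (by rwa [lineCubic_subst, e1, e2]) hQ' hne hdot' hsum' ⟨i₀, by simpa [hA, frame] using hθP⟩
  have h := (hS.qProp hQ' hn).subst hBA hAB
  rw [subst_subst hAB] at h
  exact ⟨_, _, _, h⟩

lemma exists_qProp_one [IsAlgClosed k] {f : R4 k} (hf : f ∈ RZ k 3) (hfp : Prime f) :
    ∃ v : Fin 2 → Fin 4 → k, QProp f 1 v := by
  obtain ⟨p, hp, hp0⟩ := exists_eval_ne_of_not_dvd hfp (not_dvd_linf hf (c := Pi.single 0 1)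
    (by simp))
  obtain ⟨q, hq, -, hpq⟩ := exists_point hf hfp (v := fun _ : Unit => p)
    (fun _ => by rintro rfl; exact hp0 (by rw [eval_linf]; simp)) (c := Pi.single 0 1) (by simp)
  obtain ⟨l, m, h⟩ := hpq ()
  have hD : q l * p m - q m * p l ≠ 0 := sub_ne_zero.2 h
  refine ⟨![p, q], by simp, ?_, fun c => ?_, fun F hF hv => ?_, fun T hT hv => ?_, by norm_num⟩
  · simp [Fin.forall_fin_two, hp, hq]
  · refine ⟨C (c 0 / (q l * p m - q m * p l)) * (C (q l) * X m - C (q m) * X l) +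
      C (c 1 / (q l * p m - q m * p l)) * (C (p m) * X l - C (p l) * X m),
      Submodule.add_mem _ (C_mul_mem (Submodule.sub_mem _ (C_mul_mem (X_mem_RZ m) _)
        (C_mul_mem (X_mem_RZ l) _)) _) (C_mul_mem (Submodule.sub_mem _ (C_mul_mem (X_mem_RZ l) _)
        (C_mul_mem (X_mem_RZ m) _)) _), ?_⟩
    simp only [Fin.forall_fin_two]
    constructor <;> simp <;> field_simp <;> ring
  · obtain ⟨c, rfl⟩ := RZ_zero_deg (by simpa using hF)
    have : c = 0 := by simpa using hv 0
    simp [this]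
  · choose t ht using fun j => RZ_zero_deg (p := T j) (by simpa using hT j)
    refine ⟨0, fun j => ?_⟩
    suffices t j = 0 by simp [ht, this]
    by_contra hj
    have h0 := fun l => hv 0 j l
    have h1 := fun l => hv 1 j l
    simp only [ht, eval_C, Matrix.cons_val_zero, Matrix.cons_val_one] at h0 h1
    refine h (mul_left_cancel₀ (mul_ne_zero hj hj) ?_)
    linear_combination t j * p m * h1 l + t l * q j * h0 m - t j * p l * h1 m - t m * q j * h0 l

lemma exists_qProp [IsAlgClosed k] {f : R4 k} (hf : f ∈ RZ k 3) (hfp : Prime f)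
    (hs : ∀ v ≠ 0, eval v f = 0 → ∃ i, eval v (pderiv i f) ≠ 0) {n : ℕ} (hn : 1 ≤ n) :
    ∃ (ι : Type) (_ : Fintype ι) (v : ι → Fin 4 → k), QProp f n v := by
  induction n, hn using Nat.le_induction with
  | base =>
    obtain ⟨v, hv⟩ := exists_qProp_one hf hfp
    exact ⟨_, _, v, by simpa using hv⟩
  | succ n hn ih =>
    obtain ⟨ι, _, v, hv⟩ := ih
    exact hv.exists_succ hf hfp hs hn

end

end CubicMRC

/-- For `a ≥ 3`, a general set `Z` of `o(a) = (3/2)a(a-1) + a + 1` points on a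
smooth cubic surface `X ⊂ ℙ³` has graded minimal free resolution
`0 → R(-a-3)^a → R(-a-1)^(3a-3) ⊕ R(-a-2)^3 → R(-a)^(2a) ⊕ R(-3) → I_Z → 0`. -/
theorem mrc_cubic_resolution_o (k : Type) [Field k] [IsAlgClosed k]
    (S : SmoothCubicSurface k) (a : ℕ) (ha : 3 ≤ a) :
    GeneralPointsSatisfy k S (3 * (a * (a - 1) / 2) + a + 1) (fun Z =>
      HasMinFreeRes3 k ⊥ (pointsIdeal k (Set.range Z))
        (Fin.append (fun _ : Fin (2 * a) => a) (fun _ : Fin (1) => 3))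
        (Fin.append (fun _ : Fin (3 * a - 3) => a + 1) (fun _ : Fin (3) => a + 2))
        (fun _ : Fin (a) => a + 3)) := by
  obtain ⟨ι, _, v, hv⟩ := CubicMRC.exists_qProp
    (CubicMRC.mem_RZ_nat.2 S.homog : S.f ∈ CubicMRC.RZ k 3) S.irred.prime S.smooth (n := a)
        (by omega)
  exact CubicMRC.generalPointsSatisfy_of_qProp S a ha hv
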